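/- Fix δ with 0 < δ < 1. There exist constants c > 0 and C > 0 (depending only on δ, with c effective) with the following property: for every x ≥ 3 and every integer D with D ≡ 0 or 1 (mod 4), D not a perfect square, and |D| ≤ (log x)^{1−δ}, the counting function π₀(x) = #{p ≤ x : p an odd prime, p ∤ D, and the Legendre symbol (D/p) = −1} satisfies |π₀(x) − (1/2)∫₂ˣ dt/log t| ≤ C·x·exp(−c·√(log x)), uniformly in D. -/

import Mathlib

section
open Complex Metric

lemma exists_log_ball {f : ℂ → ℂ} {c : ℂ} {R : ℝ} (hR : 0 < R)
    (hf : DifferentiableOn ℂ f (ball c R)) (h0 : ∀ z ∈ ball c R, f z ≠ 0) :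
    ∃ g : ℂ → ℂ, (∀ z ∈ ball c R, HasDerivAt g (deriv f z / f z) z) ∧ g c = 0 ∧
      ∀ z ∈ ball c R, f z = f c * exp (g z) := by
  have hd : DifferentiableOn ℂ (fun z => deriv f z / f z) (ball c R) :=
    (hf.deriv isOpen_ball).div hf h0
  obtain ⟨g, hg⟩ := hd.isExactOn_ball
  have hc : c ∈ ball c R := mem_ball_self hR
  refine ⟨fun z => g z - g c, fun z hz => (hg z hz).sub_const _, by simp, ?_⟩
  have key : ∀ z ∈ ball c R, f z * exp (-(g z - g c)) = f c * exp (-(g c - g c)) := by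
    intro z hz
    refine (convex_ball c R).is_const_of_fderivWithin_eq_zero (𝕜 := ℂ)
      (f := fun z => f z * exp (-(g z - g c))) ?_ ?_ hz hc
    · intro w hw
      exact ((hf w hw).mul ((((hg w hw).differentiableAt.sub_const _).neg).cexp.differentiableWithinAt))
    · intro w hw
      have h1 : HasDerivAt f (deriv f w) w :=
        ((hf w hw).differentiableAt (isOpen_ball.mem_nhds hw)).hasDerivAt
      have h2 := h1.mul ((((hg w hw).sub_const (g c)).neg).cexp)
      rw [fderivWithin_of_isOpen isOpen_ball hw]
      have h3 : HasDerivAt (fun z => f z * exp (-(g z - g c))) 0 w := by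
        refine h2.congr_deriv ?_
        have h := mul_div_cancel₀ (deriv f w) (h0 w hw)
        linear_combination -(exp (-(g w - g c))) * h
      ext
      simpa using h3.deriv
  intro z hz
  have := key z hz
  simp only [sub_self, neg_zero, exp_zero, mul_one] at this
  rw [← this, mul_assoc, ← exp_add]
  simp

lemma log_deriv_bound {f : ℂ → ℂ} {c : ℂ} {R L : ℝ} (hR : 0 < R) (hL : 0 < L)
    (hf : DifferentiableOn ℂ f (ball c R)) (h0 : ∀ z ∈ ball c R, f z ≠ 0)
    (hB : ∀ z ∈ ball c R, ‖f z‖ ≤ ‖f c‖ * Real.exp L) (k : ℕ) :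
    ‖iteratedDeriv k (fun z => deriv f z / f z) c‖ ≤ (k + 1).factorial * (2 * L) * (2 / R) ^ (k + 1) := by
  obtain ⟨g, hg, hgc, hfg⟩ := exists_log_ball hR hf h0
  have hc : c ∈ ball c R := mem_ball_self hR
  have hfc := h0 c hc
  have hgd : DifferentiableOn ℂ g (ball c R) := fun z hz => (hg z hz).differentiableAt.differentiableWithinAt
  have hre : ∀ z ∈ ball c R, (g z).re ≤ L := by
    intro z hz
    have := hB z hz
    rw [hfg z hz, norm_mul, norm_exp] at this
    exact Real.exp_le_exp.1 (le_of_mul_le_mul_left this (norm_pos_iff.2 hfc))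
  have hmap : ∀ z ∈ ball (0 : ℂ) R, c + z ∈ ball c R := by intro z hz; simpa using hz
  have hbc : ∀ z ∈ ball (0 : ℂ) R, ‖g (c + z)‖ ≤ 2 * L * ‖z‖ / (R - ‖z‖) := by
    intro z hz
    refine borelCaratheodory_zero (f := fun z => g (c + z)) hL ?_ ?_ hR hz (by simpa using hgc)
    · exact hgd.comp (by fun_prop) hmap
    · intro w hw; exact hre _ (hmap w hw)
  have hsub : closedBall c (R / 2) ⊆ ball c R := closedBall_subset_ball (by linarith)
  have hcl : DiffContOnCl ℂ g (ball c (R / 2)) := (hgd.mono hsub).diffContOnCl_ball subset_rfl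
  have hC : ∀ z ∈ sphere c (R / 2), ‖g z‖ ≤ 2 * L := by
    intro z hz
    have hz' : ‖z - c‖ = R / 2 := by simpa [dist_eq_norm] using hz
    have := hbc (z - c) (by simp [hz']; linarith)
    rw [hz'] at this
    simp only [add_sub_cancel] at this
    refine this.trans (le_of_eq ?_)
    field_simp
    ring
  have := norm_iteratedDeriv_le_of_forall_mem_sphere_norm_le (k + 1) (by positivity) hcl hC
  rw [iteratedDeriv_succ'] at this
  have heq : deriv g =ᶠ[nhds c] (fun z => deriv f z / f z) := by
    filter_upwards [isOpen_ball.mem_nhds hc] with z hz using (hg z hz).deriv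
  rw [heq.iteratedDeriv_eq] at this
  refine this.trans (le_of_eq ?_)
  rw [div_pow, div_pow]
  field_simp

/-- dividing out one zero -/
lemma divide_zero {f : ℂ → ℂ} {c a : ℂ} {R B : ℝ} (hR : 0 < R)
    (hf : DifferentiableOn ℂ f (closedBall c R)) (hd : DifferentiableAt ℂ f c) (hc : f c ≠ 0)
    (hB : ∀ z ∈ closedBall c R, ‖f z‖ ≤ B) (ha : a ∈ ball c (R / 3)) (hfa : f a = 0) :
    ∃ g : ℂ → ℂ, DifferentiableOn ℂ g (closedBall c R) ∧ DifferentiableAt ℂ g c ∧ g c = f c ∧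
      (∀ z ∈ closedBall c R, ‖g z‖ ≤ B / 2) ∧
      (∀ z, z ≠ a → (g z = 0 ↔ f z = 0)) ∧ deriv f c / f c = deriv g c / g c + 1 / (c - a) := by
  have hac : c - a ≠ 0 := by
    intro h; rw [sub_eq_zero] at h; exact hc (h ▸ hfa)
  have ha' : ‖a - c‖ < R / 3 := by simpa [dist_eq_norm] using ha
  have hanh : closedBall c R ∈ nhds a := by
    apply mem_nhds_iff.2 ⟨ball c R, ball_subset_closedBall, isOpen_ball, ?_⟩
    simp [dist_eq_norm]; linarith
  have hds : DifferentiableOn ℂ (dslope f a) (closedBall c R) := (differentiableOn_dslope hanh).2 hf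
  have hca : c ≠ a := sub_ne_zero.1 hac
  have hval : ∀ z, z ≠ a → dslope f a z = f z / (z - a) := by
    intro z hz
    rw [dslope_of_ne _ hz, slope_def_field, hfa, sub_zero]
  refine ⟨fun z => (c - a) * dslope f a z, hds.const_mul _, ?_, ?_, ?_, ?_, ?_⟩
  · refine DifferentiableAt.const_mul ?_ _
    exact (differentiableAt_dslope_of_ne hca).2 hd
  · simp only [hval c hca]; field_simp
  · intro z hz
    have hcl : DiffContOnCl ℂ (fun z => (c - a) * dslope f a z) (ball c R) :=
      (hds.const_mul _).diffContOnCl_ball subset_rfl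
    refine norm_le_of_forall_mem_frontier_norm_le isBounded_ball hcl ?_ (by rwa [closure_ball c hR.ne'])
    intro w hw
    rw [frontier_ball c hR.ne'] at hw
    have hw' : ‖w - c‖ = R := by simpa [dist_eq_norm] using hw
    have hwa : 2 * R / 3 ≤ ‖w - a‖ := by
      have : ‖w - c‖ ≤ ‖w - a‖ + ‖a - c‖ := by simpa using norm_add_le (w - a) (a - c)
      linarith
    have hwne : w ≠ a := by rintro rfl; simp at hwa; linarith
    rw [hval w hwne, norm_mul, norm_div]
    have h1 : ‖c - a‖ ≤ R / 3 := by rw [norm_sub_rev]; exact ha'.le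
    have h2 : ‖f w‖ ≤ B := hB w (sphere_subset_closedBall hw)
    have h3 : 0 < ‖w - a‖ := lt_of_lt_of_le (by positivity) hwa
    have hB0 : 0 ≤ B := (norm_nonneg _).trans h2
    calc ‖c - a‖ * (‖f w‖ / ‖w - a‖) ≤ (R / 3) * (B / (2 * R / 3)) := by gcongr
      _ = B / 2 := by field_simp
  · intro z hz
    simp only [hval z hz]
    have : z - a ≠ 0 := sub_ne_zero.2 hz
    simp [hac, this]
  · have hev : (fun z => (c - a) * dslope f a z) =ᶠ[nhds c] fun z => (c - a) * (f z / (z - a)) := by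
      filter_upwards [isOpen_ne.mem_nhds hca] with z hz
      rw [hval z hz]
    have h1 : HasDerivAt (fun z => (c - a) * (f z / (z - a)))
        ((c - a) * ((deriv f c * (c - a) - f c * 1) / (c - a) ^ 2)) c :=
      ((hd.hasDerivAt.div ((hasDerivAt_id c).sub_const a) hac)).const_mul _
    rw [hev.deriv_eq, h1.deriv]
    simp only [hval c hca]
    field_simp
    ring

lemma landau_zero {f : ℂ → ℂ} {c : ℂ} {R L : ℝ} (hR : 0 < R) (hL : 0 < L)
    (hf : DifferentiableOn ℂ f (closedBall c R)) (hc : f c ≠ 0)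
    (hB : ∀ z ∈ closedBall c R, ‖f z‖ ≤ ‖f c‖ * Real.exp L)
    (hz : ∀ z ∈ ball c (R / 3), f z = 0 → z.re < c.re) :
    -(12 * L / R) ≤ (deriv f c / f c).re := by
  suffices H : ∀ n : ℕ, ∀ f : ℂ → ℂ, ∀ B : ℝ, DifferentiableOn ℂ f (closedBall c R) → f c ≠ 0 →
      (∀ z ∈ closedBall c R, ‖f z‖ ≤ B) → B ≤ ‖f c‖ * Real.exp L → B < 2 ^ n * ‖f c‖ →
      (∀ z ∈ ball c (R / 3), f z = 0 → z.re < c.re) →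
      -(12 * L / R) ≤ (deriv f c / f c).re by
    obtain ⟨n, hn⟩ := pow_unbounded_of_one_lt (Real.exp L) (one_lt_two)
    refine H n f _ hf hc hB le_rfl ?_ hz
    rw [mul_comm]
    exact mul_lt_mul_of_pos_right hn (norm_pos_iff.2 hc)
  intro n
  induction n with
  | zero =>
    intro f B hf hc hB _ h _
    have := hB c (mem_closedBall_self hR.le)
    simp at h
    linarith
  | succ n ih =>
    intro f B hf hc hB hBL hn hz
    have hcn : closedBall c R ∈ nhds c := closedBall_mem_nhds c hR
    by_cases hne : ∃ a ∈ ball c (R / 3), f a = 0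
    · obtain ⟨a, ha, hfa⟩ := hne
      obtain ⟨g, hg, hgd, hgc, hgB, hgz, hder⟩ := divide_zero hR hf (hf.differentiableAt hcn) hc hB ha hfa
      have hB0 : 0 ≤ B := (norm_nonneg _).trans (hB c (mem_closedBall_self hR.le))
      have hare := hz a ha hfa
      have := ih g (B / 2) hg (by rwa [hgc]) hgB (by rw [hgc]; linarith)
        (by rw [hgc]; rw [pow_succ] at hn; linarith) (by
          intro z hzb hgz0
          by_cases hza : z = a
          · rwa [hza]
          · exact hz z hzb ((hgz z hza).1 hgz0))
      rw [hder, add_re]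
      have h1 : 0 ≤ (1 / (c - a)).re := by
        rw [one_div, inv_re]
        apply div_nonneg _ (normSq_nonneg _)
        simp; linarith
      linarith
    · push Not at hne
      have hsub : ball c (R / 3) ⊆ closedBall c R :=
        (ball_subset_ball (by linarith)).trans ball_subset_closedBall
      have := log_deriv_bound (f := f) (c := c) (R := R / 3) (L := L) (by positivity) hL
        (hf.mono hsub) hne (fun z hz => (hB z (hsub hz)).trans hBL) 0
      simp only [iteratedDeriv_zero, zero_add, Nat.factorial_one, Nat.cast_one, one_mul, pow_one] at this
      have h2 := (abs_le.1 (abs_re_le_norm (deriv f c / f c))).1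
      have h3 : 2 * L * (2 / (R / 3)) = 12 * L / R := by field_simp; ring
      rw [h3] at this
      linarith

lemma landau_one {f : ℂ → ℂ} {c ρ : ℂ} {R L : ℝ} (hR : 0 < R) (hL : 0 < L)
    (hf : DifferentiableOn ℂ f (closedBall c R)) (hc : f c ≠ 0)
    (hB : ∀ z ∈ closedBall c R, ‖f z‖ ≤ ‖f c‖ * Real.exp L)
    (hz : ∀ z ∈ ball c (R / 3), f z = 0 → z.re < c.re) (hρ : ρ ∈ ball c (R / 3)) (h0 : f ρ = 0) :
    -(12 * L / R) + (1 / (c - ρ)).re ≤ (deriv f c / f c).re := by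
  obtain ⟨g, hg, hgd, hgc, hgB, hgz, hder⟩ := divide_zero hR hf
    (hf.differentiableAt (closedBall_mem_nhds c hR)) hc hB hρ h0
  have hp : 0 < ‖f c‖ * Real.exp L := mul_pos (norm_pos_iff.2 hc) (Real.exp_pos _)
  have := landau_zero (f := g) hR hL hg (by rwa [hgc])
    (fun z hz => (hgB z hz).trans (by rw [hgc]; linarith)) (by
      intro z hzb hgz0
      by_cases hza : z = ρ
      · rw [hza]; exact hz ρ hρ h0
      · exact hz z hzb ((hgz z hza).1 hgz0))
  rw [hder, add_re]
  linarith

lemma landau_two {f : ℂ → ℂ} {c ρ ρ' : ℂ} {R L : ℝ} (hR : 0 < R) (hL : 0 < L)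
    (hf : DifferentiableOn ℂ f (closedBall c R)) (hc : f c ≠ 0)
    (hB : ∀ z ∈ closedBall c R, ‖f z‖ ≤ ‖f c‖ * Real.exp L)
    (hz : ∀ z ∈ ball c (R / 3), f z = 0 → z.re < c.re) (hρ : ρ ∈ ball c (R / 3)) (h0 : f ρ = 0)
    (hρ' : ρ' ∈ ball c (R / 3)) (h0' : f ρ' = 0) (hne : ρ' ≠ ρ) :
    -(12 * L / R) + (1 / (c - ρ)).re + (1 / (c - ρ')).re ≤ (deriv f c / f c).re := by
  obtain ⟨g, hg, hgd, hgc, hgB, hgz, hder⟩ := divide_zero hR hf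
    (hf.differentiableAt (closedBall_mem_nhds c hR)) hc hB hρ h0
  have hp : 0 < ‖f c‖ * Real.exp L := mul_pos (norm_pos_iff.2 hc) (Real.exp_pos _)
  have := landau_one (f := g) hR hL hg (by rwa [hgc])
    (fun z hz => (hgB z hz).trans (by rw [hgc]; linarith)) (by
      intro z hzb hgz0
      by_cases hza : z = ρ
      · rw [hza]; exact hz ρ hρ h0
      · exact hz z hzb ((hgz z hza).1 hgz0)) hρ' ((hgz ρ' hne).2 h0')
  rw [hder, add_re]
  linarith

end

section
open MeasureTheory Set Filter Topology

noncomputable def LP (P : ℝ → ℂ) (s : ℂ) : ℂ := s * ∫ u in Ioi (1:ℝ), P u * (u:ℂ)^(-(s+1))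

lemma LP_integrable {P : ℝ → ℂ} {B κ : ℝ} (hP : Measurable P) (hB : ∀ u, 1 ≤ u → ‖P u‖ ≤ B * u ^ κ)
    {s : ℂ} (hs : κ < s.re) : IntegrableOn (fun u:ℝ => P u * (u:ℂ)^(-(s+1))) (Ioi 1) := by
  have h1 : IntegrableOn (fun u:ℝ => B * u ^ (κ - s.re - 1)) (Ioi 1) :=
    (integrableOn_Ioi_rpow_of_lt (by linarith) one_pos).const_mul B
  refine Integrable.mono' h1 ?_ ?_
  · exact (hP.mul (by fun_prop)).aestronglyMeasurable
  · filter_upwards [ae_restrict_mem measurableSet_Ioi] with u hu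
    have hu' : (1:ℝ) < u := hu
    have hu0 : 0 < u := by linarith
    rw [norm_mul, Complex.norm_cpow_eq_rpow_re_of_pos hu0]
    calc ‖P u‖ * u ^ (-(s+1)).re ≤ (B * u ^ κ) * u ^ (-(s+1)).re := by
          gcongr; exact hB u hu'.le
      _ = B * u ^ (κ - s.re - 1) := by
          rw [mul_assoc, ← Real.rpow_add hu0]; congr 2; simp; ring

lemma LP_bound {P : ℝ → ℂ} {B κ : ℝ} (hP : Measurable P) (hB : ∀ u, 1 ≤ u → ‖P u‖ ≤ B * u ^ κ)
    {s : ℂ} (hs : κ < s.re) : ‖LP P s‖ ≤ B * ‖s‖ / (s.re - κ) := by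
  have h1 : IntegrableOn (fun u:ℝ => B * u ^ (κ - s.re - 1)) (Ioi 1) :=
    (integrableOn_Ioi_rpow_of_lt (by linarith) one_pos).const_mul B
  have h2 : ‖∫ u in Ioi (1:ℝ), P u * (u:ℂ)^(-(s+1))‖ ≤ ∫ u in Ioi (1:ℝ), B * u ^ (κ - s.re - 1) := by
    refine norm_integral_le_of_norm_le h1 ?_
    filter_upwards [ae_restrict_mem measurableSet_Ioi] with u hu
    have hu' : (1:ℝ) < u := hu
    have hu0 : 0 < u := by linarith
    rw [norm_mul, Complex.norm_cpow_eq_rpow_re_of_pos hu0]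
    calc ‖P u‖ * u ^ (-(s+1)).re ≤ (B * u ^ κ) * u ^ (-(s+1)).re := by
          gcongr; exact hB u hu'.le
      _ = B * u ^ (κ - s.re - 1) := by
          rw [mul_assoc, ← Real.rpow_add hu0]; congr 2; simp; ring
  rw [integral_const_mul, integral_Ioi_rpow_of_lt (by linarith) one_pos] at h2
  unfold LP
  rw [norm_mul]
  have h3 : s.re - κ ≠ 0 := by linarith
  have h4 : κ - s.re - 1 + 1 ≠ 0 := by
    intro h; apply h3; linarith
  calc ‖s‖ * _ ≤ ‖s‖ * (B * (-1 ^ (κ - s.re - 1 + 1) / (κ - s.re - 1 + 1))) := by gcongr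
    _ = _ := by rw [Real.one_rpow]; field_simp; ring_nf

lemma LP_diff {P : ℝ → ℂ} {B : ℝ} (hP : Measurable P) (hB : ∀ u, ‖P u‖ ≤ B)
    {s : ℂ} (hs : 0 < s.re) : DifferentiableAt ℂ (LP P) s := by
  have hle : ∀ u, ‖(Ioi (1:ℝ)).indicator P u‖ ≤ B := fun u => by
    by_cases h : u ∈ Ioi (1:ℝ)
    · simp [h, hB u]
    · simp only [h, not_false_eq_true, indicator_of_notMem, norm_zero]
      exact (norm_nonneg _).trans (hB u)
  have h1 : DifferentiableAt ℂ (mellin ((Ioi (1:ℝ)).indicator P)) (-s) := by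
    refine mellin_differentiableAt_of_isBigO_rpow (a := 0) (b := -s.re - 1) ?_ ?_ (by simpa using hs) ?_ (by simp)
    · apply LocallyIntegrable.locallyIntegrableOn
      refine (locallyIntegrable_const B).mono ?_ ?_
      · exact (hP.indicator measurableSet_Ioi).aestronglyMeasurable
      · filter_upwards with u
        exact (hle u).trans (le_abs_self _)
    · refine Asymptotics.IsBigO.of_bound B ?_
      filter_upwards with u
      simpa using hle u
    · refine Asymptotics.IsBigO.of_bound 0 ?_
      have : Ioo (0:ℝ) 1 ∈ 𝓝[>] (0:ℝ) := Ioo_mem_nhdsGT one_pos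
      filter_upwards [this] with u hu
      have : u ∉ Ioi (1:ℝ) := by simp only [mem_Ioi, not_lt]; exact hu.2.le
      simp [this]
  have h2 : LP P = fun s => s * mellin ((Ioi (1:ℝ)).indicator P) (-s) := by
    ext s
    unfold LP mellin
    congr 1
    rw [← integral_indicator measurableSet_Ioi, ← integral_indicator measurableSet_Ioi]
    congr 1
    ext u
    by_cases h : u ∈ Ioi (1:ℝ)
    · have h' : u ∈ Ioi (0:ℝ) := mem_Ioi.2 (lt_trans one_pos (mem_Ioi.1 h))
      simp only [h, h', indicator_of_mem, smul_eq_mul]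
      rw [mul_comm]; congr 2; ring
    · by_cases h' : u ∈ Ioi (0:ℝ) <;> simp [h, h']
  rw [h2]
  exact differentiableAt_id.mul (h1.comp s differentiableAt_id.neg)

structure Good (q B : ℝ) (P : ℝ → ℂ) : Prop where
  meas : Measurable P
  bd : ∀ u, ‖P u‖ ≤ B
  per : Function.Periodic P q
  rc : ∀ u, ContinuousWithinAt P (Ioi u) u

lemma Good.ii {q B : ℝ} {P : ℝ → ℂ} (h : Good q B P) (a b : ℝ) : IntervalIntegrable P volume a b := by
  refine (intervalIntegrable_const (c := B)).mono_fun' h.meas.aestronglyMeasurable ?_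
  filter_upwards with u using h.bd u

lemma Good.step {q B : ℝ} {P : ℝ → ℂ} (h : Good q B P) (hq : 1 ≤ q) :
    ∃ μ : ℂ, ∃ Q, ‖μ‖ ≤ B ∧ Good q (2 * q * B) Q ∧ ∀ s : ℂ, 0 < s.re → LP P s = μ + s * LP Q (s+1) := by
  have hq0 : 0 < q := by linarith
  have hB0 : 0 ≤ B := (norm_nonneg _).trans (h.bd 0)
  set μ : ℂ := (∫ u in (1:ℝ)..(1+q), P u) / q with hμ
  have hμB : ‖μ‖ ≤ B := by
    rw [hμ, norm_div, Complex.norm_real, Real.norm_of_nonneg hq0.le, div_le_iff₀ hq0]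
    have := intervalIntegral.norm_integral_le_of_norm_le_const (a := (1:ℝ)) (b := 1+q) (f := P) (C := B) (fun u _ => h.bd u)
    simpa [abs_of_pos hq0] using this
  set P1 : ℝ → ℂ := fun u => P u - μ with hP1
  have hP1ii : ∀ a b, IntervalIntegrable P1 volume a b := fun a b => (h.ii a b).sub intervalIntegrable_const
  have hP1b : ∀ u, ‖P1 u‖ ≤ 2 * B := fun u => by
    have := norm_sub_le (P u) μ
    have := h.bd u
    simp only [hP1]; linarith
  have hP1per : Function.Periodic P1 q := fun u => by simp [hP1, h.per u]
  have hint0 : ∫ u in (1:ℝ)..(1+q), P1 u = 0 := by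
    simp only [hP1]
    rw [intervalIntegral.integral_sub (h.ii _ _) intervalIntegrable_const]
    simp only [intervalIntegral.integral_const, add_sub_cancel_left, hμ]
    have : (q:ℂ) ≠ 0 := by exact_mod_cast hq0.ne'
    rw [Complex.real_smul]; field_simp; simp
  set Q : ℝ → ℂ := fun u => ∫ v in (1:ℝ)..u, P1 v with hQ
  have hQc : Continuous Q := intervalIntegral.continuous_primitive hP1ii 1
  have hQper : Function.Periodic Q q := fun u => by
    simp only [hQ]
    rw [hP1per.intervalIntegral_add_eq_add 1 u hP1ii, hint0, add_zero]
  have hQb : ∀ u, ‖Q u‖ ≤ 2 * q * B := fun u => by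
    obtain ⟨v, hv, hv'⟩ := hQper.exists_mem_Ico hq0 u 1
    rw [hv']
    have h2 := intervalIntegral.norm_integral_le_of_norm_le_const (a := (1:ℝ)) (b := v) (f := P1) (C := 2*B) (fun u _ => hP1b u)
    rw [abs_of_nonneg (by linarith [hv.1])] at h2
    refine h2.trans ?_
    nlinarith [hv.2]
  have hQG : Good q (2 * q * B) Q := ⟨hQc.measurable, hQb, hQper, fun u => hQc.continuousWithinAt⟩
  have hP1m : Measurable P1 := h.meas.sub_const _
  refine ⟨μ, Q, hμB, hQG, fun s hs => ?_⟩
  have hs0 : s ≠ 0 := by rintro rfl; simp at hs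
  have hs1 : s + 1 ≠ 0 := by
    intro h; have := congrArg Complex.re h; simp at this; linarith
  have hI1 : IntegrableOn (fun u:ℝ => P1 u * (u:ℂ)^(-(s+1))) (Ioi 1) :=
    LP_integrable (B := 2 * B) (κ := 0) hP1m (fun u _ => by simpa using hP1b u) hs
  have hI2 : IntegrableOn (fun u:ℝ => Q u * (u:ℂ)^(-((s+1)+1))) (Ioi 1) :=
    LP_integrable (B := 2 * q * B) (κ := 0) hQG.meas (fun u _ => by simpa using hQb u) (by simp; linarith)
  have hI3 : IntegrableOn (fun u:ℝ => (u:ℂ)^(-(s+1))) (Ioi 1) :=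
    integrableOn_Ioi_cpow_of_lt (by simp; linarith) one_pos
  have key : ∫ u in Ioi (1:ℝ), P1 u * (u:ℂ)^(-(s+1)) = (s+1) * ∫ u in Ioi (1:ℝ), Q u * (u:ℂ)^(-((s+1)+1)) := by
    have t1 := intervalIntegral_tendsto_integral_Ioi 1 hI1 tendsto_id
    have t2 := (intervalIntegral_tendsto_integral_Ioi 1 hI2 tendsto_id).const_mul (s+1)
    have t3 : Tendsto (fun X : ℝ => (X:ℂ)^(-(s+1)) * Q X) atTop (𝓝 0) := by
      have : Tendsto (fun X:ℝ => X ^ (-(s.re+1)) * (2 * q * B)) atTop (𝓝 0) := by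
        have := (tendsto_rpow_neg_atTop (y := s.re + 1) (by linarith)).mul_const (2*q*B)
        simpa using this
      refine squeeze_zero_norm' ?_ this
      filter_upwards [eventually_gt_atTop 0] with X hX
      rw [norm_mul, Complex.norm_cpow_eq_rpow_re_of_pos hX]
      have : (-(s+1)).re = -(s.re+1) := by simp
      rw [this]
      gcongr
      exact hQb X
    have t4 := t3.add t2
    rw [zero_add] at t4
    refine tendsto_nhds_unique t1 (t4.congr' ?_)
    filter_upwards [eventually_gt_atTop 1] with X hX
    have hb := intervalIntegral.integral_mul_deriv_eq_deriv_mul_of_hasDeriv_right (a := (1:ℝ)) (b := X)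
      (u := fun u:ℝ => (u:ℂ)^(-(s+1))) (v := Q) (u' := fun u => (-(s+1)) * (u:ℂ)^(-(s+1)-1)) (v' := P1)
      ?_ hQc.continuousOn ?_ ?_ ?_ (hP1ii _ _)
    · have e1 : Q 1 = 0 := by simp [hQ]
      simp only [e1, mul_zero, sub_zero] at hb
      have e2 : ∫ x in (1:ℝ)..X, -(s+1) * (x:ℂ)^(-(s+1)-1) * Q x = -((s+1) * ∫ x in (1:ℝ)..X, Q x * (x:ℂ)^(-((s+1)+1))) := by
        rw [← intervalIntegral.integral_const_mul, ← intervalIntegral.integral_neg]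
        congr 1; ext x
        rw [show -(s+1)-1 = -((s+1)+1) by ring]; ring
      rw [e2, sub_neg_eq_add] at hb
      simp only [id]
      rw [← hb]
      congr 1; ext x; ring
    · intro x hx
      rw [uIcc_of_le hX.le] at hx
      exact (Complex.continuousAt_ofReal_cpow_const x _ (Or.inr (by linarith [hx.1]))).continuousWithinAt
    · intro x hx
      rw [min_eq_left hX.le] at hx
      have hx0 : (x:ℝ) ≠ 0 := by linarith [hx.1]
      have := hasDerivAt_ofReal_cpow_const' (x := x) (r := -(s+1)-1) hx0 (by intro h; apply hs1; linear_combination -h)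
      have h2 := this.const_mul (-(s+1))
      refine HasDerivAt.hasDerivWithinAt (h2.congr_of_eventuallyEq ?_)
      filter_upwards with y
      have : -(s+1) ≠ 0 := neg_ne_zero.2 hs1
      rw [show -(s+1)-1+1 = -(s+1) by ring]; field_simp
    · intro x hx
      exact (intervalIntegral.integral_hasDerivWithinAt_right (s := Ici x) (t := Ioi x) (hP1ii _ _)
        (hP1m.stronglyMeasurable.stronglyMeasurableAtFilter) ((h.rc x).sub continuousWithinAt_const)).mono Ioi_subset_Ici_self
    · apply ContinuousOn.intervalIntegrable
      intro x hx
      rw [uIcc_of_le hX.le] at hx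
      exact (continuousAt_const.mul (Complex.continuousAt_ofReal_cpow_const x _ (Or.inr (by linarith [hx.1])))).continuousWithinAt
  have h5 : ∫ u in Ioi (1:ℝ), P u * (u:ℂ)^(-(s+1)) = (∫ u in Ioi (1:ℝ), P1 u * (u:ℂ)^(-(s+1))) + μ * ∫ u in Ioi (1:ℝ), (u:ℂ)^(-(s+1)) := by
    rw [← integral_const_mul, ← integral_add hI1 (hI3.const_mul μ)]
    congr 1; ext u; simp [hP1]; ring
  have h6 : ∫ u in Ioi (1:ℝ), (u:ℂ)^(-(s+1)) = 1 / s := by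
    rw [integral_Ioi_cpow_of_lt (by simp; linarith) one_pos]
    have : -(s+1)+1 = -s := by ring
    rw [this]; simp [neg_div_neg_eq]
  unfold LP
  rw [h5, key, h6]
  field_simp
  ring

lemma Good.cont (J : ℕ) : ∀ R : ℝ, 0 < R → ∃ C : ℝ, 0 < C ∧ ∀ q B : ℝ, ∀ P, 1 ≤ q → Good q B P → ∃ F : ℂ → ℂ,
    DifferentiableOn ℂ F {s | -(J:ℝ) < s.re} ∧ (∀ s : ℂ, 0 < s.re → F s = LP P s) ∧
    ∀ s : ℂ, ‖s‖ ≤ R → -(J:ℝ) + 1/2 ≤ s.re → ‖F s‖ ≤ C * B * q ^ J := by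
  induction J with
  | zero =>
    intro R hR
    refine ⟨2 * R, by positivity, fun q B P hq h => ⟨LP P, fun s hs => ?_, fun s _ => rfl, fun s hs hs' => ?_⟩⟩
    · simp only [CharP.cast_eq_zero, neg_zero, mem_ofPred_eq] at hs
      exact (LP_diff h.meas h.bd hs).differentiableWithinAt
    · simp only [CharP.cast_eq_zero, neg_zero, zero_add] at hs'
      have hB0 : 0 ≤ B := (norm_nonneg _).trans (h.bd 0)
      have := LP_bound (κ := 0) (B := B) h.meas (fun u _ => by simpa using h.bd u) (s := s) (by linarith)
      refine this.trans ?_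
      rw [sub_zero, div_le_iff₀ (by linarith)]
      simp only [pow_zero, mul_one]
      calc B * ‖s‖ ≤ B * R := by gcongr
        _ ≤ 2 * R * B * (1/2) := by linarith
        _ ≤ 2 * R * B * s.re := by gcongr
  | succ J ih =>
    intro R hR
    obtain ⟨C, hC, hind⟩ := ih (R+1) (by linarith)
    refine ⟨1 + R * (C * 2), by positivity, fun q B P hq h => ?_⟩
    obtain ⟨μ, Q, hμ, hQ, hrec⟩ := h.step hq
    obtain ⟨F, hF1, hF2, hF3⟩ := hind q _ Q hq hQ
    have hB0 : 0 ≤ B := (norm_nonneg _).trans (h.bd 0)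
    refine ⟨fun s => μ + s * F (s+1), ?_, ?_, ?_⟩
    · intro s hs
      simp only [Nat.cast_add, Nat.cast_one, neg_add_rev, mem_ofPred_eq] at hs
      apply DifferentiableAt.differentiableWithinAt
      have h1 : DifferentiableAt ℂ F (s+1) := by
        apply (hF1 _ (by simp; linarith)).differentiableAt
        exact (isOpen_lt continuous_const Complex.continuous_re).mem_nhds (by simp; linarith)
      have : DifferentiableAt ℂ (fun s => F (s+1)) s :=
        DifferentiableAt.comp (f := fun s => s + 1) s h1 (by fun_prop)
      fun_prop
    · intro s hs
      have h1 := hF2 (s+1) (by simp; linarith)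
      simp only [hrec s hs, h1]
    · intro s hs hs'
      push_cast at hs'
      have h1 := hF3 (s+1) ((norm_add_le _ _).trans (by simp; linarith)) (by simp; linarith)
      have h2 : (1:ℝ) ≤ q ^ (J+1) := one_le_pow₀ hq
      calc ‖μ + s * F (s+1)‖ ≤ ‖μ‖ + ‖s‖ * ‖F (s+1)‖ := (norm_add_le _ _).trans (by rw [norm_mul])
        _ ≤ B * q^(J+1) + R * (C * (2 * q * B) * q ^ J) := by
            gcongr
            nlinarith
        _ = _ := by ring

end

section
open MeasureTheory Set Filter Topology

noncomputable def Pz (u : ℝ) : ℂ := -((Int.fract u : ℝ) : ℂ)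

lemma fl_rc {α : Type*} [TopologicalSpace α] (g : ℤ → α) (u : ℝ) : ContinuousWithinAt (fun v : ℝ => g ⌊v⌋) (Ioi u) u := by
  have h := (tendsto_floor_right_pure_floor u).mono_left (nhdsWithin_mono u (Ioi_subset_Ici_self))
  have h2 : ∀ᶠ v in 𝓝[>] u, ⌊v⌋ = ⌊u⌋ := tendsto_pure.1 h
  refine tendsto_const_nhds.congr' (f₁ := fun _ => g ⌊u⌋) ?_
  filter_upwards [h2] with v hv
  rw [hv]

lemma Pz_good : Good 1 1 Pz := by
  refine ⟨?_, ?_, ?_, ?_⟩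
  · unfold Pz; fun_prop
  · intro u
    unfold Pz
    rw [norm_neg, Complex.norm_real, Real.norm_of_nonneg (Int.fract_nonneg u)]
    exact (Int.fract_lt_one u).le
  · intro u; simp [Pz]
  · intro u
    have h1 := fl_rc (fun n : ℤ => (n:ℂ)) u
    have h2 : ContinuousWithinAt (fun v : ℝ => (v:ℂ)) (Ioi u) u := Complex.continuous_ofReal.continuousWithinAt
    have : Pz = fun v : ℝ => ((⌊v⌋:ℤ):ℂ) - (v:ℂ) := by
      ext v; simp only [Pz, Int.fract]; push_cast; ring
    rw [this]
    exact h1.sub h2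

noncomputable def chS {q : ℕ} (χ : DirichletCharacter ℂ q) (u : ℝ) : ℂ :=
  ∑ k ∈ Finset.Icc 1 ((⌊u⌋ % (q:ℤ)).toNat), χ (k : ZMod q)

section ch
variable {q : ℕ} [NeZero q] {χ : DirichletCharacter ℂ q}

lemma ch_sum_period (hχ : χ ≠ 1) (n : ℕ) : ∑ k ∈ Finset.Icc 1 (n+q), χ (k : ZMod q) = ∑ k ∈ Finset.Icc 1 n, χ (k : ZMod q) := by
  induction n with
  | zero =>
    have h0 : ∑ k ∈ Finset.range q, χ (k : ZMod q) = 0 := by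
      rw [← MulChar.sum_eq_zero_of_ne_one hχ]
      refine Finset.sum_nbij' (fun k => (k : ZMod q)) ZMod.val ?_ ?_ ?_ ?_ ?_
      · simp
      · intro a _; simpa using ZMod.val_lt a
      · intro a ha; exact ZMod.val_cast_of_lt (by simpa using ha)
      · intro a _; simp
      · simp
    have h1 := Finset.sum_range_succ (fun k : ℕ => χ (k : ZMod q)) q
    have h2 := Finset.sum_range_succ' (fun k : ℕ => χ (k : ZMod q)) q
    rw [h0] at h1
    have h3 : ∑ k ∈ Finset.Icc 1 q, χ (k : ZMod q) = ∑ k ∈ Finset.range q, χ ((k+1 : ℕ) : ZMod q) := by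
      rw [Finset.range_eq_Ico, Finset.sum_Ico_add' (fun k : ℕ => χ (k : ZMod q)) 0 q 1]
      congr 1
    simp only [zero_add, Finset.Icc_eq_empty_of_lt zero_lt_one, Finset.sum_empty]
    rw [h3]
    rw [h1] at h2
    simp at h2 ⊢
    exact h2
  | succ n ih =>
    rw [show n + 1 + q = (n+q)+1 by ring, Finset.sum_Icc_succ_top (by omega), Finset.sum_Icc_succ_top (by omega), ih]
    congr 2
    push_cast
    simp

lemma ch_sum_mod (hχ : χ ≠ 1) (n : ℕ) : ∑ k ∈ Finset.Icc 1 (n % q), χ (k : ZMod q) = ∑ k ∈ Finset.Icc 1 n, χ (k : ZMod q) := by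
  have h : ∀ m r : ℕ, ∑ k ∈ Finset.Icc 1 (r + q * m), χ (k : ZMod q) = ∑ k ∈ Finset.Icc 1 r, χ (k : ZMod q) := by
    intro m r
    induction m with
    | zero => simp
    | succ m ih => rw [show r + q * (m+1) = (r+q*m)+q by ring, ch_sum_period hχ, ih]
  conv_rhs => rw [← Nat.mod_add_div n q]
  rw [h]

lemma chS_eq (hχ : χ ≠ 1) {u : ℝ} (hu : 0 ≤ u) : chS χ u = ∑ k ∈ Finset.Icc 1 ⌊u⌋₊, χ (k : ZMod q) := by
  rw [← ch_sum_mod hχ, chS]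
  congr 2
  rw [← Int.natCast_floor_eq_floor hu]
  norm_cast

lemma ch_sum_norm (n : ℕ) : ‖∑ k ∈ Finset.Icc 1 n, χ (k : ZMod q)‖ ≤ n := by
  refine (norm_sum_le _ _).trans ((Finset.sum_le_sum (fun k _ => χ.norm_le_one _)).trans ?_)
  simp

lemma chS_norm (u : ℝ) : ‖chS χ u‖ ≤ q := by
  have hq : 0 < (q:ℤ) := by exact_mod_cast Nat.pos_of_ne_zero (NeZero.ne q)
  refine (ch_sum_norm _).trans ?_
  have h1 := Int.emod_lt_of_pos ⌊u⌋ hq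
  have : (⌊u⌋ % (q:ℤ)).toNat ≤ q := by omega
  exact_mod_cast this

lemma chS_good : Good q q (chS χ) := by
  refine ⟨?_, chS_norm, ?_, ?_⟩
  · have : Measurable (fun n : ℤ => ∑ k ∈ Finset.Icc 1 ((n % (q:ℤ)).toNat), χ (k : ZMod q)) := measurable_from_top
    exact this.comp Int.measurable_floor
  · intro u
    simp [chS]
  · intro u
    exact fl_rc (fun n : ℤ => ∑ k ∈ Finset.Icc 1 ((n % (q:ℤ)).toNat), χ (k : ZMod q)) u

lemma chS_norm' (hχ : χ ≠ 1) {θ : ℝ} (h0 : 0 ≤ θ) (h1 : θ ≤ 1) (u : ℝ) (hu : 1 ≤ u) : ‖chS χ u‖ ≤ (q:ℝ)^θ * u ^ (1 - θ) := by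
  have hn1 : ‖chS χ u‖ ≤ q := chS_norm u
  have hn2 : ‖chS χ u‖ ≤ u := by
    rw [chS_eq hχ (by linarith)]
    exact (ch_sum_norm _).trans (Nat.floor_le (by linarith))
  rcases eq_or_lt_of_le (norm_nonneg (chS χ u)) with h | h
  · rw [← h]; positivity
  · calc ‖chS χ u‖ = ‖chS χ u‖ ^ θ * ‖chS χ u‖ ^ (1-θ) := by
          rw [← Real.rpow_add h]; simp
      _ ≤ _ := by gcongr

lemma chL_eq (hχ : χ ≠ 1) {s : ℂ} (hs : 1 < s.re) : LSeries (fun n => χ (n : ZMod q)) s = LP (chS χ) s := by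
  rw [LSeries_eq_mul_integral (r := 1) _ zero_le_one hs (DirichletCharacter.LSeriesSummable_of_one_lt_re χ hs)]
  · unfold LP
    congr 1
    refine setIntegral_congr_fun measurableSet_Ioi (fun u hu => ?_)
    rw [chS_eq hχ (by linarith [mem_Ioi.1 hu])]
  · refine Asymptotics.IsBigO.of_bound 1 ?_
    filter_upwards with n
    simpa using ch_sum_norm (χ := χ) n
end ch

lemma zeta_eq {s : ℂ} (hs : 1 < s.re) : riemannZeta s = s / (s-1) + LP Pz s := by
  have h1 : LSeries 1 s = riemannZeta s := LSeries_one_eq_riemannZeta hs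
  have hs1 : s - 1 ≠ 0 := by intro h; have := congrArg Complex.re h; simp at this; linarith
  rw [← h1, LSeries_eq_mul_integral (r := 1) _ zero_le_one hs (LSeriesSummable_one_iff.2 hs)]
  · have hI1 : IntegrableOn (fun u:ℝ => Pz u * (u:ℂ)^(-(s+1))) (Ioi 1) :=
      LP_integrable (B := 1) (κ := 0) Pz_good.meas (fun u _ => by simpa using Pz_good.bd u) (by linarith)
    have hI2 : IntegrableOn (fun u:ℝ => (u:ℂ)^(-s)) (Ioi 1) :=
      integrableOn_Ioi_cpow_of_lt (by simp; linarith) one_pos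
    have h3 : ∫ u in Ioi (1:ℝ), (∑ k ∈ Finset.Icc 1 ⌊u⌋₊, (1 : ℕ → ℂ) k) * (u:ℂ)^(-(s+1)) =
        (∫ u in Ioi (1:ℝ), (u:ℂ)^(-s)) + ∫ u in Ioi (1:ℝ), Pz u * (u:ℂ)^(-(s+1)) := by
      rw [← integral_add hI2 hI1]
      refine setIntegral_congr_fun measurableSet_Ioi (fun u hu => ?_)
      have hu1 : (1:ℝ) < u := hu
      have hu0 : (u:ℂ) ≠ 0 := by exact_mod_cast (by linarith : u ≠ 0)
      have e1 : (∑ k ∈ Finset.Icc 1 ⌊u⌋₊, (1 : ℕ → ℂ) k) = (u:ℂ) + Pz u := by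
        simp only [Pi.one_apply, Finset.sum_const, Nat.card_Icc, add_tsub_cancel_right, nsmul_eq_mul, mul_one, Pz, Int.fract]
        rw [← Int.natCast_floor_eq_floor (by linarith : 0 ≤ u)]
        push_cast; ring
      rw [e1, add_mul]
      congr 1
      rw [show -s = 1 + -(s+1) by ring, Complex.cpow_add _ _ hu0, Complex.cpow_one]
    rw [h3, integral_Ioi_cpow_of_lt (by simp; linarith) one_pos]
    unfold LP
    have : -s + 1 ≠ 0 := by intro h; apply hs1; linear_combination -h
    rw [mul_add]
    congr 1
    simp only [Complex.ofReal_one, Complex.one_cpow]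
    rw [mul_div_assoc', div_eq_div_iff this hs1]; ring
  · refine Asymptotics.IsBigO.of_bound 1 ?_
    filter_upwards with n
    simp

end

section
open MeasureTheory Set Filter Topology

lemma logMul_iter (f : ℕ → ℂ) (m n : ℕ) : (LSeries.logMul^[m] f) n = ((Real.log n : ℝ):ℂ) ^ m * f n := by
  induction m with
  | zero => simp
  | succ m ih =>
    rw [Function.iterate_succ_apply', LSeries.logMul, ih, pow_succ, ← Complex.natCast_log]; ring

open scoped ComplexOrder in
lemma zetaMul_sq {q : ℕ} {χ : DirichletCharacter ℂ q} (hχ : χ ^ 2 = 1) (k : ℕ) (hk : k ≠ 0) :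
    1 ≤ χ.zetaMul (k^2) := by
  have hm := χ.isMultiplicative_zetaMul
  induction k using Nat.recOnPosPrimePosCoprime with
  | prime_pow p n hp hn =>
    rw [← pow_mul]
    have e : χ.zetaMul (p ^ (n*2)) = ∑ i ∈ Finset.range (n*2+1), (χ (p : ZMod q))^i := by
      unfold DirichletCharacter.zetaMul
      rw [ArithmeticFunction.coe_zeta_mul_apply, Nat.sum_divisors_prime_pow hp]
      refine Finset.sum_congr rfl (fun i _ => ?_)
      rw [← χ.apply_eq_toArithmeticFunction_apply (pow_ne_zero i hp.ne_zero)]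
      push_cast; rw [map_pow]
    rw [e]
    rcases MulChar.isQuadratic_iff_sq_eq_one.mpr hχ p with h | h | h
    · rw [Finset.sum_eq_single 0]
      · simp
      · intro b _ hb; simp [h, hb]
      · simp
    · simp only [h, one_pow, Finset.sum_const, Finset.card_range, nsmul_eq_mul, mul_one]
      exact_mod_cast Nat.le_add_left _ _
    · rw [h, neg_one_geom_sum]
      rw [if_neg]
      intro h; rw [Nat.even_add_one] at h; exact h ⟨n, by ring⟩
  | zero => simp at hk
  | one => simp [hm.1]
  | coprime a b ha hb hab iha ihb =>
    rw [mul_pow, hm.2 (Nat.Coprime.pow 2 2 hab)]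
    exact one_le_mul_of_one_le_of_one_le (iha (by omega)) (ihb (by omega))

lemma fact_le (m : ℕ) : (m.factorial : ℝ) ≤ (m+1)^(m+1) * Real.exp (-m) := by
  induction m with
  | zero => simp
  | succ m ih =>
    rw [Nat.factorial_succ]
    push_cast
    have h1 : Real.exp 1 ≤ (((m:ℝ)+2)/(m+1))^(m+2) := by
      have hp : (0:ℝ) < ((m:ℝ)+2)/(m+1) := by positivity
      have h2 := Real.one_sub_inv_le_log_of_pos hp
      rw [← Real.exp_log (pow_pos hp (m+2)), Real.exp_le_exp, Real.log_pow]
      have h3 : 1 - (((m:ℝ)+2)/(m+1))⁻¹ = 1 / (m+2) := by field_simp; ring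
      rw [h3] at h2
      push_cast
      calc (1:ℝ) = (m+2) * (1/(m+2)) := by field_simp
        _ ≤ _ := by gcongr
    calc ((m:ℝ)+1) * m.factorial ≤ (m+1) * ((m+1)^(m+1) * Real.exp (-m)) := by gcongr
      _ = (m+1)^(m+2) * Real.exp 1 * Real.exp (-(m+1)) := by
          rw [show -(m:ℝ) = 1 + -(m+1) by ring, Real.exp_add]; ring
      _ ≤ (m+1)^(m+2) * (((m:ℝ)+2)/(m+1))^(m+2) * Real.exp (-(m+1)) := by gcongr
      _ = _ := by
          rw [← mul_pow]
          have : ((m:ℝ)+1) * ((m+2)/(m+1)) = m+1+1 := by field_simp; ring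
          rw [this]

lemma fact_le' (m : ℕ) (hm : 1 ≤ m) : (m.factorial : ℝ) ≤ 3 * (m+1) * (m^m * Real.exp (-m)) := by
  refine (fact_le m).trans ?_
  have hm0 : (0:ℝ) < m := by exact_mod_cast hm
  have h1 : ((m:ℝ)+1)^m ≤ 3 * m^m := by
    have : ((m:ℝ)+1) = m * (1 + 1/m) := by field_simp
    rw [this, mul_pow]
    have h2 : (1 + 1/(m:ℝ))^m ≤ 3 := by
      have := Real.add_one_le_exp (1/(m:ℝ))
      calc (1 + 1/(m:ℝ))^m ≤ (Real.exp (1/m))^m := by gcongr; linarith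
        _ = Real.exp 1 := by rw [← Real.exp_nat_mul]; congr 1; field_simp
        _ ≤ 3 := by linarith [Real.exp_one_lt_d9]
    nlinarith [pow_pos hm0 m]
  rw [pow_succ]
  nlinarith [mul_le_mul_of_nonneg_right h1 (by positivity : (0:ℝ) ≤ (m+1) * Real.exp (-m))]

lemma opt_lemma {α β K c κ : ℝ} (hα : 0 < α) (hβ : 0 < β) (hK : 0 < K) (hc : 0 < c) (hκ : 0 < κ) :
    ∃ c' : ℝ, 0 < c' ∧ ∀ Q l : ℝ, 1 ≤ Q → 0 ≤ l →
      (∀ m : ℕ, 1 ≤ m → c / (m+1) ≤ l * Real.exp (β * m) + K * Q * Real.exp (-(α * m))) →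
      c' * Q ^ (-((1+κ)^2 * β / α)) ≤ l := by
  have hlin : ∀ a : ℝ, 0 < a → ∀ m : ℕ, (m:ℝ) + 1 ≤ (1 + 1/a) * Real.exp (a * m) := by
    intro a ha m
    have h1 := Real.add_one_le_exp (a * m)
    have h2 : (1:ℝ) ≤ Real.exp (a*m) := Real.one_le_exp (by positivity)
    have h3 : (m:ℝ) ≤ 1/a * Real.exp (a*m) := by
      rw [div_mul_eq_mul_div, one_mul, le_div_iff₀ ha]; linarith
    linarith
  set α' := α / (1+κ) with hα'
  have hα'0 : 0 < α' := by positivity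
  set a1 := α - α' with ha1
  have ha10 : 0 < a1 := by
    have : α' < α := div_lt_self hα (by linarith)
    linarith
  set b1 := β * κ with hb1
  have hb10 : 0 < b1 := by positivity
  set M := Real.log (1 + 2 * K * (1+1/a1) / c) with hM
  have hM0 : 0 ≤ M := Real.log_nonneg (by have : 0 ≤ 2 * K * (1+1/a1) / c := by positivity
                                          linarith)
  refine ⟨(c/2) / (1+1/b1) * Real.exp (-((β + b1) * (M/α' + 2))), by positivity, fun Q l hQ hl h => ?_⟩
  have hQ0 : 0 < Q := by linarith
  have hlQ : 0 ≤ Real.log Q := Real.log_nonneg hQ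
  set m := ⌈(Real.log Q + M)/α'⌉₊ + 1 with hm
  have hm1 : (Real.log Q + M) ≤ α' * m := by
    have := Nat.le_ceil ((Real.log Q + M)/α')
    rw [div_le_iff₀ hα'0] at this
    rw [hm]; push_cast; nlinarith
  have hm2 : (m:ℝ) ≤ (Real.log Q + M)/α' + 2 := by
    have := Nat.ceil_lt_add_one (a := (Real.log Q + M)/α') (by positivity)
    rw [hm]; push_cast; linarith
  have hmm := h m (by omega)
  have hmp : (0:ℝ) < m + 1 := by positivity
  have h1 : K * Q * Real.exp (-(α * m)) ≤ c / 2 / (m+1) := by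
    rw [le_div_iff₀ hmp]
    have e1 : Q ≤ Real.exp (α' * m) * Real.exp (-M) := by
      rw [← Real.exp_add]
      calc Q = Real.exp (Real.log Q) := (Real.exp_log hQ0).symm
        _ ≤ _ := Real.exp_le_exp.2 (by linarith)
    have e2 : K * (1+1/a1) * Real.exp (-M) ≤ c / 2 := by
      rw [Real.exp_neg, hM, Real.exp_log (by positivity), ← div_eq_mul_inv, div_le_iff₀ (by positivity)]
      have : c / 2 * (1 + 2 * K * (1 + 1 / a1) / c) = c/2 + K * (1+1/a1) := by field_simp
      linarith
    calc K * Q * Real.exp (-(α * m)) * (m+1) ≤ K * (Real.exp (α' * m) * Real.exp (-M)) * Real.exp (-(α * m)) * ((1+1/a1) * Real.exp (a1 * m)) := by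
          gcongr; exact hlin a1 ha10 m
      _ = K * (1+1/a1) * Real.exp (-M) * (Real.exp (α' * m) * Real.exp (-(α * m)) * Real.exp (a1*m)) := by ring
      _ = K * (1+1/a1) * Real.exp (-M) := by
          rw [← Real.exp_add, ← Real.exp_add, show α' * m + -(α * m) + a1 * m = 0 by rw [ha1]; ring]; simp
      _ ≤ _ := e2
  have h2 : c / 2 / (m+1) ≤ l * Real.exp (β * m) := by
    have : c / (m+1) = c/2/(m+1) + c/2/(m+1) := by ring
    linarith
  have h3 : c / 2 / ((1+1/b1) * Real.exp (b1 * m)) ≤ l * Real.exp (β * m) :=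
    (div_le_div_of_nonneg_left (by positivity) hmp (hlin b1 hb10 m)).trans h2
  have h4 : c / 2 / (1+1/b1) * Real.exp (-((β + b1) * m)) ≤ l := by
    rw [div_le_iff₀ (by positivity)] at h3
    rw [show -((β + b1) * m) = -(b1 * m + β * m) by ring, Real.exp_neg, ← div_eq_mul_inv, div_div, div_le_iff₀ (by positivity), Real.exp_add]
    linarith
  refine le_trans ?_ h4
  rw [mul_assoc]
  gcongr
  rw [Real.rpow_def_of_pos hQ0, ← Real.exp_add, Real.exp_le_exp]
  have e3 : (1+κ)^2 * β / α = (β + b1) / α' := by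
    rw [hb1, hα']; field_simp
  rw [e3]
  have : (β + b1) * m ≤ (β+b1) * ((Real.log Q + M)/α' + 2) := by gcongr
  have e4 : (β+b1) * ((Real.log Q + M)/α' + 2) = (β + b1) * (M/α' + 2) + Real.log Q * ((β + b1)/α') := by ring
  linarith

lemma exists_J (ε : ℝ) (hε : 0 < ε) : ∃ J : ℕ, 1 ≤ J ∧ (1 + 1/(J:ℝ))^5 / 2 ≤ 1/2 + ε := by
  have h : Tendsto (fun J : ℕ => (1 + 1/(J:ℝ))^5/2) atTop (𝓝 ((1+0)^5/2)) :=
    ((tendsto_const_nhds.add (tendsto_const_div_atTop_nhds_zero_nat 1)).pow 5).div_const 2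
  have h2 : ∀ᶠ J : ℕ in atTop, (1 + 1/(J:ℝ))^5/2 < 1/2 + ε :=
    h.eventually_lt_const (by norm_num; exact hε)
  obtain ⟨J, hJ, hJ1⟩ := (h2.and (eventually_ge_atTop 1)).exists
  exact ⟨J, hJ1, hJ.le⟩

end

section
open MeasureTheory Set Filter Topology

lemma absc_zetaMul {q : ℕ} (χ : DirichletCharacter ℂ q) {s : ℂ} (hs : 1 < s.re) :
    LSeries.abscissaOfAbsConv χ.zetaMul < s.re := by
  refine lt_of_le_of_lt (b := ((1:ℝ):EReal)) ?_ (by exact_mod_cast hs)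
  refine LSeries.abscissaOfAbsConv_le_of_forall_lt_LSeriesSummable (fun y hy => ?_)
  exact χ.LSeriesSummable_zetaMul (by simpa using hy)

open scoped ComplexOrder in
lemma lower_sum {q : ℕ} {χ : DirichletCharacter ℂ q} (hχ : χ ^ 2 = 1) {A : ℝ} (hA : 2 ≤ A) (m : ℕ) (hm : 1 ≤ m) :
    (m.factorial : ℝ) * ((16:ℝ)^(-A) / 3 * ((A - 1/2)⁻¹)^m / (m+1)) ≤ ‖LSeries (LSeries.logMul^[m] χ.zetaMul) A‖ := by
  have hm0 : (0:ℝ) < m := by exact_mod_cast hm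
  have hsum : LSeriesSummable (LSeries.logMul^[m] χ.zetaMul) A := by
    apply LSeriesSummable_of_abscissaOfAbsConv_lt_re
    rw [LSeries.absicssaOfAbsConv_logPowMul]
    exact absc_zetaMul χ (by simp; linarith)
  refine le_trans ?_ (Complex.re_le_norm _)
  have hterm : ∀ n : ℕ, n ≠ 0 → (LSeries.term (LSeries.logMul^[m] χ.zetaMul) A n).re = (Real.log n)^m * (χ.zetaMul n).re / (n:ℝ)^A := by
    intro n hn
    rw [LSeries.term_of_ne_zero hn, logMul_iter]
    have h1 : χ.zetaMul n = (((χ.zetaMul n).re : ℝ) : ℂ) := by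
      have := (Complex.le_def.1 (DirichletCharacter.zetaMul_nonneg hχ n)).2
      apply Complex.ext <;> simp [← this]
    rw [h1]
    have h2 : (n:ℂ) ^ (A:ℂ) = (((n:ℝ)^A : ℝ):ℂ) := by
      rw [Complex.ofReal_cpow (by positivity)]; simp
    rw [h2]
    norm_cast
  have hnn : ∀ n : ℕ, 0 ≤ (χ.zetaMul n).re := fun n => (Complex.le_def.1 (DirichletCharacter.zetaMul_nonneg hχ n)).1
  have htn : ∀ n : ℕ, 0 ≤ (LSeries.term (LSeries.logMul^[m] χ.zetaMul) A n).re := by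
    intro n
    rcases eq_or_ne n 0 with rfl | hn
    · simp
    · rw [hterm n hn]
      have := hnn n
      have := Real.log_natCast_nonneg n
      positivity
  have hre : (LSeries (LSeries.logMul^[m] χ.zetaMul) A).re = ∑' n, (LSeries.term (LSeries.logMul^[m] χ.zetaMul) A n).re :=
    Complex.re_tsum hsum
  have hsum' : Summable (fun n => (LSeries.term (LSeries.logMul^[m] χ.zetaMul) A n).re) :=
    (Complex.hasSum_re hsum.hasSum).summable
  rw [hre]
  have hA1 : 0 < 2*A - 1 := by linarith
  set E := Real.exp (m / (2*A-1)) with hE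
  have hE1 : 1 ≤ E := Real.one_le_exp (by positivity)
  have hE0 : 0 < E := by linarith
  set N := ⌈E⌉₊ with hN
  have hN1 : E ≤ N := Nat.le_ceil E
  have hN2 : (N:ℝ) ≤ 2 * E := by
    have := Nat.ceil_lt_add_one hE0.le
    linarith
  have hNp : 0 < N := by rw [hN]; exact Nat.ceil_pos.2 hE0
  have hinj : Set.InjOn (fun k : ℕ => k^2) (Finset.Ico N (2*N)) := fun a _ b _ h => by
    simpa using h
  have h1 := hsum'.sum_le_tsum ((Finset.Ico N (2*N)).image (fun k => k^2)) (fun n _ => htn n)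
  rw [Finset.sum_image hinj] at h1
  refine le_trans ?_ h1
  have h2 : ∀ k ∈ Finset.Ico N (2*N), (m / (A-1/2))^m / ((16:ℝ)^A * E^(2*A)) ≤ (LSeries.term (LSeries.logMul^[m] χ.zetaMul) A (k^2)).re := by
    intro k hk
    rw [Finset.mem_Ico] at hk
    have hk0 : k ≠ 0 := by omega
    have hkN : (N:ℝ) ≤ k := by exact_mod_cast hk.1
    have hkE : E ≤ k := hN1.trans hkN
    have hk4 : (k:ℝ) ≤ 4 * E := by
      have : (k:ℝ) ≤ 2 * N := by exact_mod_cast hk.2.le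
      linarith
    rw [hterm _ (pow_ne_zero 2 hk0)]
    have hz : 1 ≤ (χ.zetaMul (k^2)).re := by
      have := (Complex.le_def.1 (zetaMul_sq hχ k hk0)).1
      simpa using this
    have hl : m / (A - 1/2) ≤ Real.log ((k^2 : ℕ):ℝ) := by
      push_cast
      rw [Real.log_pow]
      have := Real.log_le_log hE0 hkE
      rw [hE, Real.log_exp] at this
      have e : m / (A-1/2) = 2 * (m/(2*A-1)) := by
        have : A - 1/2 ≠ 0 := by linarith
        field_simp
      rw [e]; push_cast; linarith
    have hd : (((k^2:ℕ):ℝ))^A ≤ (16:ℝ)^A * E^(2*A) := by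
      have e1 : (E:ℝ)^(2*A) = (E^2)^A := by
        rw [Real.rpow_mul hE0.le]; norm_num
      rw [e1, ← Real.mul_rpow (by norm_num) (by positivity)]
      push_cast
      apply Real.rpow_le_rpow (by positivity) _ (by linarith)
      nlinarith [Nat.cast_nonneg (α := ℝ) k]
    have hA2 : 0 < A - 1/2 := by linarith
    have hkp : (0:ℝ) < ((k^2:ℕ):ℝ)^A := by
      apply Real.rpow_pos_of_pos; exact_mod_cast pow_pos (Nat.pos_of_ne_zero hk0) 2
    apply div_le_div₀
    · have := hnn (k^2)
      have h3 : 0 ≤ m / (A-1/2) := by positivity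
      have := h3.trans hl
      positivity
    · calc (m / (A-1/2))^m ≤ (Real.log ((k^2 : ℕ):ℝ))^m := by gcongr
        _ ≤ _ := le_mul_of_one_le_right (by have h3 : 0 ≤ m / (A-1/2) := by positivity
                                            have := h3.trans hl
                                            positivity) hz
    · exact hkp
    · exact hd
  have h3 := Finset.card_nsmul_le_sum _ _ _ h2
  refine le_trans ?_ h3
  simp only [Nat.card_Ico, nsmul_eq_mul]
  have hcard : ((2 * N - N : ℕ):ℝ) = N := by
    congr 1; omega
  rw [hcard]
  have hA2 : 0 < A - 1/2 := by linarith
  calc (m.factorial : ℝ) * ((16:ℝ)^(-A) / 3 * ((A - 1/2)⁻¹)^m / (m+1))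
      ≤ (3 * (m+1) * (m^m * Real.exp (-m))) * ((16:ℝ)^(-A) / 3 * ((A - 1/2)⁻¹)^m / (m+1)) := by
        gcongr; exact fact_le' m hm
    _ = E * ((m / (A-1/2))^m / ((16:ℝ)^A * E^(2*A))) := by
        have e1 : Real.exp (-m) = E / E^(2*A) := by
          rw [hE, ← Real.exp_mul, ← Real.exp_sub]
          congr 1; field_simp; ring
        rw [e1, Real.rpow_neg (by norm_num), div_pow, inv_pow]
        have := Real.rpow_pos_of_pos (by norm_num : (0:ℝ)<16) A
        have := Real.rpow_pos_of_pos hE0 (2*A)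
        field_simp
    _ ≤ _ := by gcongr

lemma zL_eq {q : ℕ} [NeZero q] {χ : DirichletCharacter ℂ q} (hχ : χ ≠ 1) {s : ℂ} (hs : 1 < s.re) :
    LSeries χ.zetaMul s = (s / (s-1) + LP Pz s) * LP (chS χ) s := by
  rw [DirichletCharacter.zetaMul, ArithmeticFunction.LSeries_mul', ← zeta_eq hs, ← chL_eq hχ hs]
  · congr 1
    · exact ArithmeticFunction.LSeries_zeta_eq_riemannZeta hs
    · exact LSeries_congr (fun {n} hn => (χ.apply_eq_toArithmeticFunction_apply hn).symm) s
  · exact ArithmeticFunction.LSeriesSummable_zeta_iff.mpr hs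
  · exact (LSeriesSummable_congr _ fun h ↦ (χ.apply_eq_toArithmeticFunction_apply h).symm).mpr <|
      ZMod.LSeriesSummable_of_one_lt_re χ hs

lemma iterDeriv_pole (l : ℂ) (A : ℝ) (hA : 1 < A) (m : ℕ) :
    ‖iteratedDeriv m (fun s : ℂ => l * (s - 1)⁻¹) A‖ = m.factorial * (‖l‖ * ((A-1)⁻¹)^(m+1)) := by
  rw [iteratedDeriv_const_mul_field, norm_mul]
  have h := congrFun (iter_deriv_inv_linear_sub (𝕜 := ℂ) m 1 1) A
  simp only [one_mul] at h
  rw [iteratedDeriv_eq_iterate, h]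
  simp only [norm_mul, norm_pow, norm_neg, norm_one, one_pow, one_mul, mul_one, Complex.norm_natCast]
  have e : (A:ℂ) - 1 = ((A-1:ℝ):ℂ) := by push_cast; rfl
  rw [e, norm_zpow, Complex.norm_real, Real.norm_of_nonneg (by linarith), inv_pow, ← zpow_natCast, ← zpow_neg]
  push_cast
  rw [show (-1 - (m:ℤ)) = -((m:ℤ)+1) by ring]
  ring

lemma upper_sum (J : ℕ) (hJ : 1 ≤ J) (A : ℝ) (hA : 2 ≤ A) : ∃ K : ℝ, 0 < K ∧ ∀ (q : ℕ) [NeZero q] (χ : DirichletCharacter ℂ q), χ ≠ 1 →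
    ∀ m : ℕ, ‖LSeries (LSeries.logMul^[m] χ.zetaMul) A‖ ≤
      m.factorial * (‖LP (chS χ) 1‖ * ((A-1)⁻¹)^(m+1) + K * (q:ℝ)^(J+1) * ((A + J - 1/2)⁻¹)^m) := by
  have hJ' : (1:ℝ) ≤ J := by exact_mod_cast hJ
  set ρ := A + J - 1/2 with hρ
  obtain ⟨C, hC, hcont⟩ := Good.cont J (A + ρ) (by linarith)
  refine ⟨C * (1 + 2 + C), by positivity, fun q _ χ hχ m => ?_⟩
  have hq1 : (1:ℝ) ≤ q := by exact_mod_cast Nat.one_le_iff_ne_zero.2 (NeZero.ne q)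
  obtain ⟨F, hF1, hF2, hF3⟩ := hcont q q (chS χ) hq1 chS_good
  obtain ⟨Z, hZ1, hZ2, hZ3⟩ := hcont 1 1 Pz le_rfl Pz_good
  set l := LP (chS χ) 1 with hl
  have hFl : F 1 = l := hF2 1 (by simp)
  have hopen : IsOpen {s : ℂ | -(J:ℝ) < s.re} := isOpen_lt continuous_const Complex.continuous_re
  have h1mem : {s : ℂ | -(J:ℝ) < s.re} ∈ 𝓝 (1:ℂ) := hopen.mem_nhds (by simp; linarith)
  set h : ℂ → ℂ := fun s => F s + dslope F 1 s + Z s * F s with hh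
  have hdiff : DifferentiableOn ℂ h {s : ℂ | -(J:ℝ) < s.re} :=
    (hF1.add ((Complex.differentiableOn_dslope h1mem).2 hF1)).add (hZ1.mul hF1)
  have hball : Metric.closedBall (A:ℂ) ρ ⊆ {s : ℂ | -(J:ℝ) < s.re} := by
    intro s hs
    rw [mem_closedBall_iff_norm] at hs
    have := (Complex.abs_re_le_norm (s - A)).trans hs
    rw [abs_le] at this
    simp only [Complex.sub_re, Complex.ofReal_re] at this
    simp only [mem_ofPred_eq]; linarith
  have hρ0 : 0 < ρ := by linarith
  have hdc : DiffContOnCl ℂ h (Metric.ball (A:ℂ) ρ) := by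
    apply DifferentiableOn.diffContOnCl
    rw [closure_ball _ hρ0.ne']
    exact hdiff.mono hball
  have hsph : ∀ z ∈ Metric.sphere (A:ℂ) ρ, ‖h z‖ ≤ C * (1 + 2 + C) * (q:ℝ)^(J+1) := by
    intro z hz
    rw [mem_sphere_iff_norm] at hz
    have hre := (Complex.abs_re_le_norm (z - A)).trans hz.le
    rw [abs_le] at hre
    simp only [Complex.sub_re, Complex.ofReal_re] at hre
    have hnz : ‖z‖ ≤ A + ρ := by
      have := norm_add_le (z - A) A
      simp only [sub_add_cancel, Complex.norm_real] at this
      rw [Real.norm_of_nonneg (by linarith)] at this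
      linarith
    have hFz := hF3 z hnz (by linarith)
    have hZz := hZ3 z hnz (by linarith)
    have hF1' := hF3 1 (by simp; linarith) (by simp; linarith)
    rw [one_pow, mul_one, mul_one] at hZz
    have hz1 : 1 ≤ ‖z - 1‖ := by
      have := norm_sub_le (z - 1) (A - 1)
      rw [sub_sub_sub_cancel_right, hz] at this
      have e : (A:ℂ) - 1 = ((A-1:ℝ):ℂ) := by push_cast; rfl
      rw [e, Complex.norm_real, Real.norm_of_nonneg (by linarith)] at this
      linarith
    have hne : z ≠ 1 := by rintro rfl; simp at hz1; linarith
    have hds : ‖dslope F 1 z‖ ≤ 2 * (C * q * q^J) := by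
      rw [dslope_of_ne _ hne, slope_def_field, norm_div]
      calc ‖F z - F 1‖ / ‖z - 1‖ ≤ ‖F z - F 1‖ := div_le_self (norm_nonneg _) hz1
        _ ≤ ‖F z‖ + ‖F 1‖ := norm_sub_le _ _
        _ ≤ _ := by linarith
    calc ‖h z‖ ≤ ‖F z‖ + ‖dslope F 1 z‖ + ‖Z z‖ * ‖F z‖ := by
          refine (norm_add_le _ _).trans ?_
          rw [norm_mul]
          gcongr
          exact norm_add_le _ _
      _ ≤ (C * q * q^J) + 2 * (C * q * q^J) + C * (C * q * q^J) := by gcongr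
      _ = _ := by ring
  have hcau := Complex.norm_iteratedDeriv_le_of_forall_mem_sphere_norm_le m hρ0 hdc hsph
  have hAre : 1 < (A:ℂ).re := by simp; linarith
  have hev : LSeries χ.zetaMul =ᶠ[𝓝 (A:ℂ)] fun s => l * (s-1)⁻¹ + h s := by
    have : {s : ℂ | 1 < s.re} ∈ 𝓝 (A:ℂ) := (isOpen_lt continuous_const Complex.continuous_re).mem_nhds hAre
    filter_upwards [this] with s hs
    have hs' : 1 < s.re := hs
    have hs1 : s ≠ 1 := by rintro rfl; simp at hs'
    rw [zL_eq hχ hs']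
    simp only [hh]
    rw [dslope_of_ne _ hs1, slope_def_field, hFl, hF2 s (by linarith), hZ2 s (by linarith)]
    have : s - 1 ≠ 0 := sub_ne_zero.2 hs1
    field_simp
    ring
  have hid := hev.iteratedDeriv_eq m
  rw [LSeries_iteratedDeriv m (absc_zetaMul χ hAre)] at hid
  have hcd : ContDiffAt ℂ m h A := by
    have : AnalyticAt ℂ h A := (hdiff.analyticOnNhd hopen) _ (hball (Metric.mem_closedBall_self hρ0.le))
    exact this.contDiffAt
  have hcd2 : ContDiffAt ℂ m (fun s : ℂ => l * (s-1)⁻¹) A := by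
    refine contDiffAt_const.mul (ContDiffAt.inv (by fun_prop) ?_)
    intro h; have := congrArg Complex.re h; simp at this; linarith
  have hadd : iteratedDeriv m (fun s : ℂ => l * (s-1)⁻¹ + h s) A = iteratedDeriv m (fun s : ℂ => l * (s-1)⁻¹) A + iteratedDeriv m h A :=
    iteratedDeriv_fun_add hcd2 hcd
  rw [hadd] at hid
  have hno := congrArg norm hid
  rw [norm_mul, norm_pow, norm_neg, norm_one, one_pow, one_mul] at hno
  rw [hno]
  refine (norm_add_le _ _).trans ?_
  rw [iterDeriv_pole l A (by linarith), mul_add]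
  gcongr
  refine hcau.trans (le_of_eq ?_)
  rw [inv_pow]; field_simp

theorem L1_lower (ε : ℝ) (hε : 0 < ε) : ∃ c : ℝ, 0 < c ∧ ∀ (q : ℕ) [NeZero q] (χ : DirichletCharacter ℂ q), χ ≠ 1 → χ^2 = 1 →
    c * (q:ℝ)^(-(1/2+ε)) ≤ ‖LP (chS χ) 1‖ := by
  obtain ⟨J, hJ, hJε⟩ := exists_J ε hε
  have hJ' : (1:ℝ) ≤ J := by exact_mod_cast hJ
  set A : ℝ := (J:ℝ)^2 + 1 with hAdef
  have hA : 2 ≤ A := by rw [hAdef]; nlinarith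
  obtain ⟨K, hK, hup⟩ := upper_sum J hJ A hA
  have hr1 : 1 < (A + J - 1/2) / (A - 1/2) := by rw [one_lt_div (by linarith)]; linarith
  have hr2 : 1 < (A - 1/2) / (A - 1) := by rw [one_lt_div (by linarith)]; linarith
  set α := Real.log ((A + J - 1/2) / (A - 1/2)) with hα
  set β := Real.log ((A - 1/2) / (A - 1)) with hβ
  have hα0 : 0 < α := Real.log_pos hr1
  have hβ0 : 0 < β := Real.log_pos hr2
  have hA1 : 0 < A - 1 := by linarith
  have hA2 : 0 < A - 1/2 := by linarith
  have hA3 : 0 < A + J - 1/2 := by linarith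
  obtain ⟨c', hc', hopt⟩ := opt_lemma (c := (16:ℝ)^(-A)/3) (κ := 1/(J:ℝ)) hα0 hβ0 hK (by positivity) (by positivity)
  refine ⟨c', hc', fun q _ χ hχ hχ2 => ?_⟩
  have hq1 : (1:ℝ) ≤ q := by exact_mod_cast Nat.one_le_iff_ne_zero.2 (NeZero.ne q)
  have hq0 : (0:ℝ) < q := by linarith
  have h := hopt ((q:ℝ)^(J+1)) (‖LP (chS χ) 1‖) (one_le_pow₀ hq1) (norm_nonneg _) ?_
  · refine le_trans ?_ h
    gcongr
    rw [← Real.rpow_natCast, ← Real.rpow_mul hq0.le]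
    apply Real.rpow_le_rpow_of_exponent_le hq1
    have hβle : β ≤ 1 / (2 * (J:ℝ)^2) := by
      have := Real.log_le_sub_one_of_pos (lt_trans one_pos hr2)
      refine this.trans (le_of_eq ?_)
      rw [hAdef]; field_simp; ring
    have hαge : J / ((J:ℝ)^2 + J + 1/2) ≤ α := by
      have := Real.one_sub_inv_le_log_of_pos (lt_trans one_pos hr1)
      refine le_trans (le_of_eq ?_) this
      rw [inv_div, eq_sub_iff_add_eq, div_add_div _ _ (by positivity) (by linarith), div_eq_one_iff_eq (by positivity), hAdef]; ring
    have hfin : ((J:ℝ)+1) * ((1 + 1/(J:ℝ))^2 * β / α) ≤ (1 + 1/(J:ℝ))^5 / 2 := by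
      calc ((J:ℝ)+1) * ((1 + 1/(J:ℝ))^2 * β / α) ≤ (J+1) * ((1 + 1/(J:ℝ))^2 * (1 / (2 * (J:ℝ)^2)) / (J / ((J:ℝ)^2 + J + 1/2))) := by gcongr
        _ ≤ (J+1) * ((1 + 1/(J:ℝ))^2 * (1 / (2 * (J:ℝ)^2)) / (J / ((J:ℝ)+1)^2)) := by
            gcongr
            nlinarith
        _ = _ := by field_simp
    push_cast
    linarith
  · intro m hm
    have hb := (lower_sum hχ2 hA m hm).trans (hup q χ hχ m)
    have hmf : (0:ℝ) < m.factorial := by positivity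
    have hb := le_of_mul_le_mul_left hb hmf
    have hpos : 0 < (A-1/2)^m := by positivity
    have hb := mul_le_mul_of_nonneg_right hb hpos.le
    have e1 : (16:ℝ)^(-A) / 3 * ((A - 1/2)⁻¹)^m / (m+1) * (A-1/2)^m = (16:ℝ)^(-A) / 3 / (m+1) := by
      rw [inv_pow, div_mul_eq_mul_div, mul_assoc, inv_mul_cancel₀ hpos.ne', mul_one]
    have e2 : Real.exp (β * m) = ((A-1/2)/(A-1))^m := by
      rw [mul_comm, Real.exp_nat_mul, hβ, Real.exp_log (by positivity)]
    have e3 : Real.exp (-(α * m)) = ((A-1/2)/(A+J-1/2))^m := by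
      rw [mul_comm, ← mul_neg, Real.exp_nat_mul, hα, ← Real.log_inv, Real.exp_log (by positivity), inv_div]
    rw [e1] at hb
    refine hb.trans ?_
    rw [e2, e3, add_mul]
    have hA1' : 1 ≤ A - 1 := by linarith
    have hA1'' : (A-1)⁻¹ ≤ 1 := inv_le_one_of_one_le₀ hA1'
    apply add_le_add
    · rw [mul_assoc, div_pow, pow_succ, inv_pow]
      gcongr
      calc ((A-1)^m)⁻¹ * (A-1)⁻¹ * (A-1/2)^m ≤ ((A-1)^m)⁻¹ * 1 * (A-1/2)^m := by gcongr
        _ = _ := by field_simp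
    · rw [mul_assoc, div_pow, inv_pow]
      refine le_of_eq ?_
      field_simp

end

section
open MeasureTheory Set Filter Topology

noncomputable def f0 (s : ℂ) : ℂ := s + (s-1) * LP Pz s
noncomputable def GG {q : ℕ} (χ : DirichletCharacter ℂ q) (s : ℂ) : ℂ := f0 s * LP (chS χ) s

lemma LPz_bound {s : ℂ} (hs : 0 < s.re) : ‖LP Pz s‖ ≤ ‖s‖ / s.re := by
  have := LP_bound (κ := 0) (B := 1) (s := s) Pz_good.meas (fun u _ => by simpa using Pz_good.bd u) hs
  simpa using this

lemma f0_diff {s : ℂ} (hs : 0 < s.re) : DifferentiableAt ℂ f0 s := by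
  have := LP_diff Pz_good.meas Pz_good.bd hs
  unfold f0
  fun_prop

lemma f0_bound {s : ℂ} (hs : 1/2 ≤ s.re) : ‖f0 s‖ ≤ 3 * (‖s‖+1)^2 := by
  have h := LPz_bound (s := s) (by linarith)
  have h2 : ‖s‖ / s.re ≤ 2 * ‖s‖ := by
    rw [div_le_iff₀ (by linarith)]; nlinarith [norm_nonneg s]
  have h3 : ‖s - 1‖ ≤ ‖s‖ + 1 := by simpa using norm_sub_le s 1
  calc ‖f0 s‖ ≤ ‖s‖ + ‖s-1‖ * ‖LP Pz s‖ := by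
        unfold f0; exact (norm_add_le _ _).trans (by rw [norm_mul])
    _ ≤ ‖s‖ + (‖s‖+1) * (2*‖s‖) := by gcongr; exact h.trans h2
    _ ≤ _ := by nlinarith [norm_nonneg s]

lemma LSeries_norm_le {f : ℕ → ℂ} (hf : ∀ n, ‖f n‖ ≤ 1) {s : ℂ} (hs : 1 < s.re) (hs2 : s.re ≤ 2) : ‖LSeries f s‖ ≤ 3 / (s.re - 1) := by
  have h1 : ∀ n, ‖LSeries.term f s n‖ ≤ 1 / (n:ℝ)^s.re := by
    intro n
    rw [LSeries.norm_term_eq]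
    split_ifs with h
    · positivity
    · gcongr; exact hf n
  have hsum := Real.summable_one_div_nat_rpow.2 hs
  have h2 : ‖LSeries f s‖ ≤ ∑' n : ℕ, 1 / (n:ℝ)^s.re := tsum_of_norm_bounded hsum.hasSum h1
  have hre : 1 < ((s.re:ℝ):ℂ).re := by simpa using hs
  have h3 : ((∑' n : ℕ, 1 / (n:ℝ)^s.re : ℝ):ℂ) = riemannZeta (s.re:ℂ) := by
    rw [zeta_eq_tsum_one_div_nat_cpow hre, Complex.ofReal_tsum]
    refine tsum_congr fun n => ?_
    rw [Complex.ofReal_div, Complex.ofReal_cpow (Nat.cast_nonneg n)]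
    simp
  have h4 : ∑' n : ℕ, 1 / (n:ℝ)^s.re = ‖riemannZeta (s.re:ℂ)‖ := by
    rw [← h3, Complex.norm_real, Real.norm_of_nonneg]
    exact tsum_nonneg fun n => by positivity
  rw [h4, zeta_eq hre] at h2
  refine h2.trans ((norm_add_le _ _).trans ?_)
  have h5 := LPz_bound (s := (s.re:ℂ)) (by simp; linarith)
  have e1 : ‖((s.re:ℝ):ℂ)‖ = s.re := by rw [Complex.norm_real, Real.norm_of_nonneg (by linarith)]
  have e2 : ‖((s.re:ℝ):ℂ) - 1‖ = s.re - 1 := by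
    rw [← Complex.ofReal_one, ← Complex.ofReal_sub, Complex.norm_real, Real.norm_of_nonneg (by linarith)]
  rw [norm_div, e1, e2]
  rw [e1, Complex.ofReal_re, div_self (by linarith)] at h5
  calc s.re / (s.re-1) + ‖LP Pz s.re‖ ≤ s.re / (s.re-1) + 1 := by gcongr
    _ ≤ _ := by
      rw [div_add_one (by linarith)]
      gcongr
      linarith

lemma mu_norm (n : ℕ) : ‖((ArithmeticFunction.moebius n : ℤ) : ℂ)‖ ≤ 1 := by
  rw [Complex.norm_intCast]
  exact_mod_cast ArithmeticFunction.abs_moebius_le_one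

lemma lower_of_mul {a b : ℂ} {σ : ℝ} (hσ : 1 < σ) (h : a * b = 1) (hb : ‖b‖ ≤ 3 / (σ - 1)) : (σ-1)/3 ≤ ‖a‖ := by
  have h1 : ‖a‖ * ‖b‖ = 1 := by rw [← norm_mul, h, norm_one]
  have h2 : 1 ≤ ‖a‖ * (3/(σ-1)) := h1.symm.le.trans (by gcongr)
  have h3 : 0 < σ - 1 := by linarith
  rw [← mul_div_assoc, le_div_iff₀ h3] at h2
  linarith

lemma f0_eq {s : ℂ} (hs : 1 < s.re) : f0 s = (s-1) * riemannZeta s := by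
  have : s - 1 ≠ 0 := by intro h; have := congrArg Complex.re h; simp at this; linarith
  rw [zeta_eq hs, f0]; field_simp

lemma f0_lower {s : ℂ} (hs : 1 < s.re) (hs2 : s.re ≤ 2) : (s.re-1)^2/3 ≤ ‖f0 s‖ := by
  have h1 := LSeries_one_mul_Lseries_moebius hs
  rw [LSeries_one_eq_riemannZeta hs] at h1
  have h2 := lower_of_mul hs h1 (LSeries_norm_le mu_norm hs hs2)
  have h3 : s.re - 1 ≤ ‖s - 1‖ := by simpa using Complex.re_le_norm (s-1)
  rw [f0_eq hs, norm_mul]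
  calc (s.re-1)^2/3 = (s.re-1) * ((s.re-1)/3) := by ring
    _ ≤ _ := by gcongr

lemma f0_ne {s : ℂ} (hs : 1 < s.re) : f0 s ≠ 0 := by
  rw [f0_eq hs]
  refine mul_ne_zero ?_ (riemannZeta_ne_zero_of_one_lt_re hs)
  intro h; have := congrArg Complex.re h; simp at this; linarith

section
variable {q : ℕ} [NeZero q] {χ : DirichletCharacter ℂ q}

lemma f1_diff {s : ℂ} (hs : 0 < s.re) : DifferentiableAt ℂ (LP (chS χ)) s :=
  LP_diff chS_good.meas chS_good.bd hs

lemma GG_diff {s : ℂ} (hs : 0 < s.re) : DifferentiableAt ℂ (GG χ) s :=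
  (f0_diff hs).mul (f1_diff hs)

lemma f1_bound {s : ℂ} (hs : 1/2 ≤ s.re) : ‖LP (chS χ) s‖ ≤ 2 * q * ‖s‖ := by
  have := LP_bound (κ := 0) (B := q) (s := s) (P := chS χ) chS_good.meas (fun u _ => by simpa using chS_good.bd u) (by linarith)
  refine this.trans ?_
  rw [sub_zero, div_le_iff₀ (by linarith)]
  have : 0 ≤ (q:ℝ) * ‖s‖ := by positivity
  nlinarith

lemma f1_lower (hχ : χ ≠ 1) {s : ℂ} (hs : 1 < s.re) (hs2 : s.re ≤ 2) : (s.re-1)/3 ≤ ‖LP (chS χ) s‖ := by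
  have h1 := DirichletCharacter.LSeries.mul_mu_eq_one χ hs
  rw [chL_eq hχ hs] at h1
  refine lower_of_mul hs h1 (LSeries_norm_le (fun n => ?_) hs hs2)
  simp only [Pi.mul_apply, norm_mul]
  exact mul_le_one₀ (χ.norm_le_one _) (norm_nonneg _) (mu_norm n)

lemma f1_ne (hχ : χ ≠ 1) {s : ℂ} (hs : 1 < s.re) : LP (chS χ) s ≠ 0 := by
  intro h
  have h1 := DirichletCharacter.LSeries.mul_mu_eq_one χ hs
  rw [chL_eq hχ hs, h] at h1
  simp at h1

lemma GG_ne (hχ : χ ≠ 1) {s : ℂ} (hs : 1 < s.re) : GG χ s ≠ 0 := mul_ne_zero (f0_ne hs) (f1_ne hχ hs)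

lemma GG_bound {s : ℂ} (hs : 1/2 ≤ s.re) : ‖GG χ s‖ ≤ 6 * q * (‖s‖+1)^3 := by
  rw [GG, norm_mul]
  calc _ ≤ 3 * (‖s‖+1)^2 * (2 * q * ‖s‖) := by gcongr; exacts [f0_bound hs, f1_bound hs]
    _ ≤ 3 * (‖s‖+1)^2 * (2 * q * (‖s‖+1)) := by gcongr; linarith
    _ = _ := by ring

lemma GG_lower (hχ : χ ≠ 1) {s : ℂ} (hs : 1 < s.re) (hs2 : s.re ≤ 2) : (s.re-1)^3/9 ≤ ‖GG χ s‖ := by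
  rw [GG, norm_mul]
  calc (s.re-1)^3/9 = (s.re-1)^2/3 * ((s.re-1)/3) := by ring
    _ ≤ _ := by gcongr; exacts [f0_lower hs hs2, f1_lower hχ hs hs2]

lemma Lam_eq {s : ℂ} (hs : 1 < s.re) : LSeries (fun n => (ArithmeticFunction.vonMangoldt n : ℂ)) s = 1/(s-1) - deriv f0 s / f0 s := by
  rw [ArithmeticFunction.LSeries_vonMangoldt_eq_deriv_riemannZeta_div hs]
  have hs1 : s - 1 ≠ 0 := by intro h; have := congrArg Complex.re h; simp at this; linarith
  have hz : riemannZeta s ≠ 0 := riemannZeta_ne_zero_of_one_lt_re hs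
  have hd : DifferentiableAt ℂ riemannZeta s := differentiableAt_riemannZeta (by rintro rfl; simp at hs1)
  have he : f0 =ᶠ[𝓝 s] fun z => (z-1) * riemannZeta z := by
    filter_upwards [(isOpen_lt continuous_const Complex.continuous_re).mem_nhds hs] with z hz using f0_eq hz
  rw [he.deriv_eq, f0_eq hs, deriv_fun_mul (by fun_prop) hd]
  simp
  field_simp
  ring

lemma tw_eq (hχ : χ ≠ 1) {s : ℂ} (hs : 1 < s.re) : LSeries (fun n => χ (n : ZMod q) * (ArithmeticFunction.vonMangoldt n : ℂ)) s = - (deriv (LP (chS χ)) s / LP (chS χ) s) := by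
  have h := DirichletCharacter.LSeries_twist_vonMangoldt_eq χ hs
  have he : LSeries (fun n => χ (n : ZMod q)) =ᶠ[𝓝 s] LP (chS χ) := by
    filter_upwards [(isOpen_lt continuous_const Complex.continuous_re).mem_nhds hs] with z hz using chL_eq hχ hz
  rw [he.deriv_eq, chL_eq hχ hs, neg_div] at h
  exact h

lemma sum1_eq (hχ : χ ≠ 1) {s : ℂ} (hs : 1 < s.re) :
    LSeries (fun n => (ArithmeticFunction.vonMangoldt n : ℂ) + χ (n : ZMod q) * (ArithmeticFunction.vonMangoldt n : ℂ)) s = 1/(s-1) - deriv (GG χ) s / GG χ s := by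
  have h := LSeries_add (ArithmeticFunction.LSeriesSummable_vonMangoldt hs) (DirichletCharacter.LSeriesSummable_twist_vonMangoldt χ hs)
  refine h.trans ?_
  have e1 := Lam_eq hs
  have e2 := tw_eq hχ hs
  have e3 : deriv (GG χ) s / GG χ s = deriv f0 s / f0 s + deriv (LP (chS χ)) s / LP (chS χ) s := by
    have : GG χ = fun s => f0 s * LP (chS χ) s := rfl
    rw [this, deriv_fun_mul (f0_diff (by linarith)) (f1_diff (by linarith))]
    have := f0_ne hs
    have := f1_ne hχ hs
    field_simp
  rw [e3]
  calc _ = (1/(s-1) - deriv f0 s / f0 s) + (- (deriv (LP (chS χ)) s / LP (chS χ) s)) := by rw [← e1, ← e2]; rfl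
    _ = _ := by ring

end

end

section
open MeasureTheory Set Filter Topology

lemma z341 (z : ℂ) (hz : ‖z‖ = 1) : 0 ≤ 3 + 4 * z.re + (z*z).re := by
  have h : z.re^2 + z.im^2 = 1 := by
    have := Complex.sq_norm z
    rw [hz, Complex.normSq_apply] at this; nlinarith
  rw [Complex.mul_re]
  nlinarith [sq_nonneg (z.re+1)]

lemma comb_nonneg {r : ℕ → ℝ} (hr : ∀ n, 0 ≤ r n) {σ : ℝ} (hσ : ∀ t : ℝ, LSeriesSummable (fun n => (r n : ℂ)) (σ + t * Complex.I)) (t : ℝ) :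
    0 ≤ 3 * (LSeries (fun n => (r n : ℂ)) σ).re + 4 * (LSeries (fun n => (r n : ℂ)) (σ + t * Complex.I)).re
      + (LSeries (fun n => (r n : ℂ)) (σ + (2*t:ℝ) * Complex.I)).re := by
  have h0 : LSeriesSummable (fun n => (r n : ℂ)) σ := by simpa using hσ 0
  have h1 := hσ t
  have h2 := hσ (2*t)
  have H0 := (Complex.hasSum_re h0.hasSum).summable.mul_left 3
  have H1 := (Complex.hasSum_re h1.hasSum).summable.mul_left 4
  have H2 := (Complex.hasSum_re h2.hasSum).summable
  simp only [LSeries]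
  rw [Complex.re_tsum h0, Complex.re_tsum h1, Complex.re_tsum h2, ← tsum_mul_left, ← tsum_mul_left,
    ← Summable.tsum_add, ← Summable.tsum_add]
  · refine tsum_nonneg fun n => ?_
    rcases eq_or_ne n 0 with rfl | hn
    · simp
    · have hn0 : (n:ℂ) ≠ 0 := by exact_mod_cast hn
      have hnp : (0:ℝ) < n := by exact_mod_cast Nat.pos_of_ne_zero hn
      set z : ℂ := ((n:ℂ) ^ ((t:ℂ) * Complex.I))⁻¹ with hz
      have hz1 : ‖z‖ = 1 := by
        rw [hz, norm_inv, Complex.norm_natCast_cpow_of_pos (Nat.pos_of_ne_zero hn)]; simp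
      have key := z341 z hz1
      have e0 : LSeries.term (fun n => (r n : ℂ)) σ n = ((r n / (n:ℝ)^σ : ℝ):ℂ) := by
        rw [LSeries.term_of_ne_zero hn, Complex.ofReal_div, Complex.ofReal_cpow hnp.le]; simp
      have e1 : LSeries.term (fun n => (r n : ℂ)) (σ + t * Complex.I) n = ((r n / (n:ℝ)^σ : ℝ):ℂ) * z := by
        rw [← e0, LSeries.term_of_ne_zero hn, LSeries.term_of_ne_zero hn, Complex.cpow_add _ _ hn0, hz]; field_simp
      have e2 : LSeries.term (fun n => (r n : ℂ)) (σ + (2*t:ℝ) * Complex.I) n = ((r n / (n:ℝ)^σ : ℝ):ℂ) * (z*z) := by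
        rw [← e0, LSeries.term_of_ne_zero hn, LSeries.term_of_ne_zero hn, Complex.cpow_add _ _ hn0, hz,
          show (((2*t:ℝ):ℂ) * Complex.I) = (t:ℂ) * Complex.I + (t:ℂ) * Complex.I by push_cast; ring, Complex.cpow_add _ _ hn0]
        field_simp
      rw [e0, e1, e2, Complex.re_ofReal_mul, Complex.re_ofReal_mul, Complex.ofReal_re]
      have hnn : 0 ≤ r n / (n:ℝ)^σ := div_nonneg (hr n) (by positivity)
      nlinarith [mul_nonneg hnn key]
  · exact H0.add H1
  · exact H2
  · exact H0
  · exact H1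

lemma LP_conj {P : ℝ → ℂ} (hP : ∀ u, (starRingEnd ℂ) (P u) = P u) (s : ℂ) : LP P ((starRingEnd ℂ) s) = (starRingEnd ℂ) (LP P s) := by
  unfold LP
  rw [map_mul, ← integral_conj]
  congr 1
  refine setIntegral_congr_fun measurableSet_Ioi fun u hu => ?_
  have hu0 : (0:ℝ) < u := lt_trans one_pos hu
  simp only [map_mul, hP]
  have := Complex.cpow_conj (u:ℂ) (-(s+1)) (by rw [Complex.arg_ofReal_of_nonneg hu0.le]; exact Real.pi_pos.ne)
  rw [Complex.conj_ofReal] at this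
  rw [← this]; simp

section
variable {q : ℕ} [NeZero q] {χ : DirichletCharacter ℂ q}

lemma chi_real (hχ2 : χ^2 = 1) (a : ZMod q) : χ a = 0 ∨ χ a = 1 ∨ χ a = -1 :=
  MulChar.isQuadratic_iff_sq_eq_one.mpr hχ2 a

lemma GG_conj (hχ2 : χ^2 = 1) (s : ℂ) : GG χ ((starRingEnd ℂ) s) = (starRingEnd ℂ) (GG χ s) := by
  unfold GG f0
  rw [LP_conj, LP_conj]
  · simp
  · intro u
    unfold chS
    rw [map_sum]
    refine Finset.sum_congr rfl fun k _ => ?_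
    rcases chi_real hχ2 (k : ZMod q) with h | h | h <;> simp [h]
  · intro u; simp [Pz]

noncomputable def r1 (χ : DirichletCharacter ℂ q) (n : ℕ) : ℝ := ArithmeticFunction.vonMangoldt n * (1 + (χ (n : ZMod q)).re)

lemma r1_nonneg (χ : DirichletCharacter ℂ q) (n : ℕ) : 0 ≤ r1 χ n := by
  refine mul_nonneg ArithmeticFunction.vonMangoldt_nonneg ?_
  have h := Complex.abs_re_le_norm (χ (n : ZMod q))
  have := χ.norm_le_one (n : ZMod q)
  linarith [(abs_le.1 (h.trans this)).1]

lemma r1_eq (hχ2 : χ^2 = 1) : (fun n => (r1 χ n : ℂ)) = fun n : ℕ => (ArithmeticFunction.vonMangoldt n : ℂ) + χ (n : ZMod q) * (ArithmeticFunction.vonMangoldt n : ℂ) := by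
  ext n
  unfold r1
  rcases chi_real hχ2 (n : ZMod q) with h | h | h <;> simp [h]; ring

lemma r1_summable (hχ2 : χ^2 = 1) {s : ℂ} (hs : 1 < s.re) : LSeriesSummable (fun n => (r1 χ n : ℂ)) s := by
  rw [r1_eq hχ2]
  exact (ArithmeticFunction.LSeriesSummable_vonMangoldt hs).add (DirichletCharacter.LSeriesSummable_twist_vonMangoldt χ hs)

lemma comb_GG (hχ : χ ≠ 1) (hχ2 : χ^2 = 1) {η : ℝ} (hη : 0 < η) (t : ℝ) :
    3 * (deriv (GG χ) (1+η:ℝ) / GG χ (1+η:ℝ)).re + 4 * (deriv (GG χ) ((1+η:ℝ) + t * Complex.I) / GG χ ((1+η:ℝ) + t * Complex.I)).re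
     + (deriv (GG χ) ((1+η:ℝ) + (2*t:ℝ) * Complex.I) / GG χ ((1+η:ℝ) + (2*t:ℝ) * Complex.I)).re
     ≤ 3 / η + 4 * (η / (η^2+t^2)) + η / (η^2+(2*t)^2) := by
  have h := comb_nonneg (r1_nonneg χ) (σ := 1+η) (fun t => r1_summable hχ2 (by simp [hη])) t
  have hr : ∀ t : ℝ, (1 / (((1+η:ℝ):ℂ) + (t:ℝ) * Complex.I - 1)).re = η / (η^2+t^2) := by
    intro t
    rw [one_div, Complex.inv_re]
    simp [Complex.normSq_apply, pow_two]
  rw [r1_eq hχ2, sum1_eq hχ (by simp [hη]), sum1_eq hχ (by simp [hη]), sum1_eq hχ (by simp [hη])] at h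
  have h0 := hr 0
  simp only [Complex.ofReal_zero, zero_mul, add_zero] at h0
  rw [Complex.sub_re, Complex.sub_re, Complex.sub_re, hr, hr, h0] at h
  have e : η / (η^2+0^2) = 1 / η := by field_simp; ring
  rw [e] at h
  have : 3 / η = 3 * (1/η) := by ring
  linarith

lemma one_GG (hχ : χ ≠ 1) (hχ2 : χ^2 = 1) {η : ℝ} (hη : 0 < η) :
    (deriv (GG χ) (1+η:ℝ) / GG χ (1+η:ℝ)).re ≤ 1 / η := by
  have h := comb_GG hχ hχ2 hη 0
  simp only [Complex.ofReal_zero, zero_mul, add_zero, mul_zero] at h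
  have e : η / (η^2+0^2) = 1 / η := by field_simp; ring
  rw [e] at h
  have : 3 / η = 3 * (1/η) := by ring
  linarith

/- the growth hypothesis on the closed ball of radius 1/2 -/
lemma GG_growth (hχ : χ ≠ 1) {M η : ℝ} (hM : 4 ≤ M) (hη : η = 1/100000 / Real.log (q*M)) {c : ℂ} (hc : 1 + η ≤ c.re) (hc2 : c.re ≤ 2)
    (hcM : |c.im| + 4 ≤ 2 * M) (z : ℂ) (hz : z ∈ Metric.closedBall c (1/2)) :
    ‖GG χ z‖ ≤ ‖GG χ c‖ * Real.exp (36 * Real.log (q*M)) := by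
  have hq1 : (1:ℝ) ≤ q := by exact_mod_cast Nat.one_le_iff_ne_zero.2 (NeZero.ne q)
  set X := (q:ℝ)*M with hX
  have hX4 : 4 ≤ X := by nlinarith
  have hl1 : 1 ≤ Real.log X := by
    rw [Real.le_log_iff_exp_le (by linarith)]
    linarith [Real.exp_one_lt_d9]
  have hη0 : 0 < η := by rw [hη]; positivity
  have hzc : ‖z - c‖ ≤ 1/2 := by simpa [dist_eq_norm] using hz
  have hzre : 1/2 ≤ z.re := by
    have := (abs_le.1 ((Complex.abs_re_le_norm (z-c)).trans hzc)).1
    simp at this; linarith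
  have hcn : ‖c‖ ≤ 2 + |c.im| := by
    refine (Complex.norm_le_abs_re_add_abs_im c).trans ?_
    rw [abs_of_pos (by linarith)]; linarith
  have hzn : ‖z‖ + 1 ≤ 2*M := by
    have : ‖z‖ ≤ ‖z - c‖ + ‖c‖ := by simpa using norm_add_le (z-c) c
    linarith
  have h1 := GG_bound (χ := χ) hzre
  have h2 := GG_lower hχ (s := c) (by linarith) hc2
  have h3 : η^3 / 9 ≤ ‖GG χ c‖ := le_trans (by gcongr; linarith) h2
  have hlX : Real.log X ≤ X := (Real.log_le_sub_one_of_pos (by linarith)).trans (by linarith)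
  have hexp : Real.exp (36 * Real.log X) = X^36 := by
    rw [show (36:ℝ) = ((36:ℕ):ℝ) by norm_num, Real.exp_nat_mul, Real.exp_log (by linarith)]
  rw [hexp]
  calc ‖GG χ z‖ ≤ 6 * q * (2*M)^3 := h1.trans (by gcongr)
    _ ≤ 48 * X^3 := by
      rw [hX]
      have : 48 * ((q:ℝ)*M)^3 - 6 * q * (2*M)^3 = 48 * q * M^3 * (q^2-1) := by ring
      have : 0 ≤ 48 * q * M^3 * ((q:ℝ)^2-1) := by
        have : 0 ≤ (q:ℝ)^2 - 1 := by nlinarith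
        positivity
      linarith
    _ ≤ η^3/9 * X^36 := by
      rw [hη]
      have h4 : (4:ℝ)^30 ≤ X^30 := by gcongr
      have : (1/100000 / Real.log X)^3 / 9 * X^36 = (X^6 * X^30) / (9 * 100000^3 * (Real.log X)^3) := by
        field_simp
      rw [this, le_div_iff₀ (by positivity)]
      calc 48 * X^3 * (9 * 100000^3 * Real.log X^3) ≤ 48 * X^3 * (9 * 100000^3 * X^3) := by gcongr
        _ = X^6 * (432 * 100000^3) := by ring
        _ ≤ X^6 * X^30 := by
          gcongr
          exact le_trans (by norm_num) h4
    _ ≤ _ := by gcongr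

end

end

section
open MeasureTheory Set Filter Topology

section
variable {q : ℕ} [NeZero q] {χ : DirichletCharacter ℂ q}

set_option maxHeartbeats 1000000 in
lemma zfr_complex (hχ : χ ≠ 1) (hχ2 : χ^2 = 1) {ρ : ℂ} (h0 : GG χ ρ = 0) (him : ρ.im ≠ 0) :
    1/400000 / Real.log (q*(|ρ.im|+4)) ≤ 1 - ρ.re := by
  have hq1 : (1:ℝ) ≤ q := by exact_mod_cast Nat.one_le_iff_ne_zero.2 (NeZero.ne q)
  set t := ρ.im with ht
  set β := ρ.re with hβ
  set M := |t| + 4 with hMdef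
  have hM : 4 ≤ M := by linarith [abs_nonneg t]
  set ℓ := Real.log (q*M) with hℓ
  have hX4 : 4 ≤ (q:ℝ)*M := by nlinarith
  have hl1 : 1 ≤ ℓ := by
    rw [hℓ, Real.le_log_iff_exp_le (by linarith)]
    linarith [Real.exp_one_lt_d9]
  set η := 1/100000 / ℓ with hη
  have hη0 : 0 < η := by positivity
  have hη1 : η ≤ 1/100000 := div_le_self (by norm_num) hl1
  have hηℓ : η * ℓ = 1/100000 := by rw [hη]; field_simp
  have hgoal : 1/400000/ℓ = η/4 := by rw [hη]; ring
  rw [hgoal]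
  by_contra! hcon
  have hβ1 : β ≤ 1 := by
    by_contra! h
    exact GG_ne hχ h h0
  have hρ : ρ = (β:ℂ) + t * Complex.I := (Complex.re_add_im ρ).symm
  have hL : 0 < 36 * ℓ := by linarith
  have hdiff : ∀ c : ℂ, 1 < c.re → DifferentiableOn ℂ (GG χ) (Metric.closedBall c (1/2)) := by
    intro c hc z hz
    have hzc : ‖z - c‖ ≤ 1/2 := by simpa [dist_eq_norm] using hz
    have := (abs_le.1 ((Complex.abs_re_le_norm (z-c)).trans hzc)).1
    simp at this
    exact (GG_diff (by linarith)).differentiableWithinAt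
  have hzr : ∀ c : ℂ, 1 < c.re → ∀ z ∈ Metric.ball c (1/2/3), GG χ z = 0 → z.re < c.re := by
    intro c hc z _ hz
    by_contra! h
    exact GG_ne hχ (by linarith) hz
  have hinv : 1/η = 100000 * ℓ := by rw [hη]; field_simp
  rcases le_or_gt (10*η) |t| with hbig | hsmall
  · -- large imaginary part
    have hcomb := comb_GG hχ hχ2 hη0 t
    set c0 : ℂ := ((1+η:ℝ):ℂ) with hc0
    set c1 : ℂ := ((1+η:ℝ):ℂ) + t * Complex.I with hc1
    set c2 : ℂ := ((1+η:ℝ):ℂ) + (2*t:ℝ) * Complex.I with hc2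
    have r0 : c0.re = 1 + η := by simp [hc0]
    have r1 : c1.re = 1 + η := by simp [hc1]
    have r2 : c2.re = 1 + η := by simp [hc2]
    have i0 : c0.im = 0 := by simp [hc0]
    have i1 : c1.im = t := by simp [hc1]
    have i2 : c2.im = 2*t := by simp [hc2]
    have l0 := landau_zero (c := c0) (R := 1/2) (L := 36*ℓ) (by norm_num) hL (hdiff _ (by linarith)) (GG_ne hχ (by linarith))
      (GG_growth hχ hM hη (by linarith) (by linarith) (by rw [i0, abs_zero]; linarith)) (hzr _ (by linarith))
    have l2 := landau_zero (c := c2) (R := 1/2) (L := 36*ℓ) (by norm_num) hL (hdiff _ (by linarith)) (GG_ne hχ (by linarith))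
      (GG_growth hχ hM hη (by linarith) (by linarith) (by rw [i2, abs_mul, abs_two]; linarith [abs_nonneg t])) (hzr _ (by linarith))
    have hd : c1 - ρ = ((1 + η - β : ℝ):ℂ) := by rw [hρ, hc1]; push_cast; ring
    have hmem : ρ ∈ Metric.ball c1 (1/2/3) := by
      rw [Metric.mem_ball, dist_comm, dist_eq_norm, hd, Complex.norm_real, Real.norm_of_nonneg (by linarith)]
      linarith
    have l1 := landau_one (c := c1) (R := 1/2) (L := 36*ℓ) (by norm_num) hL (hdiff _ (by linarith)) (GG_ne hχ (by linarith))
      (GG_growth hχ hM hη (by linarith) (by linarith) (by rw [i1]; linarith [abs_nonneg t])) (hzr _ (by linarith)) hmem h0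
    rw [hd, ← Complex.ofReal_one, ← Complex.ofReal_div, Complex.ofReal_re] at l1
    have b1 : η/(η^2+t^2) ≤ 1/101 * (1/η) := by
      rw [div_le_iff₀ (by positivity)]
      have : 100 * η^2 ≤ t^2 := by rw [← sq_abs t]; nlinarith
      have e : 1/101 * (1/η) * (η^2+t^2) = (η^2+t^2)/(101*η) := by field_simp
      rw [e, le_div_iff₀ (by positivity)]; nlinarith
    have b2 : η/(η^2+(2*t)^2) ≤ 1/101 * (1/η) := by
      refine le_trans ?_ b1
      exact div_le_div_of_nonneg_left hη0.le (by positivity) (by nlinarith [sq_nonneg t])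
    have b3 : 0.8 * (1/η) ≤ 1/(1+η-β) := by
      have : 1/(1.25*η) ≤ 1/(1+η-β) := one_div_le_one_div_of_le (by linarith) (by linarith)
      refine le_trans (le_of_eq ?_) this
      field_simp; norm_num
    have b4 : 3/η = 3 * (1/η) := by ring
    rw [b4] at hcomb
    rw [hinv] at hcomb b1 b2 b3
    linarith
  · -- tiny imaginary part
    have hone := one_GG hχ hχ2 (η := 40*η) (by linarith)
    set c0 : ℂ := ((1+40*η:ℝ):ℂ) with hc0
    have r0 : c0.re = 1 + 40*η := by simp [hc0]
    have i0 : c0.im = 0 := by simp [hc0]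
    have hd : c0 - ρ = ((1 + 40*η - β : ℝ):ℂ) - t * Complex.I := by rw [hρ, hc0]; push_cast; ring
    have hd' : c0 - (starRingEnd ℂ) ρ = ((1 + 40*η - β : ℝ):ℂ) + t * Complex.I := by
      rw [hρ, hc0]; simp; ring
    have hmem : ρ ∈ Metric.ball c0 (1/2/3) := by
      rw [Metric.mem_ball, dist_comm, dist_eq_norm, hd]
      refine (norm_sub_le _ _).trans_lt ?_
      rw [Complex.norm_real, Real.norm_of_nonneg (by linarith), norm_mul, Complex.norm_I, Complex.norm_real, Real.norm_eq_abs]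
      linarith
    have hmem' : (starRingEnd ℂ) ρ ∈ Metric.ball c0 (1/2/3) := by
      rw [Metric.mem_ball, dist_comm, dist_eq_norm, hd']
      refine (norm_add_le _ _).trans_lt ?_
      rw [Complex.norm_real, Real.norm_of_nonneg (by linarith), norm_mul, Complex.norm_I, Complex.norm_real, Real.norm_eq_abs]
      linarith
    have hne : (starRingEnd ℂ) ρ ≠ ρ := by
      intro h
      exact him (Complex.conj_eq_iff_im.1 h)
    have l1 := landau_two (c := c0) (R := 1/2) (L := 36*ℓ) (by norm_num) hL (hdiff _ (by linarith)) (GG_ne hχ (by linarith))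
      (GG_growth hχ hM hη (by linarith) (by linarith) (by rw [i0, abs_zero]; linarith)) (hzr _ (by linarith)) hmem h0 hmem'
      (by rw [GG_conj hχ2, h0, map_zero]) hne
    set a := 1 + 40*η - β with ha
    have e1 : (1/(c0-ρ)).re = a/(a^2+t^2) := by
      rw [hd, one_div, Complex.inv_re]; simp [Complex.normSq_apply, pow_two]
    have e2 : (1/(c0-(starRingEnd ℂ) ρ)).re = a/(a^2+t^2) := by
      rw [hd', one_div, Complex.inv_re]; simp [Complex.normSq_apply, pow_two]
    rw [e1, e2] at l1
    have ha1 : 40*η ≤ a := by linarith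
    have ha2 : a ≤ 40.25*η := by linarith
    have b1 : 40/1721 * (1/η) ≤ a/(a^2+t^2) := by
      rw [le_div_iff₀ (by positivity)]
      have h1 : t^2 ≤ 100*η^2 := by rw [← sq_abs t]; nlinarith [abs_nonneg t]
      have h2 : a^2 ≤ 40.25^2*η^2 := by nlinarith
      have e : 40/1721 * (1/η) * (a^2+t^2) = 40*(a^2+t^2)/(1721*η) := by field_simp
      rw [e, div_le_iff₀ (by positivity)]; nlinarith
    have b2 : 1/(40*η) = 1/40*(1/η) := by field_simp
    rw [b2] at hone
    rw [hinv] at hone b1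
    linarith

end

lemma zfr_real (ε : ℝ) (hε : 0 < ε) : ∃ c : ℝ, 0 < c ∧ c ≤ 1 ∧ ∀ (q : ℕ) [NeZero q] (χ : DirichletCharacter ℂ q), χ ≠ 1 → χ^2 = 1 →
    ∀ β : ℝ, GG χ β = 0 → c * (q:ℝ)^(-(1/2+ε)) ≤ 1 - β := by
  obtain ⟨cL, hcL, hlow⟩ := L1_lower (ε/2) (by linarith)
  set θ := min (ε/2) 1 with hθ
  have hθ0 : 0 < θ := lt_min (by linarith) one_pos
  have hθ1 : θ ≤ 1 := min_le_right _ _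
  have hθε : θ ≤ ε/2 := min_le_left _ _
  have hf0 : ∀ᶠ z in 𝓝 (1:ℂ), f0 z ≠ 0 := by
    have h1 : f0 1 = 1 := by simp [f0]
    have hc : ContinuousAt f0 1 := (f0_diff (by simp)).continuousAt
    exact hc.eventually_ne (by rw [h1]; exact one_ne_zero)
  obtain ⟨r, hr, hball⟩ := Metric.eventually_nhds_iff.1 hf0
  refine ⟨min (min r (θ/4)) (min 1 (cL * θ^2/16)), by positivity, (min_le_right _ _).trans (min_le_left _ _), fun q _ χ hχ hχ2 β hβ => ?_⟩
  set c := min (min r (θ/4)) (min 1 (cL * θ^2/16)) with hc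
  have hc0 : 0 < c := by positivity
  have hq1 : (1:ℝ) ≤ q := by exact_mod_cast Nat.one_le_iff_ne_zero.2 (NeZero.ne q)
  have hq0 : (0:ℝ) < q := by linarith
  have hqp : (q:ℝ)^(-(1/2+ε)) ≤ 1 := Real.rpow_le_one_of_one_le_of_nonpos hq1 (by linarith)
  have hqp0 : 0 < (q:ℝ)^(-(1/2+ε)) := by positivity
  by_contra! hcon
  have hlt : 1 - β < c := hcon.trans_le (mul_le_of_le_one_right hc0.le hqp)
  have hβ1 : β ≤ 1 := by
    by_contra! h
    exact GG_ne hχ (s := (β:ℂ)) (by simpa using h) hβ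
  have hnorm : ‖(β:ℂ) - 1‖ = 1 - β := by
    rw [← Complex.ofReal_one, ← Complex.ofReal_sub, Complex.norm_real, Real.norm_eq_abs, abs_sub_comm, abs_of_nonneg (by linarith)]
  have hcr : c ≤ r := (min_le_left _ _).trans (min_le_left _ _)
  have hcθ : c ≤ θ/4 := (min_le_left _ _).trans (min_le_right _ _)
  have hcc : c ≤ cL * θ^2/16 := (min_le_right _ _).trans (min_le_right _ _)
  have hf1 : LP (chS χ) β = 0 := by
    refine (mul_eq_zero.1 hβ).resolve_left (hball ?_)
    rw [dist_eq_norm, hnorm]; linarith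
  have hbd : ∀ z : ℂ, ‖z - 1‖ ≤ θ/2 → ‖LP (chS χ) z‖ ≤ 4/θ * (q:ℝ)^θ := by
    intro z hz
    have hre := (abs_le.1 ((Complex.abs_re_le_norm (z-1)).trans hz)).1
    simp at hre
    have hzn : ‖z‖ ≤ 2 := by
      have : ‖z‖ ≤ ‖z - 1‖ + ‖(1:ℂ)‖ := by simpa using norm_add_le (z-1) 1
      rw [norm_one] at this; linarith
    have := LP_bound (κ := 1-θ) (B := (q:ℝ)^θ) (s := z) (P := chS χ) chS_good.meas (fun u hu => chS_norm' hχ hθ0.le hθ1 u hu) (by linarith)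
    refine this.trans ?_
    rw [div_le_iff₀ (by linarith)]
    calc (q:ℝ)^θ * ‖z‖ ≤ (q:ℝ)^θ * 2 := by gcongr
      _ = 4/θ * (q:ℝ)^θ * (θ/2) := by field_simp; norm_num
      _ ≤ _ := by gcongr; linarith
  have hre : ∀ z : ℂ, ‖z - 1‖ ≤ θ/2 → 0 < z.re := by
    intro z hz
    have hre := (abs_le.1 ((Complex.abs_re_le_norm (z-1)).trans hz)).1
    simp at hre
    linarith
  have hder : ∀ z ∈ Metric.closedBall (1:ℂ) (θ/4), ‖deriv (LP (chS χ)) z‖ ≤ 16/θ^2 * (q:ℝ)^θ := by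
    intro z hz
    have hz' : ‖z - 1‖ ≤ θ/4 := by simpa [dist_eq_norm] using hz
    have hin : ∀ w ∈ Metric.closedBall z (θ/4), ‖w - 1‖ ≤ θ/2 := by
      intro w hw
      have hw' : ‖w - z‖ ≤ θ/4 := by simpa [dist_eq_norm] using hw
      have : ‖w - 1‖ ≤ ‖w - z‖ + ‖z - 1‖ := by simpa using norm_add_le (w-z) (z-1)
      linarith
    have := Complex.norm_deriv_le_of_forall_mem_sphere_norm_le (c := z) (R := θ/4) (f := LP (chS χ)) (C := 4/θ * (q:ℝ)^θ) (by linarith) ?_ ?_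
    · refine this.trans (le_of_eq ?_)
      field_simp; norm_num
    · refine DifferentiableOn.diffContOnCl fun w hw => ?_
      rw [closure_ball _ (by linarith)] at hw
      exact (f1_diff (hre w (hin w hw))).differentiableWithinAt
    · intro w hw
      exact hbd w (hin w (Metric.sphere_subset_closedBall hw))
  have hmv := Convex.norm_image_sub_le_of_norm_deriv_le (𝕜 := ℂ) (s := Metric.closedBall (1:ℂ) (θ/4)) (f := LP (chS χ)) (C := 16/θ^2 * (q:ℝ)^θ) (x := (β:ℂ)) (y := 1)
    (fun z hz => f1_diff (hre z (by have : ‖z - 1‖ ≤ θ/4 := by simpa [dist_eq_norm] using hz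
                                    linarith))) hder (convex_closedBall _ _)
    (by rw [Metric.mem_closedBall, dist_eq_norm, hnorm]; linarith) (by simp; positivity)
  rw [hf1, sub_zero, norm_sub_rev, hnorm] at hmv
  have h1 := (hlow q χ hχ hχ2).trans hmv
  have hqθ : (q:ℝ)^θ ≤ (q:ℝ)^(ε/2) := Real.rpow_le_rpow_of_exponent_le hq1 hθε
  have h2 : cL * (q:ℝ)^(-(1/2+ε/2)) < 16/θ^2 * (q:ℝ)^(ε/2) * (c * (q:ℝ)^(-(1/2+ε))) := by
    refine h1.trans_lt ?_
    calc _ ≤ 16/θ^2 * (q:ℝ)^(ε/2) * (1-β) := by gcongr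
      _ < _ := by gcongr
  have h3 : (q:ℝ)^(ε/2) * (q:ℝ)^(-(1/2+ε)) = (q:ℝ)^(-(1/2+ε/2)) := by
    rw [← Real.rpow_add hq0]; congr 1; ring
  have h4 : 16/θ^2 * (q:ℝ)^(ε/2) * (c * (q:ℝ)^(-(1/2+ε))) ≤ cL * (q:ℝ)^(-(1/2+ε/2)) := by
    calc _ = 16/θ^2 * c * ((q:ℝ)^(ε/2) * (q:ℝ)^(-(1/2+ε))) := by ring
      _ ≤ 16/θ^2 * (cL * θ^2/16) * ((q:ℝ)^(ε/2) * (q:ℝ)^(-(1/2+ε))) := by gcongr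
      _ = _ := by rw [h3]; field_simp
  linarith

theorem zfr (ε : ℝ) (hε : 0 < ε) : ∃ c : ℝ, 0 < c ∧ c ≤ 1 ∧ ∀ (q : ℕ) [NeZero q] (χ : DirichletCharacter ℂ q), χ ≠ 1 → χ^2 = 1 →
    ∀ ρ : ℂ, GG χ ρ = 0 → (ρ.im ≠ 0 → c / Real.log (q*(|ρ.im|+4)) ≤ 1 - ρ.re) ∧ (|ρ.im| ≤ 2 → c * (q:ℝ)^(-(1/2+ε)) ≤ 1 - ρ.re) := by
  obtain ⟨c1, hc1, hc11, h1⟩ := zfr_real ε hε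
  refine ⟨c1 * (1/2400000), by positivity, by linarith, fun q _ χ hχ hχ2 ρ hρ => ?_⟩
  have hq1 : (1:ℝ) ≤ q := by exact_mod_cast Nat.one_le_iff_ne_zero.2 (NeZero.ne q)
  have hq0 : (0:ℝ) < q := by linarith
  have hlog : 0 < Real.log (q*(|ρ.im|+4)) := Real.log_pos (by nlinarith [abs_nonneg ρ.im])
  constructor
  · intro him
    refine le_trans ?_ (zfr_complex hχ hχ2 hρ him)
    gcongr
    linarith
  · intro h2
    by_cases him : ρ.im = 0
    · have e : ρ = (ρ.re : ℂ) := by apply Complex.ext <;> simp [him]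
      rw [e] at hρ
      refine le_trans ?_ (h1 q χ hχ hχ2 ρ.re hρ)
      gcongr
      linarith
    · refine le_trans ?_ (zfr_complex hχ hχ2 hρ him)
      rw [le_div_iff₀ hlog]
      have e1 : Real.log (q*(|ρ.im|+4)) ≤ 6 * (q:ℝ)^(1/2:ℝ) := by
        rw [← Real.sqrt_eq_rpow]
        have a1 : q*(|ρ.im|+4) ≤ (3 * √(q:ℝ))^2 := by
          rw [mul_pow, Real.sq_sqrt hq0.le]; nlinarith
        calc Real.log (q*(|ρ.im|+4)) ≤ Real.log ((3 * √(q:ℝ))^2) := Real.log_le_log (by positivity) a1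
          _ = 2 * Real.log (3 * √(q:ℝ)) := by rw [Real.log_pow]; norm_num
          _ ≤ 2 * (3 * √(q:ℝ)) := by
            gcongr
            exact (Real.log_le_sub_one_of_pos (by positivity)).trans (by linarith)
          _ = _ := by ring
      have e2 : (q:ℝ)^(-(1/2+ε)) * (q:ℝ)^(1/2:ℝ) ≤ 1 := by
        rw [← Real.rpow_add hq0]
        exact Real.rpow_le_one_of_one_le_of_nonpos hq1 (by linarith)
      calc _ ≤ c1 * (1/2400000) * (q:ℝ)^(-(1/2+ε)) * (6 * (q:ℝ)^(1/2:ℝ)) := by gcongr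
        _ = c1 * (1/400000) * ((q:ℝ)^(-(1/2+ε)) * (q:ℝ)^(1/2:ℝ)) := by ring
        _ ≤ c1 * (1/400000) * 1 := by gcongr
        _ ≤ _ := by linarith

end

section
open MeasureTheory Set Filter Topology

lemma log_pow_le {Y : ℝ} (hY : 1 ≤ Y) (m : ℕ) : (Real.log Y)^m ≤ m.factorial * 4^m * Y^(1/4:ℝ) := by
  have h0 : 0 ≤ Real.log Y / 4 := by have := Real.log_nonneg hY; positivity
  have h := Real.pow_div_factorial_le_exp (Real.log Y / 4) h0 m
  have e : Real.exp (Real.log Y / 4) = Y^(1/4:ℝ) := by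
    rw [Real.rpow_def_of_pos (by linarith)]; congr 1; ring
  rw [e, div_pow, div_div, div_le_iff₀ (by positivity)] at h
  linarith

section
variable {q : ℕ} [NeZero q]

noncomputable def Phi (χ : DirichletCharacter ℂ q) (s : ℂ) : ℂ := deriv (LP (chS χ)) s / LP (chS χ) s - deriv f0 s / f0 s

variable {χ : DirichletCharacter ℂ q}

lemma Phi_ball (hχ : χ ≠ 1) {η t R Y : ℝ} (hη : 0 < η) (hη1 : η ≤ 1) (hR : 0 < R) (hR1 : R ≤ 1/2)
    (hY : Y = q*(|t|+5)/η)
    (hz : ∀ z ∈ Metric.ball (((1+η:ℝ):ℂ) + t * Complex.I) R, GG χ z ≠ 0) (k : ℕ) :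
    ‖iteratedDeriv k (Phi χ) (((1+η:ℝ):ℂ) + t * Complex.I)‖ ≤ (k+1).factorial * (64 * Y^(1/4:ℝ)) * (2/R)^(k+1) := by
  have hq1 : (1:ℝ) ≤ q := by exact_mod_cast Nat.one_le_iff_ne_zero.2 (NeZero.ne q)
  set c : ℂ := ((1+η:ℝ):ℂ) + t * Complex.I with hc
  have hcre : c.re = 1 + η := by simp [hc]
  have hcim : c.im = t := by simp [hc]
  have hY5 : (|t|+5)/η ≤ Y := by
    rw [hY, mul_div_assoc]
    exact le_mul_of_one_le_left (by positivity) hq1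
  have hY1 : 5 ≤ Y := by
    refine le_trans ?_ hY5
    rw [le_div_iff₀ hη]; nlinarith [abs_nonneg t]
  set L := Real.log (9*Y^2) with hL
  have hL0 : 0 < L := Real.log_pos (by nlinarith)
  have hexp : Real.exp L = 9*Y^2 := Real.exp_log (by positivity)
  have hL16 : L ≤ 16 * Y^(1/4:ℝ) := by
    have h1 := log_pow_le (Y := 3*Y) (by linarith) 1
    have h2 : L = 2 * Real.log (3*Y) := by
      rw [hL, show 9*Y^2 = (3*Y)^2 by ring, Real.log_pow]; norm_num
    have h3 : (3*Y)^(1/4:ℝ) ≤ 2 * Y^(1/4:ℝ) := by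
      rw [Real.mul_rpow (by norm_num) (by linarith)]
      gcongr
      calc (3:ℝ)^(1/4:ℝ) ≤ (16:ℝ)^(1/4:ℝ) := by gcongr; norm_num
        _ = ((2:ℝ)^(4:ℝ))^(1/4:ℝ) := by norm_num
        _ = 2 := by rw [← Real.rpow_mul (by norm_num)]; norm_num
    simp at h1
    linarith
  have hin : ∀ z ∈ Metric.ball c R, 1/2 ≤ z.re ∧ ‖z‖ + 1 ≤ |t| + 5 := by
    intro z hz
    have hzc : ‖z - c‖ < R := by simpa [dist_eq_norm] using hz
    constructor
    · have := (abs_le.1 ((Complex.abs_re_le_norm (z-c)).trans hzc.le)).1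
      simp at this; linarith
    · have : ‖z‖ ≤ ‖z - c‖ + ‖c‖ := by simpa using norm_add_le (z-c) c
      have h2 := Complex.norm_le_abs_re_add_abs_im c
      rw [hcre, hcim, abs_of_pos (by linarith)] at h2
      linarith
  have hd0 : DifferentiableOn ℂ f0 (Metric.ball c R) := fun z hz => (f0_diff (by linarith [(hin z hz).1])).differentiableWithinAt
  have hd1 : DifferentiableOn ℂ (LP (chS χ)) (Metric.ball c R) := fun z hz => (f1_diff (by linarith [(hin z hz).1])).differentiableWithinAt
  have hn0 : ∀ z ∈ Metric.ball c R, f0 z ≠ 0 := fun z hzz => left_ne_zero_of_mul (hz z hzz)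
  have hn1 : ∀ z ∈ Metric.ball c R, LP (chS χ) z ≠ 0 := fun z hzz => right_ne_zero_of_mul (hz z hzz)
  have b0 := log_deriv_bound hR hL0 hd0 hn0 (fun z hzz => by
    have h1 := f0_bound (hin z hzz).1
    have h2 := f0_lower (s := c) (by linarith) (by linarith)
    rw [hcre] at h2
    rw [hexp]
    calc ‖f0 z‖ ≤ 3 * (|t|+5)^2 := h1.trans (by have := (hin z hzz).2; exact mul_le_mul_of_nonneg_left (pow_le_pow_left₀ (by positivity) this 2) (by norm_num))
      _ = (1+η-1)^2/3 * (9*((|t|+5)/η)^2) := by field_simp; ring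
      _ ≤ _ := by gcongr) k
  have b1 := log_deriv_bound hR hL0 hd1 hn1 (fun z hzz => by
    have h1 := f1_bound (χ := χ) (hin z hzz).1
    have h2 := f1_lower hχ (s := c) (by linarith) (by linarith)
    rw [hcre] at h2
    rw [hexp]
    calc ‖LP (chS χ) z‖ ≤ 2 * q * (|t|+5) := h1.trans (by gcongr; linarith [(hin z hzz).2])
      _ = (1+η-1)/3 * (6 * Y) := by rw [hY]; field_simp; ring
      _ ≤ (1+η-1)/3 * (9 * Y^2) := by
        have : 6 * Y ≤ 9 * Y^2 := by nlinarith
        have h3 : 0 ≤ (1+η-1)/3 := by linarith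
        gcongr
      _ ≤ _ := by gcongr) k
  have hcb : c ∈ Metric.ball c R := Metric.mem_ball_self hR
  have ha : ∀ f : ℂ → ℂ, DifferentiableOn ℂ f (Metric.ball c R) → (∀ z ∈ Metric.ball c R, f z ≠ 0) → ContDiffAt ℂ k (fun z => deriv f z / f z) c := by
    intro f hf hf0
    have h1 : AnalyticAt ℂ f c := hf.analyticAt (Metric.isOpen_ball.mem_nhds hcb)
    exact (h1.deriv.div h1 (hf0 c hcb)).contDiffAt
  have he : Phi χ = (fun z => deriv (LP (chS χ)) z / LP (chS χ) z) - (fun z => deriv f0 z / f0 z) := rfl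
  rw [he, iteratedDeriv_sub (ha _ hd1 hn1) (ha _ hd0 hn0)]
  refine (norm_sub_le _ _).trans ((add_le_add b1 b0).trans ?_)
  calc _ = ((k+1).factorial:ℝ) * (4*L) * (2/R)^(k+1) := by ring
    _ ≤ ((k+1).factorial:ℝ) * (4*(16*Y^(1/4:ℝ))) * (2/R)^(k+1) := by gcongr
    _ = _ := by ring

end

theorem Phi_bound (ε : ℝ) (hε : 0 < ε) : ∃ C : ℝ, 1 ≤ C ∧ ∀ (q : ℕ) [NeZero q] (χ : DirichletCharacter ℂ q), χ ≠ 1 → χ^2 = 1 →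
    ∀ η t : ℝ, 0 < η → η ≤ 1 → ∀ k : ℕ, ‖iteratedDeriv k (Phi χ) (((1+η:ℝ):ℂ) + t * Complex.I)‖ ≤
      (k+1).factorial * ((k+1).factorial + ((q:ℝ)^(1/2+ε))^(k+1)) * C^(k+1) * √(q*(|t|+5)/η) := by
  obtain ⟨c, hc, hc1, hz⟩ := zfr ε hε
  refine ⟨64*(16/c), ?_, fun q _ χ hχ hχ2 η t hη hη1 k => ?_⟩
  · rw [← mul_div_assoc, le_div_iff₀ hc]; linarith
  have hq1 : (1:ℝ) ≤ q := by exact_mod_cast Nat.one_le_iff_ne_zero.2 (NeZero.ne q)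
  have hq0 : (0:ℝ) < q := by linarith
  set Y := q*(|t|+5)/η with hY
  have hX5 : 5 ≤ q*(|t|+5) := by nlinarith [abs_nonneg t]
  have hXY : q*(|t|+5) ≤ Y := by rw [hY, le_div_iff₀ hη]; nlinarith
  have hY0 : 0 < Y := by linarith
  have hsq : Y^(1/4:ℝ) * Y^(1/4:ℝ) = √Y := by
    rw [← Real.rpow_add hY0, Real.sqrt_eq_rpow]; norm_num
  have hY41 : 1 ≤ Y^(1/4:ℝ) := Real.one_le_rpow (by linarith) (by norm_num)
  have h64 : (64:ℝ) ≤ 64^(k+1) := by simpa using pow_le_pow_right₀ (by norm_num : (1:ℝ) ≤ 64) (Nat.succ_le_succ (Nat.zero_le k))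
  set Q := (q:ℝ)^(1/2+ε) with hQ
  have hQ1 : 1 ≤ Q := Real.one_le_rpow hq1 (by linarith)
  set c0 : ℂ := ((1+η:ℝ):ℂ) + t * Complex.I with hc0
  have hre : c0.re = 1 + η := by simp [hc0]
  have him : c0.im = t := by simp [hc0]
  rcases le_or_gt 1 |t| with ht | ht
  · set ℓ := Real.log (q*(|t|+5)) with hℓ
    have hl1 : 1 ≤ ℓ := by
      rw [hℓ, Real.le_log_iff_exp_le (by linarith)]
      linarith [Real.exp_one_lt_d9]
    have hcl : c/2/ℓ ≤ 1/2 := (div_le_self (by linarith) hl1).trans (by linarith)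
    have h := Phi_ball hχ hη hη1 (R := c/2/ℓ) (by positivity) hcl hY (fun z hzz h0 => ?_) k
    · refine h.trans ?_
      have e1 := log_pow_le (Y := q*(|t|+5)) (by linarith) (k+1)
      have e2 : ℓ^(k+1) ≤ (k+1).factorial * 4^(k+1) * Y^(1/4:ℝ) := e1.trans (by gcongr)
      calc ((k+1).factorial:ℝ) * (64 * Y^(1/4:ℝ)) * (2/(c/2/ℓ))^(k+1)
          = (k+1).factorial * 64 * Y^(1/4:ℝ) * (4/c)^(k+1) * ℓ^(k+1) := by
            rw [show 2/(c/2/ℓ) = 4/c*ℓ by field_simp; norm_num, mul_pow]; ring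
        _ ≤ (k+1).factorial * 64^(k+1) * Y^(1/4:ℝ) * (4/c)^(k+1) * ((k+1).factorial * 4^(k+1) * Y^(1/4:ℝ)) := by gcongr
        _ = (k+1).factorial * (k+1).factorial * (64*(16/c))^(k+1) * (Y^(1/4:ℝ) * Y^(1/4:ℝ)) := by
          rw [show 64*(16/c) = 64 * (4/c) * 4 by ring, mul_pow, mul_pow]; ring
        _ ≤ _ := by
          rw [hsq]
          gcongr
          have : 0 ≤ Q^(k+1) := by positivity
          linarith
    · have hzc : ‖z - c0‖ < c/2/ℓ := by rwa [Metric.mem_ball, dist_eq_norm] at hzz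
      have a1 := (abs_lt.1 ((Complex.abs_re_le_norm (z-c0)).trans_lt hzc)).1
      have a2 := (Complex.abs_im_le_norm (z-c0)).trans_lt hzc
      simp [hre] at a1
      rw [Complex.sub_im, him] at a2
      have a3 : |t| - 1/2 < |z.im| := by
        have := abs_sub_abs_le_abs_sub t z.im
        rw [abs_sub_comm] at this; linarith
      have a4 : |z.im| < |t| + 1/2 := by
        have := abs_sub_abs_le_abs_sub z.im t
        linarith
      have a5 : z.im ≠ 0 := by intro h; rw [h, abs_zero] at a3; linarith
      have a6 := (hz q χ hχ hχ2 z h0).1 a5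
      have a7 : c/ℓ ≤ c / Real.log (q*(|z.im|+4)) := by
        have : 1 < q*(|z.im|+4) := by nlinarith [abs_nonneg z.im]
        have hh := Real.log_pos this
        refine div_le_div_of_nonneg_left hc.le hh (Real.log_le_log (by linarith) ?_)
        exact mul_le_mul_of_nonneg_left (by linarith) hq0.le
      have a8 : c/2/ℓ ≤ c/ℓ := by gcongr; linarith
      linarith
  · have hq' : (q:ℝ)^(-(1/2+ε)) = 1/Q := by rw [hQ, Real.rpow_neg hq0.le]; exact (one_div _).symm
    have hcq : c/2/Q ≤ 1/2 := (div_le_self (by linarith) hQ1).trans (by linarith)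
    have h := Phi_ball hχ hη hη1 (R := c/2/Q) (by positivity) hcq hY (fun z hzz h0 => ?_) k
    · refine h.trans ?_
      calc ((k+1).factorial:ℝ) * (64 * Y^(1/4:ℝ)) * (2/(c/2/Q))^(k+1)
          = (k+1).factorial * Q^(k+1) * (64 * (4/c)^(k+1)) * (Y^(1/4:ℝ)*1) := by
            rw [show 2/(c/2/Q) = 4/c*Q by field_simp; norm_num, mul_pow]; ring
        _ ≤ (k+1).factorial * Q^(k+1) * (64^(k+1) * (16/c)^(k+1)) * (Y^(1/4:ℝ) * Y^(1/4:ℝ)) := by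
          gcongr
          norm_num
        _ ≤ _ := by
          rw [hsq, ← mul_pow]
          gcongr
          have : (0:ℝ) ≤ (k+1).factorial := by positivity
          linarith
    · have hzc : ‖z - c0‖ < c/2/Q := by rwa [Metric.mem_ball, dist_eq_norm] at hzz
      have a1 := (abs_lt.1 ((Complex.abs_re_le_norm (z-c0)).trans_lt hzc)).1
      have a2 := (Complex.abs_im_le_norm (z-c0)).trans_lt hzc
      simp [hre] at a1
      rw [Complex.sub_im, him] at a2
      have a4 : |z.im| < |t| + 1/2 := by
        have := abs_sub_abs_le_abs_sub z.im t
        linarith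
      have a6 := (hz q χ hχ hχ2 z h0).2 (by linarith)
      rw [hq', mul_one_div] at a6
      have a8 : c/2/Q ≤ c/Q := by gcongr; linarith
      linarith

end

section
open MeasureTheory Set Filter Topology

lemma s_norm {σ : ℝ} (hσ : 1 ≤ σ) (t : ℝ) : 1 + t^2 ≤ ‖(σ + t * Complex.I : ℂ)‖ * ‖(σ + t * Complex.I + 1 : ℂ)‖ := by
  have h : ∀ a : ℝ, 1 ≤ a → √(1+t^2) ≤ ‖(a + t * Complex.I : ℂ)‖ := by
    intro a ha
    rw [Complex.norm_add_mul_I]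
    apply Real.sqrt_le_sqrt; nlinarith
  have h1 := h σ hσ
  have h2 := h (σ+1) (by linarith)
  have e : ((σ+1:ℝ):ℂ) + t * Complex.I = σ + t * Complex.I + 1 := by push_cast; ring
  rw [e] at h2
  calc 1 + t^2 = √(1+t^2) * √(1+t^2) := (Real.mul_self_sqrt (by positivity)).symm
    _ ≤ _ := by gcongr

lemma ker_int {σ : ℝ} (hσ : 1 ≤ σ) : Integrable (fun t : ℝ => 1 / ((σ + t * Complex.I : ℂ) * (σ + t * Complex.I + 1))) := by
  have hne : ∀ a : ℝ, 1 ≤ a → ∀ t : ℝ, (a + t * Complex.I : ℂ) ≠ 0 := by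
    intro a ha t h
    have := congrArg Complex.re h; simp at this; linarith
  refine (integrable_inv_one_add_sq).mono' (Continuous.aestronglyMeasurable ?_) ?_
  · refine continuous_const.div (by fun_prop) fun t => ?_
    refine mul_ne_zero (hne σ hσ t) ?_
    have := hne (σ+1) (by linarith) t
    convert this using 1
    push_cast; ring
  · filter_upwards with t
    rw [norm_div, norm_one, norm_mul, ← one_div]
    have := s_norm hσ t
    gcongr

lemma perron1 {σ : ℝ} (hσ : 1 ≤ σ) {y : ℝ} (hy : 0 < y) :
    ∫ t : ℝ, (y:ℂ)^(-(σ + t * Complex.I : ℂ)) * (1 / ((σ + t * Complex.I : ℂ) * (σ + t * Complex.I + 1))) = 2 * Real.pi * ((max (1-y) 0 : ℝ):ℂ) := by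
  set f : ℝ → ℂ := fun u => (indicator (Ioc 0 1) (fun _ => (1:ℂ))) u - (indicator (Ioc 0 1) (fun t : ℝ => (t:ℂ)^(1:ℂ))) u with hf
  have hm : ∀ s : ℂ, 0 < s.re → HasMellin f s (1/(s*(s+1))) := by
    intro s hs
    have h1 := hasMellin_one_Ioc hs
    have h2 := hasMellin_cpow_Ioc 1 (s := s) (by simp; linarith)
    have h3 := hasMellin_sub h1.1 h2.1
    rw [h1.2, h2.2] at h3
    refine ⟨h3.1, h3.2.trans ?_⟩
    have : s ≠ 0 := by intro h; simp [h] at hs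
    have : s + 1 ≠ 0 := by intro h; have := congrArg Complex.re h; simp at this; linarith
    field_simp; ring
  have hfe : ∀ u : ℝ, 0 < u → f u = ((max (1-u) 0 : ℝ):ℂ) := by
    intro u hu
    simp only [hf, indicator]
    split_ifs with h
    · rw [max_eq_left (by linarith [h.2]), Complex.cpow_one]; push_cast; ring
    · have : 1 < u := by by_contra! h'; exact h ⟨hu, h'⟩
      rw [max_eq_right (by linarith)]; simp
  have hcont : ContinuousAt f y := by
    have h1 : ContinuousAt (fun u : ℝ => ((max (1-u) 0 : ℝ):ℂ)) y := by fun_prop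
    refine h1.congr ?_
    filter_upwards [Ioi_mem_nhds hy] with u hu using (hfe u hu).symm
  have hre : ∀ t : ℝ, 0 < (σ + t * Complex.I : ℂ).re := fun t => by simp; linarith
  have hmt : ∀ t : ℝ, mellin f (σ + t * Complex.I) = 1 / ((σ + t * Complex.I : ℂ) * (σ + t * Complex.I + 1)) := fun t => (hm _ (hre t)).2
  have hv : Complex.VerticalIntegrable (mellin f) σ := by
    unfold Complex.VerticalIntegrable
    simp only [hmt]
    exact ker_int hσ
  have h := mellinInv_mellin_eq σ f hy (hm σ (by simp; linarith)).1 hv hcont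
  rw [mellinInv, hfe y hy] at h
  simp only [hmt, smul_eq_mul] at h
  rw [← h, Complex.real_smul, ← mul_assoc]
  have : (Real.pi:ℂ) ≠ 0 := by exact_mod_cast Real.pi_ne_zero
  have e : (2 * Real.pi : ℂ) * ((1 / (2 * Real.pi) : ℝ):ℂ) = 1 := by
    push_cast; field_simp
  rw [e, one_mul]

lemma perron_gen {α : Type*} [MeasurableSpace α] {μ : Measure α} [SFinite μ] {u g : α → ℝ} (hu : Measurable u) (hg : Measurable g)
    (hpos : ∀ a, 0 < u a ∨ g a = 0) {σ x : ℝ} (hσ : 1 ≤ σ) (hx : 0 < x) (hint : Integrable (fun a => g a * u a ^ (-σ)) μ) :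
    Integrable (fun t : ℝ => (∫ a, (g a:ℂ) * (u a : ℂ)^(-(σ + t * Complex.I : ℂ)) ∂μ) * ((x:ℂ)^(σ + t * Complex.I : ℂ) * (1 / ((σ + t * Complex.I : ℂ) * (σ + t * Complex.I + 1))))) ∧
    ∫ t : ℝ, (∫ a, (g a:ℂ) * (u a : ℂ)^(-(σ + t * Complex.I : ℂ)) ∂μ) * ((x:ℂ)^(σ + t * Complex.I : ℂ) * (1 / ((σ + t * Complex.I : ℂ) * (σ + t * Complex.I + 1))))
      = 2 * Real.pi * ((∫ a, g a * max (1 - u a / x) 0 ∂μ : ℝ) : ℂ) := by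
  set K : ℝ → ℂ := fun t => (x:ℂ)^(σ + t * Complex.I : ℂ) * (1 / ((σ + t * Complex.I : ℂ) * (σ + t * Complex.I + 1))) with hK
  have hKm : Measurable K := by rw [hK]; fun_prop
  have hKint : Integrable K := by
    refine ((ker_int hσ).norm.const_mul (x^σ)).mono' hKm.aestronglyMeasurable ?_
    filter_upwards with t
    rw [hK, norm_mul, Complex.norm_cpow_eq_rpow_re_of_pos hx]
    simp
  have hsw : Integrable (Function.uncurry fun (t : ℝ) (a : α) => (g a:ℂ) * (u a : ℂ)^(-(σ + t * Complex.I : ℂ)) * K t) (volume.prod μ) := by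
    refine (hKint.norm.mul_prod hint.norm).mono' (Measurable.aestronglyMeasurable ?_) ?_
    · unfold Function.uncurry
      fun_prop
    · filter_upwards with ⟨t, a⟩
      simp only [Function.uncurry]
      rcases hpos a with h | h
      · rw [norm_mul, norm_mul, Complex.norm_cpow_eq_rpow_re_of_pos h, norm_mul, Complex.norm_real]
        simp only [Complex.neg_re, Complex.add_re, Complex.ofReal_re, Complex.mul_re, Complex.I_re, mul_zero, Complex.ofReal_im, Complex.I_im, mul_one, sub_self, add_zero]
        rw [norm_mul (g a), Real.norm_of_nonneg (r := u a ^ (-σ)) (by positivity)]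
        exact le_of_eq (by ring)
      · simp [h]
  refine ⟨?_, ?_⟩
  · have := hsw.integral_prod_left
    simp only [Function.uncurry, integral_mul_const] at this
    exact this
  calc _ = ∫ t : ℝ, ∫ a, (g a:ℂ) * (u a : ℂ)^(-(σ + t * Complex.I : ℂ)) * K t ∂μ := by
        congr 1; ext t; rw [← integral_mul_const]
    _ = ∫ a, (∫ t : ℝ, (g a:ℂ) * (u a : ℂ)^(-(σ + t * Complex.I : ℂ)) * K t) ∂μ := integral_integral_swap hsw
    _ = ∫ a, 2 * Real.pi * ((g a * max (1 - u a / x) 0 : ℝ):ℂ) ∂μ := by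
        refine integral_congr_ae (ae_of_all _ fun a => ?_)
        beta_reduce
        rcases hpos a with h | h
        · have h1 := perron1 hσ (y := u a / x) (by positivity)
          rw [Complex.ofReal_mul, mul_left_comm, ← h1, ← integral_const_mul]
          congr 1; ext t
          have e : ((u a / x : ℝ):ℂ)^(-(σ + t * Complex.I : ℂ)) = (u a : ℂ)^(-(σ + t * Complex.I : ℂ)) * (x:ℂ)^(σ + t * Complex.I : ℂ) := by
            rw [div_eq_mul_inv, Complex.ofReal_mul, Complex.mul_cpow_ofReal_nonneg h.le (by positivity)]
            congr 1
            rw [Complex.ofReal_inv, Complex.inv_cpow _ _ (by rw [Complex.arg_ofReal_of_nonneg hx.le]; exact Real.pi_pos.ne), Complex.cpow_neg, inv_inv]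
          rw [e, hK]; ring
        · simp [h]
    _ = _ := by rw [integral_const_mul]; congr 1; exact integral_ofReal

end

section
open MeasureTheory Set Filter Topology

lemma pow_exp_int (k : ℕ) {r : ℝ} (hr : 0 < r) : IntegrableOn (fun v : ℝ => v^k * Real.exp (-r*v)) (Ioi 0) := by
  have h := integrableOn_rpow_mul_exp_neg_mul_rpow (p := 1) (s := (k:ℝ)) (b := r) (by have : (0:ℝ) ≤ k := by positivity
                                                                                      linarith) one_pos hr
  simpa using h

lemma cpow_exp_int (k : ℕ) {r : ℂ} (hr : 0 < r.re) : IntegrableOn (fun v : ℝ => (v:ℂ)^k * Complex.exp (-r*v)) (Ioi 0) := by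
  refine (pow_exp_int k hr).mono' (Continuous.aestronglyMeasurable (by fun_prop)) ?_
  filter_upwards [ae_restrict_mem measurableSet_Ioi] with v hv
  have hv' : 0 < v := hv
  rw [norm_mul, Complex.norm_exp, norm_pow, Complex.norm_real, Real.norm_of_nonneg hv'.le]
  simp

lemma gam_int (k : ℕ) {r : ℂ} (hr : 0 < r.re) : ∫ v in Ioi (0:ℝ), (v:ℂ)^k * Complex.exp (-r*v) = k.factorial / r^(k+1) := by
  have hr0 : r ≠ 0 := by intro h; simp [h] at hr
  have ht : ∀ k : ℕ, Tendsto (fun v : ℝ => (v:ℂ)^k * Complex.exp (-r*v)) atTop (𝓝 0) := by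
    intro k
    rw [tendsto_zero_iff_norm_tendsto_zero]
    have h := tendsto_rpow_mul_exp_neg_mul_atTop_nhds_zero (k:ℝ) r.re hr
    refine h.congr' ?_
    filter_upwards [eventually_gt_atTop 0] with v hv
    rw [norm_mul, Complex.norm_exp, norm_pow, Complex.norm_real, Real.norm_of_nonneg hv.le]
    simp
  induction k with
  | zero =>
    have hd : ∀ x ∈ Ici (0:ℝ), HasDerivAt (fun v : ℝ => -(1/r) * Complex.exp (-r*v)) ((x:ℂ)^0 * Complex.exp (-r*x)) x := by
      intro x _
      have h1 : HasDerivAt (fun v : ℝ => (-r * v : ℂ)) (-r) x := by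
        simpa using (Complex.ofRealCLM.hasDerivAt (x := x)).const_mul (-r)
      refine (h1.cexp.const_mul (-(1/r))).congr_deriv ?_
      field_simp; 
    have := integral_Ioi_of_hasDerivAt_of_tendsto' hd (cpow_exp_int 0 hr) (by simpa using (ht 0).const_mul (-(1/r)))
    rw [this]; simp
  | succ k ih =>
    have hd : ∀ x ∈ Ici (0:ℝ), HasDerivAt (fun v : ℝ => (v:ℂ)^(k+1) * Complex.exp (-r*v)) ((k+1) * ((x:ℂ)^k * Complex.exp (-r*x)) - r * ((x:ℂ)^(k+1) * Complex.exp (-r*x))) x := by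
      intro x _
      have h1 : HasDerivAt (fun v : ℝ => (-r * v : ℂ)) (-r) x := by
        simpa using (Complex.ofRealCLM.hasDerivAt (x := x)).const_mul (-r)
      have h2 : HasDerivAt (fun v : ℝ => (v:ℂ)^(k+1)) ((k+1) * (x:ℂ)^k) x := by
        simpa using (Complex.ofRealCLM.hasDerivAt (x := x)).fun_pow (k+1)
      refine (h2.mul h1.cexp).congr_deriv ?_
      ring
    have i1 := (cpow_exp_int k hr).const_mul ((k:ℂ)+1)
    have i2 := (cpow_exp_int (k+1) hr).const_mul r
    have := integral_Ioi_of_hasDerivAt_of_tendsto' hd (i1.sub i2) (ht (k+1))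
    rw [integral_sub i1 i2, integral_const_mul, integral_const_mul, ih] at this
    simp only [Complex.ofReal_zero, ne_eq, Nat.add_eq_zero_iff, one_ne_zero, and_false, not_false_eq_true, zero_pow, zero_mul, sub_zero] at this
    have h3 := (sub_eq_zero.1 this).symm
    rw [Nat.factorial_succ]
    field_simp at h3 ⊢
    push_cast
    linear_combination h3

noncomputable def bb {q : ℕ} (χ : DirichletCharacter ℂ q) (n : ℕ) : ℝ := ArithmeticFunction.vonMangoldt n * (1 - (χ (n:ZMod q)).re)

lemma bb_nonneg {q : ℕ} [NeZero q] (χ : DirichletCharacter ℂ q) (n : ℕ) : 0 ≤ bb χ n := by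
  refine mul_nonneg ArithmeticFunction.vonMangoldt_nonneg ?_
  have := (Complex.re_le_norm _).trans (χ.norm_le_one (n:ZMod q))
  linarith

lemma bb_eq {q : ℕ} [NeZero q] {χ : DirichletCharacter ℂ q} (hχ : χ^2 = 1) : (fun n => (bb χ n : ℂ)) = (fun n : ℕ => (ArithmeticFunction.vonMangoldt n : ℂ)) - (fun n : ℕ => χ (n:ZMod q) * (ArithmeticFunction.vonMangoldt n:ℂ)) := by
  ext n
  have h : ((χ (n:ZMod q)).re : ℂ) = χ (n:ZMod q) := by
    rcases chi_real hχ (n:ZMod q) with h | h | h <;> simp [h]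
  simp only [bb, Pi.sub_apply]
  push_cast
  rw [h]; ring

lemma bb_summ {q : ℕ} [NeZero q] {χ : DirichletCharacter ℂ q} (hχ : χ^2 = 1) {s : ℂ} (hs : 1 < s.re) : LSeriesSummable (fun n => (bb χ n : ℂ)) s := by
  rw [bb_eq hχ]
  exact (ArithmeticFunction.LSeriesSummable_vonMangoldt hs).sub (DirichletCharacter.LSeriesSummable_twist_vonMangoldt χ hs)

lemma Phi_eq {q : ℕ} [NeZero q] {χ : DirichletCharacter ℂ q} (hχ1 : χ ≠ 1) (hχ : χ^2 = 1) {s : ℂ} (hs : 1 < s.re) :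
    Phi χ s = LSeries (fun n => (bb χ n : ℂ)) s - (s-1)⁻¹ := by
  rw [bb_eq hχ]
  erw [LSeries_sub (ArithmeticFunction.LSeriesSummable_vonMangoldt hs) (DirichletCharacter.LSeriesSummable_twist_vonMangoldt χ hs)]
  have h2 := tw_eq hχ1 hs
  have h1 := Lam_eq hs
  unfold Phi
  rw [h1]
  erw [h2]
  ring

lemma bb_absc {q : ℕ} [NeZero q] {χ : DirichletCharacter ℂ q} (hχ : χ^2 = 1) {s : ℂ} (hs : 1 < s.re) : LSeries.abscissaOfAbsConv (fun n => (bb χ n : ℂ)) < s.re := by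
  refine lt_of_le_of_lt (LSeries.abscissaOfAbsConv_le_of_forall_lt_LSeriesSummable (x := 1) fun y hy => ?_) (by exact_mod_cast hs)
  exact bb_summ hχ (by simpa using hy)

lemma Phi_iter {q : ℕ} [NeZero q] {χ : DirichletCharacter ℂ q} (hχ1 : χ ≠ 1) (hχ : χ^2 = 1) {s : ℂ} (hs : 1 < s.re) (k : ℕ) :
    (-1)^k * iteratedDeriv k (Phi χ) s = LSeries (LSeries.logMul^[k] (fun n => (bb χ n : ℂ))) s - k.factorial / (s-1)^(k+1) := by
  have h1 : Phi χ =ᶠ[𝓝 s] fun z => LSeries (fun n => (bb χ n : ℂ)) z - (z-1)⁻¹ := by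
    have : {z : ℂ | 1 < z.re} ∈ 𝓝 s := (isOpen_lt continuous_const Complex.continuous_re).mem_nhds hs
    filter_upwards [this] with z hz using Phi_eq hχ1 hχ hz
  have hs1 : s - 1 ≠ 0 := by
    intro h; have := congrArg Complex.re h; simp at this; linarith
  have hs2 := bb_absc hχ hs
  rw [h1.iteratedDeriv_eq, iteratedDeriv_fun_sub, LSeries_iteratedDeriv k hs2]
  · have h := congrFun (iter_deriv_inv_linear_sub (𝕜 := ℂ) k 1 1) s
    simp only [one_mul] at h
    rw [iteratedDeriv_eq_iterate (f := fun z : ℂ => (z-1)⁻¹), h]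
    have e : ((-1:ℂ)^k) * (-1)^k = 1 := by rw [← mul_pow]; simp
    rw [mul_sub, ← mul_assoc, e, one_mul]
    congr 1
    simp only [one_pow, mul_one]
    rw [zpow_sub₀ hs1, zpow_neg]
    rw [zpow_one, zpow_natCast, ← mul_assoc, ← mul_assoc, e]
    field_simp
    ring
  · exact ((LSeries_analyticOnNhd _) s hs2).contDiffAt
  · exact (contDiffAt_id.sub contDiffAt_const).inv hs1

lemma perron_sum {q : ℕ} [NeZero q] {χ : DirichletCharacter ℂ q} (hχ : χ^2 = 1) (k : ℕ) {σ x : ℝ} (hσ : 1 < σ) (hx : 0 < x) :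
    Integrable (fun t : ℝ => LSeries (LSeries.logMul^[k] (fun n => (bb χ n : ℂ))) (σ + t * Complex.I) * ((x:ℂ)^(σ + t * Complex.I : ℂ) * (1 / ((σ + t * Complex.I : ℂ) * (σ + t * Complex.I + 1))))) ∧
    ∫ t : ℝ, LSeries (LSeries.logMul^[k] (fun n => (bb χ n : ℂ))) (σ + t * Complex.I) * ((x:ℂ)^(σ + t * Complex.I : ℂ) * (1 / ((σ + t * Complex.I : ℂ) * (σ + t * Complex.I + 1)))) = 2 * Real.pi * ((∑' n : ℕ, bb χ n * Real.log n ^ k * max (1 - n / x) 0 : ℝ) : ℂ) := by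
  have hb0 : bb χ 0 = 0 := by simp [bb]
  have hterm : ∀ (s : ℂ) (n : ℕ), LSeries.term (LSeries.logMul^[k] (fun n => (bb χ n : ℂ))) s n = ((bb χ n * Real.log n ^ k : ℝ):ℂ) * ((n:ℝ):ℂ)^(-s) := by
    intro s n
    rcases eq_or_ne n 0 with rfl | hn
    · simp [hb0]
    · rw [LSeries.term_of_ne_zero hn, logMul_iter, Complex.cpow_neg, div_eq_mul_inv]
      push_cast; ring
  have hsum : ∀ s : ℂ, 1 < s.re → LSeriesSummable (LSeries.logMul^[k] (fun n => (bb χ n : ℂ))) s := by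
    intro s hs
    refine LSeriesSummable_of_abscissaOfAbsConv_lt_re ?_
    rw [LSeries.absicssaOfAbsConv_logPowMul]
    exact bb_absc hχ hs
  have hnorm : ∀ (s : ℂ) (n : ℕ), ‖LSeries.term (LSeries.logMul^[k] (fun n => (bb χ n : ℂ))) s n‖ = bb χ n * Real.log n ^ k * (n:ℝ)^(-s.re) := by
    intro s n
    rcases eq_or_ne n 0 with rfl | hn
    · simp [hb0]
    · rw [hterm, norm_mul, Complex.norm_cpow_eq_rpow_re_of_pos (by positivity), Complex.norm_real, Complex.neg_re, Real.norm_of_nonneg]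
      have := bb_nonneg χ n
      positivity
  have hint : Integrable (fun n : ℕ => bb χ n * Real.log n ^ k * (n:ℝ)^(-σ)) Measure.count := by
    rw [integrable_count_iff]
    have := (hsum σ (by simpa)).norm
    simp only [hnorm] at this
    refine this.norm
  have hcount : ∀ t : ℝ, ∫ n : ℕ, ((bb χ n * Real.log n ^ k : ℝ):ℂ) * ((n:ℝ):ℂ)^(-(σ + t * Complex.I : ℂ)) ∂Measure.count = LSeries (LSeries.logMul^[k] (fun n => (bb χ n : ℂ))) (σ + t * Complex.I) := by
    intro t
    have hs : Summable _ := hsum (σ + t * Complex.I) (by simpa)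
    rw [integral_countable]
    · simp only [← hterm]
      simp [LSeries, Measure.real]
    · rw [integrable_count_iff]
      simp only [← hterm]
      exact hs.norm
  have h := perron_gen (μ := Measure.count) (α := ℕ) (u := fun n => (n:ℝ)) (g := fun n => bb χ n * Real.log n ^ k) (by fun_prop) (by fun_prop)
    (fun n => by
      rcases eq_or_ne n 0 with rfl | hn
      · right; simp [hb0]
      · left; positivity) hσ.le hx hint
  simp only [hcount] at h
  refine ⟨h.1, h.2.trans ?_⟩
  rw [integral_countable]
  · simp [Measure.real]
  · refine (hint.const_mul (x^σ)).mono' (by fun_prop) (ae_of_all _ fun n => ?_)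
    have h0 : 0 ≤ bb χ n * Real.log n ^ k := by have := bb_nonneg χ n; positivity
    rcases eq_or_ne n 0 with rfl | hn
    · simp [hb0]
    rw [norm_mul, Real.norm_of_nonneg h0, Real.norm_of_nonneg (le_max_right _ _), mul_left_comm]
    refine mul_le_mul_of_nonneg_left ?_ h0
    have hn' : (0:ℝ) < n := by positivity
    rcases le_or_gt x n with hxn | hxn
    · rw [max_eq_right (by rw [sub_nonpos]; exact (one_le_div hx).2 hxn)]; positivity
    · rw [max_eq_left (by rw [sub_nonneg]; exact (div_le_one hx).2 hxn.le), Real.rpow_neg hn'.le, ← div_eq_mul_inv]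
      refine le_trans (b := 1) (by have : 0 ≤ (n:ℝ)/x := by positivity
                                   linarith) ?_
      rw [one_le_div (by positivity)]
      exact Real.rpow_le_rpow hn'.le hxn.le (by linarith)

lemma perron_pole (k : ℕ) {σ x : ℝ} (hσ : 1 < σ) (hx : 0 < x) :
    Integrable (fun t : ℝ => (k.factorial / ((σ + t * Complex.I : ℂ)-1)^(k+1)) * ((x:ℂ)^(σ + t * Complex.I : ℂ) * (1 / ((σ + t * Complex.I : ℂ) * (σ + t * Complex.I + 1))))) ∧
    ∫ t : ℝ, (k.factorial / ((σ + t * Complex.I : ℂ)-1)^(k+1)) * ((x:ℂ)^(σ + t * Complex.I : ℂ) * (1 / ((σ + t * Complex.I : ℂ) * (σ + t * Complex.I + 1)))) = 2 * Real.pi * ((∫ v in Ioi (0:ℝ), v^k * Real.exp v * max (1 - Real.exp v / x) 0 : ℝ) : ℂ) := by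
  have hc : ∀ t : ℝ, ∫ v in Ioi (0:ℝ), ((v^k * Real.exp v : ℝ):ℂ) * ((Real.exp v : ℝ):ℂ)^(-(σ + t * Complex.I : ℂ)) = k.factorial / ((σ + t * Complex.I : ℂ)-1)^(k+1) := by
    intro t
    rw [← gam_int k (r := (σ + t * Complex.I : ℂ)-1) (by simpa)]
    congr 1; ext v
    rw [Complex.ofReal_exp, ← Complex.ofReal_exp, Complex.ofReal_mul, mul_assoc, Complex.cpow_def_of_ne_zero (by exact_mod_cast (Real.exp_pos v).ne'), ← Complex.ofReal_log (Real.exp_pos v).le, Real.log_exp, Complex.ofReal_exp, ← Complex.exp_add]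
    push_cast
    congr 2; ring
  have h := perron_gen (μ := volume.restrict (Ioi (0:ℝ))) (u := Real.exp) (g := fun v => v^k * Real.exp v) (by fun_prop) (by fun_prop)
    (fun n => Or.inl (Real.exp_pos _)) hσ.le hx (by
      refine (pow_exp_int k (r := σ - 1) (by linarith)).congr (ae_of_all _ fun v => ?_)
      beta_reduce
      rw [← Real.exp_mul, mul_assoc, ← Real.exp_add]
      congr 2; ring)
  simp only [hc] at h
  exact h

noncomputable def SS {q : ℕ} (χ : DirichletCharacter ℂ q) (k : ℕ) (x : ℝ) : ℝ := ∑' n : ℕ, bb χ n * Real.log n ^ k * max (1 - n / x) 0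
noncomputable def II (k : ℕ) (x : ℝ) : ℝ := ∫ v in Ioi (0:ℝ), v^k * Real.exp v * max (1 - Real.exp v / x) 0

lemma perron_Phi {q : ℕ} [NeZero q] {χ : DirichletCharacter ℂ q} (hχ1 : χ ≠ 1) (hχ : χ^2 = 1) (k : ℕ) {σ x : ℝ} (hσ : 1 < σ) (hx : 0 < x) :
    ∫ t : ℝ, ((-1)^k * iteratedDeriv k (Phi χ) (σ + t * Complex.I)) * ((x:ℂ)^(σ + t * Complex.I : ℂ) * (1 / ((σ + t * Complex.I : ℂ) * (σ + t * Complex.I + 1)))) = 2 * Real.pi * ((SS χ k x - II k x : ℝ):ℂ) := by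
  obtain ⟨i1, h1⟩ := perron_sum hχ k hσ hx
  obtain ⟨i2, h2⟩ := perron_pole k hσ hx
  rw [Complex.ofReal_sub, mul_sub]
  unfold SS II
  rw [← h1, ← h2, ← integral_sub i1 i2]
  congr 1; ext t
  rw [Phi_iter hχ1 hχ (by simpa), sub_mul]

theorem SI_bound (ε : ℝ) (hε : 0 < ε) : ∃ C : ℝ, 1 ≤ C ∧ ∀ (q : ℕ) [NeZero q] (χ : DirichletCharacter ℂ q), χ ≠ 1 → χ^2 = 1 →
    ∀ η x : ℝ, 0 < η → η ≤ 1 → 0 < x → ∀ k : ℕ,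
    |SS χ k x - II k x| ≤ x^(1+η) * ((k+1).factorial * ((k+1).factorial + ((q:ℝ)^(1/2+ε))^(k+1)) * C^(k+1) * √(q/η)) := by
  obtain ⟨C, hC, hb⟩ := Phi_bound ε hε
  have hJ : Integrable (fun t : ℝ => √(|t|+5) * (1+t^2)⁻¹) := by
    have h := (integrable_rpow_neg_one_add_norm_sq (E := ℝ) (μ := volume) (r := 3/2) (by simp; norm_num)).const_mul 3
    refine h.mono' (by fun_prop) (ae_of_all _ fun t => ?_)
    rw [Real.norm_of_nonneg (by positivity), Real.norm_eq_abs, sq_abs]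
    have h1 : √(|t|+5) ≤ 3 * (1+t^2)^((1:ℝ)/4) := by
      apply Real.sqrt_le_iff.2 ⟨by positivity, ?_⟩
      rw [mul_pow, ← Real.rpow_natCast (_ ^ _), ← Real.rpow_mul (by positivity)]
      norm_num
      rw [← Real.sqrt_eq_rpow]
      have h2 : 1 ≤ √(1+t^2) := Real.one_le_sqrt.2 (by nlinarith [sq_nonneg t])
      have h3 : |t| ≤ √(1+t^2) := Real.abs_le_sqrt (by linarith)
      linarith
    have h2 : (1+t^2)^(-(3/2:ℝ)/2) = (1+t^2)^((1:ℝ)/4) * (1+t^2)⁻¹ := by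
      rw [← Real.rpow_neg_one, ← Real.rpow_add (by positivity)]; norm_num
    rw [h2, ← mul_assoc]
    gcongr
  set J := ∫ t : ℝ, √(|t|+5) * (1+t^2)⁻¹ with hJd
  have hJ0 : 0 ≤ J := integral_nonneg fun t => by positivity
  refine ⟨C * (1 + J), by nlinarith, ?_⟩
  intro q _ χ h1 h2 η x hη hη1 hx k
  have hP := perron_Phi h1 h2 k (σ := 1+η) (x := x) (by linarith) hx
  set F : ℝ := (k+1).factorial * ((k+1).factorial + ((q:ℝ)^(1/2+ε))^(k+1)) * C^(k+1) * √(q/η) with hF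
  have hF0 : 0 ≤ F := by positivity
  have hle : ‖∫ t : ℝ, ((-1)^k * iteratedDeriv k (Phi χ) (((1+η:ℝ):ℂ) + t * Complex.I)) * ((x:ℂ)^(((1+η:ℝ):ℂ) + t * Complex.I : ℂ) * (1 / ((((1+η:ℝ):ℂ) + t * Complex.I : ℂ) * (((1+η:ℝ):ℂ) + t * Complex.I + 1))))‖ ≤ ∫ t : ℝ, x^(1+η) * F * (√(|t|+5) * (1+t^2)⁻¹) := by
    refine norm_integral_le_of_norm_le (hJ.const_mul _) (ae_of_all _ fun t => ?_)
    have e1 := hb q χ h1 h2 η t hη hη1 k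
    have e2 := s_norm (σ := 1+η) (by linarith) t
    rw [norm_mul, norm_mul, norm_mul, norm_pow, norm_neg, norm_one, one_pow, one_mul, Complex.norm_cpow_eq_rpow_re_of_pos hx, norm_div, norm_one, norm_mul]
    have e3 : (((1+η:ℝ):ℂ) + t * Complex.I : ℂ).re = 1+η := by simp
    rw [e3]
    have e4 : √(q*(|t|+5)/η) = √(q/η) * √(|t|+5) := by
      rw [← Real.sqrt_mul (by positivity)]; congr 1; ring
    rw [e4, ← mul_assoc] at e1
    have e5 : 1 / (‖(((1+η:ℝ):ℂ) + t * Complex.I : ℂ)‖ * ‖(((1+η:ℝ):ℂ) + t * Complex.I + 1: ℂ)‖) ≤ (1+t^2)⁻¹ := by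
      rw [← one_div]
      exact div_le_div_of_nonneg_left zero_le_one (by positivity) e2
    calc _ ≤ (F * √(|t|+5)) * (x^(1+η) * (1+t^2)⁻¹) := by
          refine mul_le_mul e1 (mul_le_mul_of_nonneg_left e5 (by positivity)) (by positivity) (by positivity)
      _ = _ := by ring
  rw [hP, integral_const_mul, ← hJd, norm_mul, Complex.norm_real, norm_mul, Complex.norm_real, Complex.norm_ofNat, Real.norm_of_nonneg Real.pi_pos.le, Real.norm_eq_abs] at hle
  have h6 : |SS χ k x - II k x| ≤ x^(1+η) * F * J := by
    refine le_trans ?_ hle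
    have := Real.pi_gt_three
    nlinarith [abs_nonneg (SS χ k x - II k x)]
  refine h6.trans ?_
  rw [mul_assoc]
  refine mul_le_mul_of_nonneg_left ?_ (by positivity)
  have h7 : J ≤ (1+J)^(k+1) := by
    calc J ≤ (1+J)^1 := by linarith
      _ ≤ _ := pow_le_pow_right₀ (by linarith) (by omega)
  rw [mul_pow, hF]
  calc _ ≤ (k+1).factorial * ((k+1).factorial + ((q:ℝ)^(1/2+ε))^(k+1)) * C^(k+1) * √(q/η) * (1+J)^(k+1) := by gcongr
    _ = _ := by ring

end

section
open MeasureTheory Set Filter Topology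

noncomputable def AA {q : ℕ} (χ : DirichletCharacter ℂ q) (k : ℕ) (v : ℝ) : ℝ := ∑ n ∈ Finset.Icc 0 ⌊v⌋₊, Real.log n ^ k * bb χ n
noncomputable def JJ (k : ℕ) (v : ℝ) : ℝ := ∫ w in (0:ℝ)..(Real.log v), w^k * Real.exp w

lemma SS_fin {q : ℕ} (χ : DirichletCharacter ℂ q) (k : ℕ) {v : ℝ} (hv : 0 < v) {N : ℕ} (hN : v ≤ N) :
    v * SS χ k v = ∑ n ∈ Finset.Icc 0 N, Real.log n ^ k * bb χ n * max (v - n) 0 := by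
  unfold SS
  rw [tsum_eq_sum (s := Finset.Icc 0 N), Finset.mul_sum]
  · refine Finset.sum_congr rfl fun n _ => ?_
    have : v * max (1 - n/v) 0 = max (v - n) 0 := by
      rw [mul_max_of_nonneg _ _ hv.le]; congr 1
      · field_simp
      · simp
    rw [← this]; ring
  · intro n hn
    have : N < n := by simpa using hn
    have : (N:ℝ) < n := by exact_mod_cast this
    rw [max_eq_right, mul_zero]
    rw [sub_nonpos, one_le_div hv]; linarith

lemma AA_fin {q : ℕ} (χ : DirichletCharacter ℂ q) (k : ℕ) {v : ℝ} (hv : 0 < v) {N : ℕ} (hN : v ≤ N) :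
    AA χ k v = ∑ n ∈ Finset.Icc 0 N, Real.log n ^ k * bb χ n * (if (n:ℝ) ≤ v then 1 else 0) := by
  unfold AA
  simp only [mul_ite, mul_one, mul_zero]
  rw [← Finset.sum_filter]
  refine Finset.sum_congr ?_ fun _ _ => rfl
  ext n
  simp only [Finset.mem_Icc, Finset.mem_filter, Nat.zero_le, true_and]
  rw [Nat.le_floor_iff hv.le]
  refine ⟨fun h => ⟨?_, h⟩, fun h => h.2⟩
  exact_mod_cast h.trans hN

lemma AA_diff {q : ℕ} [NeZero q] (χ : DirichletCharacter ℂ q) (k : ℕ) {v y : ℝ} (hv : 0 < v) (hy : 0 ≤ y) :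
    y * AA χ k v ≤ (v+y) * SS χ k (v+y) - v * SS χ k v ∧ (v+y) * SS χ k (v+y) - v * SS χ k v ≤ y * AA χ k (v+y) := by
  obtain ⟨N, hN⟩ := exists_nat_ge (v+y)
  rw [SS_fin χ k hv (by linarith : v ≤ N), SS_fin χ k (by linarith) hN, AA_fin χ k hv (by linarith : v ≤ N), AA_fin χ k (by linarith) hN,
    ← Finset.sum_sub_distrib, Finset.mul_sum, Finset.mul_sum]
  constructor
  all_goals
    refine Finset.sum_le_sum fun n _ => ?_
    have h0 : 0 ≤ Real.log n ^ k * bb χ n := mul_nonneg (by positivity) (bb_nonneg χ n)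
    rw [← mul_sub, mul_left_comm]
    refine mul_le_mul_of_nonneg_left ?_ h0
    split_ifs with h
    all_goals
      rcases max_cases (v + y - n) 0 with ⟨e1, e2⟩ | ⟨e1, e2⟩ <;> rcases max_cases (v - n) 0 with ⟨e3, e4⟩ | ⟨e3, e4⟩ <;> rw [e1, e3] <;> linarith

lemma II_int (k : ℕ) {v R : ℝ} (hv : 1 ≤ v) (hR : Real.log v ≤ R) :
    v * II k v = ∫ w in (0:ℝ)..R, w^k * Real.exp w * max (v - Real.exp w) 0 := by
  have h0 := Real.log_nonneg hv
  unfold II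
  rw [intervalIntegral.integral_of_le (by linarith), ← integral_const_mul]
  have e : ∀ w : ℝ, v * (w^k * Real.exp w * max (1 - Real.exp w / v) 0) = w^k * Real.exp w * max (v - Real.exp w) 0 := by
    intro w
    have : v * max (1 - Real.exp w/v) 0 = max (v - Real.exp w) 0 := by
      rw [mul_max_of_nonneg _ _ (by linarith)]; congr 1
      · field_simp
      · simp
    rw [← this]; ring
  simp only [e]
  refine (setIntegral_eq_of_subset_of_forall_diff_eq_zero measurableSet_Ioi (fun w hw => hw.1) ?_)
  rintro w ⟨h1, h2⟩
  have h3 : R < w := by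
    by_contra! h; exact h2 ⟨h1, h⟩
  rw [max_eq_right, mul_zero]
  rw [sub_nonpos, ← Real.log_le_iff_le_exp (by linarith)]; linarith

lemma II_diff (k : ℕ) {v y : ℝ} (hv : 1 ≤ v) (hy : 0 ≤ y) :
    y * JJ k v ≤ (v+y) * II k (v+y) - v * II k v ∧ (v+y) * II k (v+y) - v * II k v ≤ y * JJ k (v+y) := by
  have h0 := Real.log_nonneg hv
  have h1 : Real.log v ≤ Real.log (v+y) := Real.log_le_log (by linarith) (by linarith)
  have hi : ∀ u a b : ℝ, IntervalIntegrable (fun w => w^k * Real.exp w * max (u - Real.exp w) 0) volume a b := fun u a b =>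
    Continuous.intervalIntegrable (by fun_prop) _ _
  have hj : ∀ a b : ℝ, IntervalIntegrable (fun w => y * (w^k * Real.exp w)) volume a b := fun a b =>
    Continuous.intervalIntegrable (by fun_prop) _ _
  rw [II_int k hv h1, II_int k (by linarith) le_rfl]
  unfold JJ
  rw [← intervalIntegral.integral_sub (hi _ _ _) (hi _ _ _), ← intervalIntegral.integral_const_mul, ← intervalIntegral.integral_const_mul]
  constructor
  · rw [← intervalIntegral.integral_add_adjacent_intervals (b := Real.log v) (c := Real.log (v+y)) ((hi _ _ _).sub (hi _ _ _)) ((hi _ _ _).sub (hi _ _ _))]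
    have a1 : ∫ w in (0:ℝ)..Real.log v, y * (w^k * Real.exp w) ≤ ∫ w in (0:ℝ)..Real.log v, (w^k * Real.exp w * max (v + y - Real.exp w) 0 - w^k * Real.exp w * max (v - Real.exp w) 0) := by
      refine intervalIntegral.integral_mono_on h0 (hj _ _) ((hi _ _ _).sub (hi _ _ _)) fun w hw => ?_
      have : Real.exp w ≤ v := (Real.le_log_iff_exp_le (by linarith)).1 hw.2
      rw [max_eq_left (by linarith), max_eq_left (by linarith)]
      exact le_of_eq (by ring)
    have a2 : 0 ≤ ∫ w in Real.log v..Real.log (v+y), (w^k * Real.exp w * max (v + y - Real.exp w) 0 - w^k * Real.exp w * max (v - Real.exp w) 0) := by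
      refine intervalIntegral.integral_nonneg h1 fun w hw => ?_
      rw [← mul_sub]
      have : 0 ≤ w := h0.trans hw.1
      refine mul_nonneg (by positivity) ?_
      rw [sub_nonneg]
      exact max_le_max (by linarith) le_rfl
    linarith
  · refine intervalIntegral.integral_mono_on (by linarith) ((hi _ _ _).sub (hi _ _ _)) (hj _ _) fun w hw => ?_
    rw [← mul_sub, mul_comm y]
    have : 0 ≤ w := hw.1
    refine mul_le_mul_of_nonneg_left ?_ (by positivity)
    rcases max_cases (v + y - Real.exp w) 0 with ⟨e1, e2⟩ | ⟨e1, e2⟩ <;> rcases max_cases (v - Real.exp w) 0 with ⟨e3, e4⟩ | ⟨e3, e4⟩ <;> rw [e1, e3] <;> linarith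

lemma JJ_diff (k : ℕ) {v y : ℝ} (hv : 1 ≤ v) (hy : 0 ≤ y) : JJ k (v+y) - JJ k v ≤ y * Real.log (v+y)^k := by
  have h0 := Real.log_nonneg hv
  have h1 : Real.log v ≤ Real.log (v+y) := Real.log_le_log (by linarith) (by linarith)
  have hi : ∀ a b : ℝ, IntervalIntegrable (fun w => w^k * Real.exp w) volume a b := fun a b =>
    Continuous.intervalIntegrable (by fun_prop) _ _
  unfold JJ
  rw [intervalIntegral.integral_interval_sub_left (hi _ _) (hi _ _)]
  calc _ ≤ ∫ w in Real.log v..Real.log (v+y), Real.log (v+y)^k * Real.exp w := by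
        refine intervalIntegral.integral_mono_on h1 (hi _ _) (Continuous.intervalIntegrable (by fun_prop) _ _) fun w hw => ?_
        have : 0 ≤ w := h0.trans hw.1
        have := pow_le_pow_left₀ this hw.2 k
        gcongr
    _ = _ := by
        rw [intervalIntegral.integral_const_mul, integral_exp, Real.exp_log (by linarith), Real.exp_log (by linarith)]; ring

lemma AJ {q : ℕ} [NeZero q] (χ : DirichletCharacter ℂ q) (k : ℕ) {v y B : ℝ} (hy : 0 < y) (hv : 1 + y ≤ v)
    (hB : ∀ w, 1 ≤ w → w ≤ v + y → w * |SS χ k w - II k w| ≤ B) :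
    |AA χ k v - JJ k v| ≤ 2 * B / y + y * Real.log (v+y)^k := by
  have hB' : ∀ w, 1 ≤ w → w ≤ v + y → |w * SS χ k w - w * II k w| ≤ B := by
    intro w h1 h2
    rw [← mul_sub, abs_mul, abs_of_nonneg (by linarith)]; exact hB w h1 h2
  have b1 := abs_le.1 (hB' v (by linarith) (by linarith))
  have b2 := abs_le.1 (hB' (v+y) (by linarith) (by linarith))
  have b3 := abs_le.1 (hB' (v-y) (by linarith) (by linarith))
  have a1 := (AA_diff χ k (v := v) (by linarith) hy.le).1
  have a2 := (AA_diff χ k (v := v-y) (by linarith) hy.le).2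
  have i1 := (II_diff k (v := v) (by linarith) hy.le).2
  have i2 := (II_diff k (v := v-y) (by linarith) hy.le).1
  have j1 := JJ_diff k (v := v) (by linarith) hy.le
  have j2 := JJ_diff k (v := v-y) (by linarith) hy.le
  rw [sub_add_cancel] at a2 i2 j2
  have hl : Real.log v ^ k ≤ Real.log (v+y)^k := pow_le_pow_left₀ (Real.log_nonneg (by linarith)) (Real.log_le_log (by linarith) (by linarith)) k
  have e : 2 * B / y + y * Real.log (v+y)^k = (2 * B + y * (y * Real.log (v+y)^k)) / y := by field_simp
  rw [e, le_div_iff₀ hy, ← abs_of_pos hy, ← abs_mul, abs_of_pos hy, abs_le]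
  have j1' := mul_le_mul_of_nonneg_left j1 hy.le
  have j2' := mul_le_mul_of_nonneg_left j2 hy.le
  have hl' := mul_le_mul_of_nonneg_left (mul_le_mul_of_nonneg_left hl hy.le) hy.le
  rw [mul_sub] at j1' j2'
  constructor <;> linarith

end

section
open MeasureTheory Set Filter Topology

lemma abel {q : ℕ} [NeZero q] (χ : DirichletCharacter ℂ q) (k : ℕ) {z x E : ℝ} (hz0 : 0 < z) (hz : 1 ≤ Real.log z) (hzx : z ≤ x) (hE0 : 0 ≤ E)
    (hE : ∀ v, z ≤ v → v ≤ x → |AA χ k v - JJ k v| ≤ E * v * Real.log v ^ k) :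
    |∑ n ∈ Finset.Ioc ⌊z⌋₊ ⌊x⌋₊, bb χ n / Real.log n - ∫ t in z..x, 1 / Real.log t| ≤ E * (k+3) * x := by
  set f : ℝ → ℝ := fun u => (Real.log u ^ (k+1))⁻¹ with hf
  set f' : ℝ → ℝ := fun u => -((k+1) * Real.log u ^ k * u⁻¹) / (Real.log u ^ (k+1))^2 with hf'
  have hx0 : 0 < x := hz0.trans_le hzx
  have hlog : ∀ u, z ≤ u → 1 ≤ Real.log u := fun u hu => hz.trans (Real.log_le_log hz0 hu)
  have hd : ∀ u, z ≤ u → HasDerivAt f (f' u) u := by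
    intro u hu
    have h1 := hlog u hu
    have hu0 : 0 < u := hz0.trans_le hu
    have h2 := ((Real.hasDerivAt_log hu0.ne').fun_pow (k+1)).fun_inv (by positivity)
    refine h2.congr_deriv ?_
    simp [hf']
  have hJd : ∀ u, z ≤ u → HasDerivAt (JJ k) (Real.log u ^ k) u := by
    intro u hu
    have hu0 : 0 < u := hz0.trans_le hu
    have h1 : HasDerivAt (fun R : ℝ => ∫ w in (0:ℝ)..R, w^k * Real.exp w) (Real.log u ^k * Real.exp (Real.log u)) (Real.log u) := by
      have hc : Continuous (fun w : ℝ => w^k * Real.exp w) := by fun_prop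
      exact hc.integral_hasStrictDerivAt 0 _ |>.hasDerivAt
    have h2 := h1.comp u (Real.hasDerivAt_log hu0.ne')
    refine h2.congr_deriv ?_
    rw [Real.exp_log hu0]; field_simp
  have hf'c : ContinuousOn f' (Icc z x) := by
    rw [hf']
    have hl : ContinuousOn Real.log (Icc z x) := Real.continuousOn_log.mono fun u hu => (hz0.trans_le hu.1).ne'
    refine ContinuousOn.div ?_ ((hl.pow _).pow _) fun u hu => by have := hlog u hu.1; positivity
    exact ((continuousOn_const.mul (hl.pow _)).mul (continuousOn_id.inv₀ fun u hu => (hz0.trans_le hu.1).ne')).neg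
  have hde : ∀ u ∈ Icc z x, deriv f u = f' u := fun u hu => (hd u hu.1).deriv
  have hfi : IntegrableOn f' (Icc z x) := hf'c.integrableOn_Icc
  have hfi' : IntegrableOn (deriv f) (Icc z x) := hfi.congr_fun (fun u hu => (hde u hu).symm) measurableSet_Icc
  have hab := sum_mul_eq_sub_sub_integral_mul (fun n : ℕ => Real.log n ^ k * bb χ n) hz0.le hzx (fun t ht => (hd t ht.1).differentiableAt) hfi'
  have hsum : ∑ n ∈ Finset.Ioc ⌊z⌋₊ ⌊x⌋₊, f n * (Real.log n ^ k * bb χ n) = ∑ n ∈ Finset.Ioc ⌊z⌋₊ ⌊x⌋₊, bb χ n / Real.log n := by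
    refine Finset.sum_congr rfl fun n hn => ?_
    have : z < n := Nat.lt_of_floor_lt (Finset.mem_Ioc.1 hn).1
    have := hlog n this.le
    simp only [hf]
    field_simp
    ring
  have hint1 : ∫ t in Ioc z x, deriv f t * ∑ n ∈ Finset.Icc 0 ⌊t⌋₊, Real.log n ^ k * bb χ n = ∫ t in z..x, f' t * AA χ k t := by
    rw [intervalIntegral.integral_of_le hzx]
    refine setIntegral_congr_fun measurableSet_Ioc fun t ht => ?_
    beta_reduce
    rw [hde t ⟨ht.1.le, ht.2⟩]; rfl
  rw [hsum, hint1] at hab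
  have huI : uIcc z x = Icc z x := uIcc_of_le hzx
  have hlc : ContinuousOn (fun u => Real.log u ^ k) (Icc z x) := (Real.continuousOn_log.mono fun u hu => (hz0.trans_le hu.1).ne').pow _
  have hibp := intervalIntegral.integral_mul_deriv_eq_deriv_mul (a := z) (b := x) (u := f) (v := JJ k) (u' := f') (v' := fun u => Real.log u ^ k)
    (fun u hu => hd u (by rw [huI] at hu; exact hu.1)) (fun u hu => hJd u (by rw [huI] at hu; exact hu.1))
    (by rw [intervalIntegrable_iff_integrableOn_Icc_of_le hzx]; exact hfi)
    (by rw [intervalIntegrable_iff_integrableOn_Icc_of_le hzx]; exact hlc.integrableOn_Icc)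
  have hint2 : ∫ t in z..x, f t * Real.log t ^ k = ∫ t in z..x, 1 / Real.log t := by
    refine intervalIntegral.integral_congr fun t ht => ?_
    rw [huI] at ht
    have := hlog t ht.1
    simp only [hf]
    field_simp
    ring
  rw [hint2] at hibp
  have iA : IntervalIntegrable (fun t => f' t * AA χ k t) volume z x := by
    rw [intervalIntegrable_iff_integrableOn_Icc_of_le hzx]
    exact integrableOn_mul_sum_Icc (c := fun n : ℕ => Real.log n ^ k * bb χ n) hz0.le hfi
  have iJ : IntervalIntegrable (fun t => f' t * JJ k t) volume z x := by
    rw [intervalIntegrable_iff_integrableOn_Icc_of_le hzx]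
    exact (hf'c.mul fun u hu => (hJd u hu.1).continuousAt.continuousWithinAt).integrableOn_Icc
  have hd3 : ∑ n ∈ Finset.Ioc ⌊z⌋₊ ⌊x⌋₊, bb χ n / Real.log n - ∫ t in z..x, 1 / Real.log t
      = f x * (AA χ k x - JJ k x) - f z * (AA χ k z - JJ k z) - ∫ t in z..x, f' t * (AA χ k t - JJ k t) := by
    have : ∫ t in z..x, f' t * (AA χ k t - JJ k t) = (∫ t in z..x, f' t * AA χ k t) - ∫ t in z..x, f' t * JJ k t := by
      rw [← intervalIntegral.integral_sub iA iJ]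
      congr 1; ext t; ring
    rw [this, hab, hibp]
    unfold AA
    ring
  have hfb : ∀ u, z ≤ u → u ≤ x → |f u * (AA χ k u - JJ k u)| ≤ E * x := by
    intro u h1 h2
    have h3 := hlog u h1
    have hu0 : 0 < u := hz0.trans_le h1
    rw [abs_mul, abs_of_nonneg (by simp only [hf]; positivity)]
    calc _ ≤ f u * (E * u * Real.log u ^ k) := mul_le_mul_of_nonneg_left (hE u h1 h2) (by simp only [hf]; positivity)
      _ = E * u / Real.log u := by simp only [hf]; field_simp; ring
      _ ≤ E * u := div_le_self (by positivity) h3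
      _ ≤ _ := mul_le_mul_of_nonneg_left h2 hE0
  have hib : |∫ t in z..x, f' t * (AA χ k t - JJ k t)| ≤ (E * (k+1)) * |x - z| := by
    rw [← Real.norm_eq_abs]
    refine intervalIntegral.norm_integral_le_of_norm_le_const fun u hu => ?_
    rw [uIoc_of_le hzx] at hu
    have h3 := hlog u hu.1.le
    have hu0 : 0 < u := hz0.trans hu.1
    rw [norm_mul, Real.norm_eq_abs, Real.norm_eq_abs]
    have e : |f' u| = (k+1) * Real.log u ^ k * u⁻¹ / (Real.log u ^ (k+1))^2 := by
      simp only [hf']; rw [neg_div, abs_neg, abs_of_nonneg (by positivity)]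
    rw [e]
    calc _ ≤ (k+1) * Real.log u ^ k * u⁻¹ / (Real.log u ^ (k+1))^2 * (E * u * Real.log u ^ k) := mul_le_mul_of_nonneg_left (hE u hu.1.le hu.2) (by positivity)
      _ = E * (k+1) / (Real.log u)^2 := by field_simp; ring
      _ ≤ _ := div_le_self (by positivity) (one_le_pow₀ h3)
  rw [hd3]
  have h1 := hfb x hzx le_rfl
  have h2 := hfb z le_rfl hzx
  rw [abs_of_nonneg (by linarith : 0 ≤ x - z)] at hib
  have h3 : E * (k+1) * (x - z) ≤ E * (k+1) * x := mul_le_mul_of_nonneg_left (by linarith) (by positivity)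
  calc _ ≤ |f x * (AA χ k x - JJ k x)| + |f z * (AA χ k z - JJ k z)| + |∫ t in z..x, f' t * (AA χ k t - JJ k t)| :=
        (abs_sub _ _).trans (add_le_add (abs_sub _ _) le_rfl)
    _ ≤ _ := by linarith

end

section
open MeasureTheory Set Filter Topology

lemma K_est {δ C c0 L : ℝ} (hδ0 : 0 < δ) (hδ1 : δ < 1) (hC : 1 ≤ C) (hc0 : 0 < c0) (hc : 8 * c0 * C = Real.exp (-10)) (hL : 1 ≤ L) (hcL : 1 ≤ c0 * √L) {q : ℕ}
    (hq : (q:ℝ) ≤ 4 * L^(1-δ)) :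
    ((⌊c0 * √L⌋₊+1).factorial * ((⌊c0 * √L⌋₊+1).factorial + ((q:ℝ)^(1/2+δ/2))^(⌊c0 * √L⌋₊+1)) * C^(⌊c0 * √L⌋₊+1) * √(q/(1/L)) : ℝ) ≤ 4 * L^2 * L^⌊c0 * √L⌋₊ * Real.exp (-10 * ⌊c0 * √L⌋₊) := by
  set s := √L with hs
  have hs1 : 1 ≤ s := Real.one_le_sqrt.2 hL
  have hss : s * s = L := Real.mul_self_sqrt (by linarith)
  set k := ⌊c0 * s⌋₊ with hk
  have hk1 : (k:ℝ) ≤ c0 * s := Nat.floor_le (by positivity)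
  have hc1 : c0 ≤ 1 := by
    have : Real.exp (-10) ≤ 1 := Real.exp_le_one_iff.2 (by norm_num)
    nlinarith
  have hfac : ((k+1).factorial : ℝ) ≤ (2*c0*s)^(k+1) := by
    have h1 : ((k+1).factorial : ℝ) ≤ ((k+1:ℕ):ℝ)^(k+1) := by exact_mod_cast Nat.factorial_le_pow (k+1)
    refine h1.trans (pow_le_pow_left₀ (by positivity) ?_ _)
    push_cast; linarith
  have hL0 : (0:ℝ) < L := by linarith
  have hQ : (q:ℝ)^(1/2+δ/2) ≤ 4 * s := by
    calc (q:ℝ)^(1/2+δ/2) ≤ (4 * L^(1-δ))^(1/2+δ/2) := Real.rpow_le_rpow (by positivity) hq (by positivity)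
      _ = 4^(1/2+δ/2) * L^((1-δ)*(1/2+δ/2)) := by
        rw [Real.mul_rpow (by norm_num) (by positivity), ← Real.rpow_mul hL0.le]
      _ ≤ 4^(1:ℝ) * L^((1:ℝ)/2) := by
        refine mul_le_mul (Real.rpow_le_rpow_of_exponent_le (by norm_num) (by linarith)) (Real.rpow_le_rpow_of_exponent_le hL (by nlinarith)) (by positivity) (by positivity)
      _ = 4 * s := by rw [Real.rpow_one, hs, Real.sqrt_eq_rpow]
  have hsq : √(q/(1/L)) ≤ 2 * L := by
    apply Real.sqrt_le_iff.2 ⟨by positivity, ?_⟩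
    have : L^(1-δ) ≤ L^(1:ℝ) := Real.rpow_le_rpow_of_exponent_le hL (by linarith)
    rw [Real.rpow_one] at this
    rw [div_div_eq_mul_div, div_one]
    nlinarith
  have h2 : ((k+1).factorial : ℝ) + ((q:ℝ)^(1/2+δ/2))^(k+1) ≤ 2 * (4*s)^(k+1) := by
    have a1 : (2*c0*s)^(k+1) ≤ (4*s)^(k+1) := pow_le_pow_left₀ (by positivity) (by nlinarith) _
    have a2 : ((q:ℝ)^(1/2+δ/2))^(k+1) ≤ (4*s)^(k+1) := pow_le_pow_left₀ (by positivity) hQ _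
    linarith
  calc _ ≤ (2*c0*s)^(k+1) * (2 * (4*s)^(k+1)) * C^(k+1) * (2*L) := by gcongr
    _ = (8*c0*C*(s*s))^(k+1) * (4 * L) := by
      rw [show 8*c0*C*(s*s) = (2*c0*s)*(4*s)*C by ring, mul_pow (2*c0*s*(4*s)), mul_pow (2*c0*s)]; ring
    _ = Real.exp (-10) * (4 * L^2 * L^k * Real.exp (-10 * k)) := by
      rw [hc, hss, mul_pow, pow_succ (Real.exp (-10)), ← Real.exp_nat_mul, pow_succ, mul_comm (k:ℝ)]; ring
    _ ≤ 1 * (4 * L^2 * L^k * Real.exp (-10 * k)) := by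
      refine mul_le_mul_of_nonneg_right (Real.exp_le_one_iff.2 (by norm_num)) (by positivity)
    _ = _ := one_mul _

set_option maxHeartbeats 1000000 in
theorem weighted (δ : ℝ) (hδ0 : 0 < δ) (hδ1 : δ < 1) : ∃ c : ℝ, 0 < c ∧ ∃ C : ℝ, 0 < C ∧ ∃ L0 : ℝ, 4 ≤ L0 ∧ ∀ x : ℝ, 1 < x → L0 ≤ Real.log x →
    ∀ (q : ℕ) [NeZero q] (χ : DirichletCharacter ℂ q), χ ≠ 1 → χ^2 = 1 → (q:ℝ) ≤ 4 * (Real.log x)^(1-δ) →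
    |∑ n ∈ Finset.Ioc ⌊√x⌋₊ ⌊x⌋₊, bb χ n / Real.log n - ∫ t in (√x)..x, 1 / Real.log t| ≤ C * x * Real.exp (-c * √(Real.log x)) := by
  obtain ⟨C, hC, hSI⟩ := SI_bound (δ/2) (by linarith)
  set c0 := Real.exp (-10) / (8 * C) with hc0d
  have hc0 : 0 < c0 := by positivity
  have hc8 : 8 * c0 * C = Real.exp (-10) := by rw [hc0d]; field_simp
  set M := 512 * (24 * 3 / c0^4) + 1 with hM
  have hM0 : 0 < M := by positivity
  refine ⟨c0/2, by positivity, M * 12, by positivity, max 4 (1/c0^2), le_max_left _ _, ?_⟩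
  intro x hx hL q _ χ hχ1 hχ hq
  set L := Real.log x with hLd
  have hL4 : 4 ≤ L := (le_max_left _ _).trans hL
  have hLc : 1 / c0^2 ≤ L := (le_max_right _ _).trans hL
  have hx0 : 0 < x := by linarith
  have hcL : 1 ≤ c0 * √L := by
    rw [← div_le_iff₀' hc0]
    apply Real.le_sqrt_of_sq_le
    rw [div_pow, one_pow]; exact hLc
  have hK := K_est hδ0 hδ1 hC hc0 hc8 (by linarith) hcL hq
  set s := √L with hs
  have hss : s * s = L := Real.mul_self_sqrt (by linarith)
  have hs0 : 0 ≤ s := Real.sqrt_nonneg _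
  set k := ⌊c0 * s⌋₊ with hk
  have hk1 : (k:ℝ) ≤ c0 * s := Nat.floor_le (by positivity)
  have hk2 : c0 * s < k + 1 := Nat.lt_floor_add_one _
  set K : ℝ := ((k+1).factorial * ((k+1).factorial + ((q:ℝ)^(1/2+δ/2))^(k+1)) * C^(k+1) * √(q/(1/L)) : ℝ) with hKd
  have hK0 : 0 ≤ K := by positivity
  have hLsq : L^2 ≤ 24 * 3 / c0^4 * Real.exp k := by
    rw [div_mul_eq_mul_div, le_div_iff₀ (by positivity)]
    have h1 : L^2 * c0^4 = (c0*s)^4 := by rw [← hss]; ring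
    have h2 : (c0*s)^4 ≤ ((k:ℝ)+1)^4 := pow_le_pow_left₀ (by positivity) hk2.le _
    have h3 := Real.pow_div_factorial_le_exp ((k:ℝ)+1) (by positivity) 4
    rw [Real.exp_add] at h3
    have h4 : Real.exp 1 ≤ 3 := by linarith [Real.exp_one_lt_d9]
    have h5 : ((k:ℝ)+1)^4 / 24 ≤ Real.exp k * 3 := by
      have : ((Nat.factorial 4 : ℕ):ℝ) = 24 := by norm_num [Nat.factorial]
      rw [this] at h3
      exact h3.trans (mul_le_mul_of_nonneg_left h4 (Real.exp_pos _).le)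
    linarith
  have h2k : (2:ℝ)^k ≤ Real.exp k := by
    have : (2:ℝ) ≤ Real.exp 1 := by linarith [Real.exp_one_gt_d9]
    calc (2:ℝ)^k ≤ (Real.exp 1)^k := pow_le_pow_left₀ (by norm_num) this _
      _ = _ := by rw [← Real.exp_nat_mul, mul_one]
  have hlz : Real.log √x = L/2 := Real.log_sqrt hx0.le
  have hz0 : 0 < √x := Real.sqrt_pos.2 hx0
  have hzx : √x ≤ x := by rw [Real.sqrt_le_left hx0.le]; nlinarith
  clear_value K k s M
  have hE : ∀ v, √x ≤ v → v ≤ x → |AA χ k v - JJ k v| ≤ (M * Real.exp (-k)) * v * Real.log v ^ k := by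
    intro v h1 h2
    have hv0 : 0 < v := hz0.trans_le h1
    have hl : L/2 ≤ Real.log v := by rw [← hlz]; exact Real.log_le_log hz0 h1
    have hv3 : 3 ≤ v := by
      have := Real.log_le_sub_one_of_pos hv0; linarith
    set l := Real.log v with hld
    have hl0 : 0 ≤ l := by linarith
    set y := v * Real.exp (-2*k) / 2 with hyd
    have hy0 : 0 < y := by positivity
    have hyv : y ≤ v/2 := by
      have : Real.exp (-2*k) ≤ 1 := Real.exp_le_one_iff.2 (by have : (0:ℝ) ≤ k := by positivity
                                                              linarith)
      rw [hyd]; nlinarith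
    have hB : ∀ w, 1 ≤ w → w ≤ v + y → w * |SS χ k w - II k w| ≤ 32 * v^2 * K := by
      intro w hw1 hw2
      have hb := hSI q χ hχ1 hχ (1/L) w (by positivity) (by rw [div_le_one (by linarith)]; linarith) (by linarith) k
      rw [← hKd] at hb
      have hw3 : w ≤ 2 * v := by linarith
      have hwx : w ≤ x^2 := by
        have e1 : w ≤ 2 * x := by linarith
        have e2 : 2 * x ≤ x * x := mul_le_mul_of_nonneg_right (by linarith) hx0.le
        linarith [sq x]
      have hwe : w^(1+1/L) ≤ 8 * w := by
        rw [Real.rpow_add (by linarith), Real.rpow_one, mul_comm]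
        refine mul_le_mul_of_nonneg_right ?_ (by linarith)
        calc w^(1/L) ≤ (x^2)^(1/L) := Real.rpow_le_rpow (by linarith) hwx (by positivity)
          _ = Real.exp 2 := by
            rw [Real.rpow_def_of_pos (by positivity), Real.log_pow, ← hLd]; congr 1; push_cast; field_simp
          _ = Real.exp 1 * Real.exp 1 := by rw [← Real.exp_add]; norm_num
          _ ≤ 8 := by nlinarith [Real.exp_one_lt_d9, Real.exp_one_gt_d9]
      calc w * |SS χ k w - II k w| ≤ w * (w^(1+1/L) * K) := mul_le_mul_of_nonneg_left hb (by linarith)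
        _ ≤ (2*v) * ((8 * (2*v)) * K) := by
          refine mul_le_mul hw3 (mul_le_mul_of_nonneg_right (hwe.trans (by linarith)) hK0) (by positivity) (by positivity)
        _ = _ := by ring
    have hAJ := AJ χ k hy0 (by linarith : 1 + y ≤ v) hB
    refine hAJ.trans ?_
    have hexp : Real.exp (2*k) * Real.exp (-2*k) = 1 := by rw [← Real.exp_add]; simp
    have p1 : 2 * (32 * v^2 * K) / y = 128 * v * Real.exp (2*k) * K := by
      rw [hyd, div_eq_iff (by positivity)]
      linear_combination (-64 * v^2 * K) * hexp
    have hLl : L^k ≤ Real.exp k * l^k := by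
      calc L^k ≤ (2*l)^k := pow_le_pow_left₀ (by linarith) (by linarith) _
        _ = 2^k * l^k := mul_pow _ _ _
        _ ≤ _ := mul_le_mul_of_nonneg_right h2k (by positivity)
    have p2 : 128 * v * Real.exp (2*k) * K ≤ 512 * (24 * 3 / c0^4) * Real.exp (-k) * v * l^k := by
      calc _ ≤ 128 * v * Real.exp (2*k) * (4 * L^2 * L^k * Real.exp (-10*k)) := mul_le_mul_of_nonneg_left hK (by positivity)
        _ ≤ 128 * v * Real.exp (2*k) * (4 * (24 * 3 / c0^4 * Real.exp k) * (Real.exp k * l^k) * Real.exp (-10*k)) := by gcongr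
        _ = 512 * (24 * 3 / c0^4) * (Real.exp (2*k) * Real.exp k * Real.exp k * Real.exp (-10*k)) * v * l^k := by ring
        _ ≤ _ := by
          have : Real.exp (2*k) * Real.exp k * Real.exp k * Real.exp (-10*k) ≤ Real.exp (-k) := by
            rw [← Real.exp_add, ← Real.exp_add, ← Real.exp_add]
            apply Real.exp_le_exp.2
            have : (0:ℝ) ≤ k := by positivity
            linarith
          gcongr
    have p3 : y * Real.log (v+y)^k ≤ Real.exp (-k) * v * l^k := by
      have e1 : Real.log (v+y) ≤ 2 * l := by
        rw [hld, ← Nat.cast_ofNat (n := 2), ← Real.log_pow]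
        exact Real.log_le_log (by positivity) (by nlinarith)
      have e0 : 0 ≤ Real.log (v+y) := Real.log_nonneg (by linarith)
      calc y * Real.log (v+y)^k ≤ (v * Real.exp (-2*k)) * (2*l)^k := mul_le_mul (by rw [hyd]; linarith [show 0 ≤ v * Real.exp (-2*k) by positivity]) (pow_le_pow_left₀ e0 e1 _) (by positivity) (by positivity)
        _ = (v * Real.exp (-2*k)) * (2^k * l^k) := by rw [mul_pow]
        _ ≤ (v * Real.exp (-2*k)) * (Real.exp k * l^k) := by gcongr
        _ = (Real.exp (-2*k) * Real.exp k) * v * l^k := by ring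
        _ = _ := by rw [← Real.exp_add]; congr 3; ring
    rw [p1]
    calc _ ≤ 512 * (24 * 3 / c0^4) * Real.exp (-k) * v * l^k + Real.exp (-k) * v * l^k := add_le_add p2 p3
      _ = _ := by rw [hM]; ring
  have hab := abel χ k hz0 (by rw [hlz]; linarith) hzx (by positivity) hE
  refine hab.trans ?_
  have f1 : (k:ℝ)+3 ≤ 6 * Real.exp (k/2) := by
    have := Real.add_one_le_exp ((k:ℝ)/2)
    have : (0:ℝ) ≤ k := by positivity
    linarith
  have f2 : Real.exp (-k) * Real.exp (k/2) ≤ 2 * Real.exp (-(c0/2) * s) := by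
    have g1 : Real.exp (-k) * Real.exp (k/2) ≤ Real.exp (1/2) * Real.exp (-(c0/2) * s) := by
      rw [← Real.exp_add, ← Real.exp_add]
      apply Real.exp_le_exp.2; linarith
    have g2 : Real.exp (1/2) ≤ 2 := by
      have : Real.exp (1/2) * Real.exp (1/2) = Real.exp 1 := by rw [← Real.exp_add]; norm_num
      nlinarith [Real.exp_one_lt_d9, Real.exp_pos (1/2)]
    exact g1.trans (mul_le_mul_of_nonneg_right g2 (Real.exp_pos _).le)
  calc M * Real.exp (-k) * (k+3) * x ≤ M * Real.exp (-k) * (6 * Real.exp (k/2)) * x := by gcongr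
    _ = 6 * M * x * (Real.exp (-k) * Real.exp (k/2)) := by ring
    _ ≤ 6 * M * x * (2 * Real.exp (-(c0/2) * s)) := by gcongr
    _ = _ := by ring

end

section
open MeasureTheory Set Filter Topology

open NumberTheorySymbols in
theorem exists_jac (D : ℤ) (hD : ¬ IsSquare D) : ∃ n : ℕ, n.Coprime (4 * D.natAbs) ∧ J(D | n) = -1 := by
  have hD0 : D ≠ 0 := by rintro rfl; exact hD ⟨0, by simp⟩
  obtain ⟨a, b, hab, hsq⟩ := Nat.sq_mul_squarefree D.natAbs
  have hb0 : b ≠ 0 := by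
    rintro rfl; simp at hab; omega
  have ha0 : a ≠ 0 := hsq.ne_zero
  have hDs : D = D.sign * ((b:ℤ)^2 * a) := by
    have := Int.sign_mul_natAbs D
    rw [← hab] at this; push_cast at this; exact this.symm
  have hs : D.sign = 1 ∨ D.sign = -1 := by
    rcases lt_trichotomy D 0 with h | h | h
    · right; exact Int.sign_eq_neg_one_of_neg h
    · exact absurd h hD0
    · left; exact Int.sign_eq_one_of_pos h
  have key : ∀ n : ℕ, n.Coprime b → n.Coprime a → n.Coprime 2 → J(D.sign * a | n) = -1 →
      n.Coprime (4 * D.natAbs) ∧ J(D | n) = -1 := by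
    intro n h1 h2 h3 h4
    refine ⟨?_, ?_⟩
    · rw [← hab]
      exact Nat.Coprime.mul_right (show n.Coprime (2 * 2) from Nat.Coprime.mul_right h3 h3) (Nat.Coprime.mul_right (Nat.Coprime.pow_right _ h1) h2)
    · have e : D = (D.sign * a) * (b:ℤ)^2 := by rw [mul_assoc, mul_comm (a:ℤ)]; exact hDs
      rw [e, jacobiSym.mul_left, jacobiSym.sq_one', mul_one]
      · exact h4
      · rw [Int.gcd_natCast_natCast]; exact h1.symm
  have hbf : ∀ p : ℕ, p.Prime → ∃ j b1, ¬ p ∣ b1 ∧ b = p^j * b1 := fun p hp =>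
    Nat.exists_eq_pow_mul_and_not_dvd hb0 p hp.ne_one
  rcases Nat.eq_two_pow_or_exists_odd_prime_and_dvd a with ⟨k, hk⟩ | ⟨p, hp, hpa, hpo⟩
  · obtain ⟨j, b1, hb1, hbe⟩ := hbf 2 Nat.prime_two
    have hk2 : a = 1 ∨ a = 2 := by
      rcases k with _ | _ | k
      · left; simpa using hk
      · right; simpa using hk
      · exfalso
        have := hsq 2 ⟨2^k, by rw [hk]; ring⟩
        simp at this
    have hcop : Nat.Coprime 8 b1 := by
      have : Nat.Coprime 2 b1 := (Nat.Prime.coprime_iff_not_dvd Nat.prime_two).2 hb1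
      exact Nat.Coprime.pow_left 3 this
    have fin : ∀ r : ℕ, r % 2 = 1 → (∀ n : ℕ, n % 8 = r % 8 → J(D.sign * a | n) = -1) → ∃ n : ℕ, n.Coprime (4 * D.natAbs) ∧ J(D | n) = -1 := by
      intro r hr hJ
      obtain ⟨n, hn1, hn2⟩ := Nat.chineseRemainder hcop r 1
      have h2 : n.Coprime 2 := by
        rw [Nat.coprime_two_right, Nat.odd_iff]
        have : n % 8 = r % 8 := hn1
        omega
      have h1 : n.Coprime b1 := by
        have := hn2.gcd_eq; simpa [Nat.Coprime] using this
      refine ⟨n, key n ?_ ?_ h2 (hJ n hn1)⟩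
      · rw [hbe]; exact Nat.Coprime.mul_right (Nat.Coprime.pow_right _ h2) h1
      · rcases hk2 with h | h <;> rw [h]
        · simp
        · exact h2
    have hm : ∀ n r: ℕ, n % 8 = r % 8 → r % 2 = 1 → J(D.sign * a | n) = J(D.sign * a | r) := by
      intro n r h hr
      have e : 4 * (D.sign * (a:ℤ)).natAbs ∣ 8 := by
        rcases hs with h | h <;> rcases hk2 with h' | h' <;> rw [h, h'] <;> decide
      rw [jacobiSym.mod_right _ (b := n) (by rw [Nat.odd_iff]; omega), jacobiSym.mod_right _ (b := r) (by rw [Nat.odd_iff]; omega)]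
      rw [← Nat.mod_mod_of_dvd n e, h, Nat.mod_mod_of_dvd _ e]
    rcases hs with h | h <;> rcases hk2 with h' | h'
    · exfalso; apply hD; rw [hDs, h, h']; exact ⟨b, by push_cast; ring⟩
    · refine fin 3 rfl fun n hn => ?_
      rw [hm n 3 hn rfl, h, h']; norm_num
    · refine fin 3 rfl fun n hn => ?_
      rw [hm n 3 hn rfl, h, h']; norm_num
    · refine fin 5 rfl fun n hn => ?_
      rw [hm n 5 hn rfl, h, h']; norm_num
  · obtain ⟨j, b1, hb1, hbe⟩ := hbf p hp
    obtain ⟨m, hm⟩ := hpa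
    haveI : Fact p.Prime := ⟨hp⟩
    have hpm : ¬ p ∣ m := by
      rintro ⟨t, ht⟩
      have := hsq p ⟨t, by rw [hm, ht]; ring⟩
      exact hp.one_lt.ne' (Nat.isUnit_iff.1 this)
    have hm0 : m ≠ 0 := by rintro rfl; simp at hpm
    have hp2 : ¬ p ∣ 4 := by
      intro h
      have h2 : p ∣ 2 := hp.dvd_of_dvd_pow (n := 2) h
      have := (Nat.prime_dvd_prime_iff_eq hp Nat.prime_two).1 h2
      rw [this] at hpo; exact absurd hpo (by decide)
    have hcop : Nat.Coprime (4 * m * b1) p := by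
      apply Nat.Coprime.symm
      rw [Nat.Prime.coprime_iff_not_dvd hp, hp.dvd_mul, hp.dvd_mul]; tauto
    obtain ⟨u, hu⟩ : ∃ u : ZMod p, quadraticChar (ZMod p) u = -1 := quadraticChar_exists_neg_one (by rw [ringChar.eq (ZMod p) p]; rintro rfl; exact absurd hpo (by decide))
    obtain ⟨n, hn1, hn2⟩ := Nat.chineseRemainder hcop 1 u.val
    have g1 : n.Coprime (4 * m * b1) := by
      have := hn1.gcd_eq; simpa [Nat.Coprime] using this
    have hn4 : n % 4 = 1 := by
      have : n ≡ 1 [MOD 4] := hn1.of_dvd ⟨m * b1, by ring⟩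
      exact this
    have hpn : J((p:ℤ) | n) = -1 := by
      rw [jacobiSym.quadratic_reciprocity_one_mod_four' hpo hn4, ← jacobiSym.legendreSym.to_jacobiSym]
      unfold legendreSym
      rw [← hu]; congr 1
      have : ((n : ℕ) : ZMod p) = ((u.val : ℕ) : ZMod p) := (ZMod.natCast_eq_natCast_iff _ _ _).2 hn2
      push_cast
      rw [this, ZMod.natCast_zmod_val]
    have hpnc : n.Coprime p := by
      by_contra hc
      have : J((p:ℤ) | n) = 0 := by
        rw [jacobiSym.eq_zero_iff]
        refine ⟨by omega, ?_⟩
        rw [Int.gcd_natCast_natCast]; rw [Nat.coprime_comm] at hc; exact hc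
      omega
    have hodd : Odd n := by rw [Nat.odd_iff]; omega
    have hmm : J(D.sign * m | n) = 1 := by
      have e : 4 * (D.sign * (m:ℤ)).natAbs = 4 * m := by
        rw [Int.natAbs_mul]; rcases hs with h | h <;> rw [h] <;> simp
      have h4 : n % (4*m) = 1 % (4*m) := hn1.of_dvd ⟨b1, by ring⟩
      rw [jacobiSym.mod_right _ hodd, e, h4, ← e, ← jacobiSym.mod_right _ odd_one, jacobiSym.one_right]
    refine ⟨n, key n ?_ ?_ ?_ ?_⟩
    · rw [hbe]; exact Nat.Coprime.mul_right (Nat.Coprime.pow_right _ hpnc) (g1.coprime_dvd_right ⟨4*m, by ring⟩)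
    · rw [hm]; exact Nat.Coprime.mul_right hpnc (g1.coprime_dvd_right ⟨4*b1, by ring⟩)
    · rw [Nat.coprime_two_right]; exact hodd
    · rw [hm]; push_cast
      rw [show D.sign * ((p:ℤ) * m) = p * (D.sign * m) by ring, jacobiSym.mul_left, hpn, hmm]; norm_num

open NumberTheorySymbols in
theorem exists_char (D : ℤ) (hD : ¬ IsSquare D) :
    ∃ χ : DirichletCharacter ℂ (4 * D.natAbs), χ ≠ 1 ∧ χ^2 = 1 ∧
      ∀ n : ℕ, n.Coprime (4 * D.natAbs) → χ (n : ZMod (4 * D.natAbs)) = ((J(D | n) : ℤ) : ℂ) := by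
  have hD0 : D ≠ 0 := by rintro rfl; exact hD ⟨0, by simp⟩
  have hq : 4 ≤ 4 * D.natAbs := by omega
  haveI : NeZero (4 * D.natAbs) := ⟨by omega⟩
  haveI : Fact (1 < 4 * D.natAbs) := ⟨by omega⟩
  have hodd : ∀ n : ℕ, n.Coprime (4 * D.natAbs) → Odd n := by
    intro n hn
    rw [← Nat.coprime_two_right]; exact hn.coprime_dvd_right ⟨2 * D.natAbs, by ring⟩
  have hval : ∀ n : ℕ, n.Coprime (4 * D.natAbs) → J(D | (n : ZMod (4 * D.natAbs)).val) = J(D | n) := by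
    intro n hn
    rw [ZMod.val_natCast, ← jacobiSym.mod_right _ (hodd n hn)]
  have hunit : ∀ a : ZMod (4 * D.natAbs), IsUnit a ↔ a.val.Coprime (4 * D.natAbs) := by
    intro a
    rw [← ZMod.isUnit_iff_coprime, ZMod.natCast_zmod_val]
  let χ : DirichletCharacter ℂ (4 * D.natAbs) :=
    { toFun := fun a => open Classical in if IsUnit a then ((J(D | a.val) : ℤ) : ℂ) else 0
      map_one' := by simp [ZMod.val_one]
      map_mul' := by
        intro a b
        by_cases ha : IsUnit a
        · by_cases hb : IsUnit b
          · have hab := ha.mul hb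
            simp only [ha, hb, hab, if_true]
            rw [ZMod.val_mul, ← jacobiSym.mod_right, jacobiSym.mul_right' _ _ _]
            · push_cast; rfl
            · exact fun h => by have := (hunit a).1 ha; rw [h] at this; simp at this
            · exact fun h => by have := (hunit b).1 hb; rw [h] at this; simp at this
            · exact (hodd _ ((hunit a).1 ha)).mul (hodd _ ((hunit b).1 hb))
          · have hab : ¬ IsUnit (a*b) := fun h => hb (isUnit_of_mul_isUnit_right h)
            simp [hb, hab]
        · have hab : ¬ IsUnit (a*b) := fun h => ha (isUnit_of_mul_isUnit_left h)
          simp [ha, hab]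
      map_nonunit' := by intro a ha; simp [ha] }
  have hχ : ∀ a : ZMod (4 * D.natAbs), IsUnit a → χ a = ((J(D | a.val) : ℤ) : ℂ) := by
    intro a ha
    show (open Classical in if IsUnit a then ((J(D | a.val) : ℤ) : ℂ) else 0) = _
    rw [if_pos ha]
  have hn : ∀ n : ℕ, n.Coprime (4 * D.natAbs) → χ (n : ZMod (4 * D.natAbs)) = ((J(D | n) : ℤ) : ℂ) := by
    intro n hn
    rw [hχ _ ((ZMod.isUnit_iff_coprime _ _).2 hn), hval n hn]
  refine ⟨χ, ?_, ?_, hn⟩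
  · intro h
    obtain ⟨n, h1, h2⟩ := exists_jac D hD
    have := hn n h1
    rw [h, h2, MulChar.one_apply ((ZMod.isUnit_iff_coprime _ _).2 h1)] at this
    norm_num at this
  · ext a
    rw [MulChar.pow_apply_coe, MulChar.one_apply_coe, hχ _ a.isUnit]
    have : J(D | (a : ZMod (4 * D.natAbs)).val) ^ 2 = 1 := by
      apply jacobiSym.sq_one
      have := (hunit a).1 a.isUnit
      rw [Int.gcd_eq_natAbs, Int.natAbs_natCast]
      exact (this.coprime_dvd_right ⟨4, by ring⟩).symm
    exact_mod_cast this

end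

section
open MeasureTheory Set Filter Topology

lemma inv_log_le {t : ℝ} (ht : 2 ≤ t) : 0 ≤ 1 / Real.log t ∧ 1 / Real.log t ≤ 2 := by
  have h2 := Real.log_two_gt_d9
  have h : Real.log 2 ≤ Real.log t := Real.log_le_log (by norm_num) ht
  refine ⟨by apply div_nonneg <;> linarith, ?_⟩
  rw [div_le_iff₀ (by linarith)]; linarith

lemma int_bd {a b : ℝ} (ha : 2 ≤ a) (hab : a ≤ b) : |∫ t in a..b, 1 / Real.log t| ≤ 2 * b := by
  have := intervalIntegral.norm_integral_le_of_norm_le_const (a := a) (b := b) (C := 2) (f := fun t => 1 / Real.log t) (by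
    intro t ht
    rw [uIoc_of_le hab] at ht
    have := inv_log_le (ha.trans ht.1.le)
    rw [Real.norm_eq_abs, abs_of_nonneg this.1]; exact this.2)
  rw [Real.norm_eq_abs, abs_of_nonneg (by linarith : 0 ≤ b - a)] at this
  linarith

lemma int_ii {a b : ℝ} (ha : 2 ≤ a) (hab : a ≤ b) : IntervalIntegrable (fun t => 1 / Real.log t) volume a b := by
  apply ContinuousOn.intervalIntegrable
  intro t ht
  rw [uIcc_of_le hab] at ht
  have : 2 ≤ t := ha.trans ht.1
  have h0 : Real.log t ≠ 0 := (Real.log_pos (by linarith)).ne'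
  exact (ContinuousAt.div continuousAt_const (Real.continuousAt_log (by linarith)) h0).continuousWithinAt

def inert (D : ℤ) : Set ℕ := {p : ℕ | ∃ hp : p.Prime, p ≠ 2 ∧ ¬ ((p : ℤ) ∣ D) ∧ @legendreSym p ⟨hp⟩ D = -1}

open Classical in
lemma ncard_inert (D : ℤ) {x : ℝ} (hx : 0 ≤ x) : (({p : ℕ | ∃ hp : p.Prime, p ≠ 2 ∧ ¬ ((p : ℤ) ∣ D) ∧
              @legendreSym p ⟨hp⟩ D = -1 ∧ (p : ℝ) ≤ x}).ncard : ℝ) = ∑ n ∈ Finset.Ioc 0 ⌊x⌋₊, (if n ∈ inert D then (1:ℝ) else 0) := by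
  rw [Finset.sum_boole, ← Set.ncard_coe_finset]
  congr 2
  ext p
  simp only [mem_setOf_eq, Finset.coe_filter, Finset.mem_Ioc, inert]
  constructor
  · rintro ⟨hp, h1, h2, h3, h4⟩
    exact ⟨⟨hp.pos, Nat.le_floor h4⟩, hp, h1, h2, h3⟩
  · rintro ⟨⟨h0, h4⟩, hp, h1, h2, h3⟩
    exact ⟨hp, h1, h2, h3, (Nat.le_floor_iff hx).1 h4⟩

open Classical in
lemma term_bd (D : ℤ) (hD : D ≠ 0) (χ : DirichletCharacter ℂ (4 * D.natAbs)) (h2 : χ^2 = 1)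
    (hχ : ∀ n : ℕ, n.Coprime (4 * D.natAbs) → χ (n : ZMod (4 * D.natAbs)) = ((jacobiSym D n : ℤ) : ℂ)) (n : ℕ) (hn : 0 < n) :
    |bb χ n / Real.log n - 2 * (if n ∈ inert D then (1:ℝ) else 0)| ≤
      (if n ∣ 4 * D.natAbs then 1 else 0) + 4 * (if ¬ n.Prime then ArithmeticFunction.vonMangoldt n else 0) := by
  haveI : NeZero (4 * D.natAbs) := ⟨by omega⟩
  by_cases hp : n.Prime
  · have hlog : Real.log n ≠ 0 := (Real.log_pos (by exact_mod_cast hp.one_lt)).ne'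
    have hbb : bb χ n / Real.log n = 1 - (χ (n : ZMod (4 * D.natAbs))).re := by
      rw [bb, ArithmeticFunction.vonMangoldt_apply_prime hp]; field_simp
    rw [hbb]
    simp only [hp, not_true_eq_false, if_false, mul_zero, add_zero]
    by_cases hd : n ∣ 4 * D.natAbs
    · have hni : n ∉ inert D := by
        rintro ⟨_, h1, h2, _⟩
        rcases (hp.dvd_mul).1 hd with h | h
        · exact h1 ((Nat.prime_dvd_prime_iff_eq hp Nat.prime_two).1 (hp.dvd_of_dvd_pow (n := 2) h))
        · exact h2 (Int.natCast_dvd.2 h)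
      have hz : χ (n : ZMod (4 * D.natAbs)) = 0 := by
        apply χ.map_nonunit
        rw [ZMod.isUnit_iff_coprime, hp.coprime_iff_not_dvd]; simpa using hd
      simp [hd, hni, hz]
    · have hc : n.Coprime (4 * D.natAbs) := (hp.coprime_iff_not_dvd).2 hd
      haveI : Fact n.Prime := ⟨hp⟩
      rw [hχ n hc, ← jacobiSym.legendreSym.to_jacobiSym]
      have hnd : ¬ ((n:ℤ) ∣ D) := fun h => hd (Dvd.dvd.mul_left (Int.natCast_dvd.1 h) 4)
      have hn2 : n ≠ 2 := by rintro rfl; exact hd ⟨2 * D.natAbs, by ring⟩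
      have hz : (D : ZMod n) ≠ 0 := by
        rwa [Ne, ZMod.intCast_zmod_eq_zero_iff_dvd]
      rcases legendreSym.eq_one_or_neg_one n hz with h | h
      · have : n ∉ inert D := by
          rintro ⟨_, _, _, h'⟩
          rw [h] at h'; norm_num at h'
        rw [h]; simp [this, hd]
      · have : n ∈ inert D := ⟨hp, hn2, hnd, h⟩
        rw [h]; simp [this, hd]; norm_num
  · have hni : n ∉ inert D := fun h => hp h.1
    simp only [hp, hni, not_false_eq_true, if_true, if_false, mul_zero, sub_zero]
    have hA : |bb χ n / Real.log n| ≤ 4 * ArithmeticFunction.vonMangoldt n := by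
      rcases Nat.lt_or_ge n 2 with h | h
      · have : n = 1 := by omega
        subst this; simp
      · have hl : Real.log 2 ≤ Real.log n := Real.log_le_log (by norm_num) (by exact_mod_cast h)
        have := Real.log_two_gt_d9
        have h0 := bb_nonneg χ n
        have hv := ArithmeticFunction.vonMangoldt_nonneg (n := n)
        rw [abs_of_nonneg (by apply div_nonneg <;> linarith), div_le_iff₀ (by linarith)]
        have h1 : bb χ n ≤ 2 * ArithmeticFunction.vonMangoldt n := by
          rw [bb, mul_comm]
          refine mul_le_mul_of_nonneg_right ?_ hv
          rcases chi_real h2 (n : ZMod (4 * D.natAbs)) with h | h | h <;> rw [h] <;> norm_num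
        nlinarith
    have : (0:ℝ) ≤ (if n ∣ 4 * D.natAbs then 1 else 0) := by split_ifs <;> norm_num
    linarith

open Classical in
lemma sum_bd (D : ℤ) (hD : D ≠ 0) (χ : DirichletCharacter ℂ (4 * D.natAbs)) (h2 : χ^2 = 1)
    (hχ : ∀ n : ℕ, n.Coprime (4 * D.natAbs) → χ (n : ZMod (4 * D.natAbs)) = ((jacobiSym D n : ℤ) : ℂ)) {x : ℝ} (hx : 1 ≤ x) (N : ℕ) :
    |∑ n ∈ Finset.Ioc N ⌊x⌋₊, bb χ n / Real.log n - 2 * ∑ n ∈ Finset.Ioc N ⌊x⌋₊, (if n ∈ inert D then (1:ℝ) else 0)| ≤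
      (4 * D.natAbs : ℕ) + 8 * (√x * Real.log x) := by
  rw [Finset.mul_sum, ← Finset.sum_sub_distrib]
  refine (Finset.abs_sum_le_sum_abs _ _).trans ?_
  have hsub : Finset.Ioc N ⌊x⌋₊ ⊆ Finset.Ioc 0 ⌊x⌋₊ := Finset.Ioc_subset_Ioc_left (Nat.zero_le _)
  have hψ := Chebyshev.psi_sub_theta_le hx
  rw [Chebyshev.psi_sub_theta_eq_sum_not_prime, Finset.sum_filter] at hψ
  calc _ ≤ ∑ n ∈ Finset.Ioc 0 ⌊x⌋₊, |bb χ n / Real.log n - 2 * (if n ∈ inert D then (1:ℝ) else 0)| :=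
        Finset.sum_le_sum_of_subset_of_nonneg hsub fun _ _ _ => abs_nonneg _
    _ ≤ ∑ n ∈ Finset.Ioc 0 ⌊x⌋₊, ((if n ∣ 4 * D.natAbs then 1 else 0) + 4 * (if ¬ n.Prime then ArithmeticFunction.vonMangoldt n else 0)) :=
        Finset.sum_le_sum fun n hn => term_bd D hD χ h2 hχ n (Finset.mem_Ioc.1 hn).1
    _ = ∑ n ∈ Finset.Ioc 0 ⌊x⌋₊, (if n ∣ 4 * D.natAbs then (1:ℝ) else 0) + 4 * ∑ n ∈ Finset.Ioc 0 ⌊x⌋₊, (if ¬ n.Prime then ArithmeticFunction.vonMangoldt n else 0) := by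
        rw [Finset.sum_add_distrib, Finset.mul_sum]
    _ ≤ _ := by
        have : ∑ n ∈ Finset.Ioc 0 ⌊x⌋₊, (if n ∣ 4 * D.natAbs then (1:ℝ) else 0) ≤ (4 * D.natAbs : ℕ) := by
          rw [Finset.sum_boole]
          norm_cast
          refine (Finset.card_le_card (t := Finset.Ioc 0 (4 * D.natAbs)) ?_).trans (by simp)
          intro n hn
          rw [Finset.mem_filter, Finset.mem_Ioc] at hn
          exact Finset.mem_Ioc.2 ⟨hn.1.1, Nat.le_of_dvd (by omega) hn.2⟩
        linarith

theorem final_density (δ : ℝ) (hδ0 : 0 < δ) (hδ1 : δ < 1) :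
    ∃ c : ℝ, 0 < c ∧ ∃ C : ℝ, 0 < C ∧
      ∀ x : ℝ, 3 ≤ x → ∀ D : ℤ,
        (D % 4 = 0 ∨ D % 4 = 1) → ¬ IsSquare D →
        (|D| : ℝ) ≤ (Real.log x) ^ ((1 : ℝ) - δ) →
        |(({p : ℕ | ∃ hp : p.Prime, p ≠ 2 ∧ ¬ ((p : ℤ) ∣ D) ∧
              @legendreSym p ⟨hp⟩ D = -1 ∧ (p : ℝ) ≤ x}).ncard : ℝ) -
            (1 / 2) * ∫ t in (2 : ℝ)..x, 1 / Real.log t| ≤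
          C * x * Real.exp (-c * Real.sqrt (Real.log x)) := by
  classical
  obtain ⟨c, hc, C, hC, L0, hL0, hW⟩ := weighted δ hδ0 hδ1
  refine ⟨min c (1/4), by positivity, C + 64 + 2 * Real.exp (√L0), by positivity, ?_⟩
  set c' := min c (1/4) with hc'
  have hcc : c' ≤ c := min_le_left _ _
  have hc4 : c' ≤ 1/4 := min_le_right _ _
  clear_value c'
  intro x hx D _ hD hDx
  have hx0 : 0 < x := by linarith
  have hD0 : D ≠ 0 := by rintro rfl; exact hD ⟨0, by simp⟩
  rw [ncard_inert D hx0.le]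
  set L := Real.log x with hLd
  have hL1 : 0 < L := Real.log_pos (by linarith)
  have hfl : (⌊x⌋₊ : ℝ) ≤ x := Nat.floor_le hx0.le
  have hcnt : ∀ M : ℕ, 0 ≤ ∑ n ∈ Finset.Ioc 0 M, (if n ∈ inert D then (1:ℝ) else 0) ∧ ∑ n ∈ Finset.Ioc 0 M, (if n ∈ inert D then (1:ℝ) else 0) ≤ M := by
    intro M
    refine ⟨Finset.sum_nonneg fun n _ => by split_ifs <;> norm_num, ?_⟩
    rw [Finset.sum_boole]
    norm_cast
    exact (Finset.card_filter_le _ _).trans (by simp)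
  set E := Real.exp (-c' * √L) with hE
  have hE0 : 0 < E := Real.exp_pos _
  rcases lt_or_ge L L0 with hs | hs
  · have h1 := hcnt ⌊x⌋₊
    have h2 := int_bd le_rfl (by linarith : (2:ℝ) ≤ x)
    rw [abs_le] at h2
    have h3 : 1 ≤ Real.exp (√L0) * E := by
      rw [hE, ← Real.exp_add]
      apply Real.one_le_exp
      have : √L ≤ √L0 := Real.sqrt_le_sqrt hs.le
      have := Real.sqrt_nonneg L
      nlinarith
    have h4 : 2 * x ≤ (C + 64 + 2 * Real.exp (√L0)) * x * E := by
      have : 0 ≤ (C + 64) * x * E := by positivity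
      nlinarith
    have h5 : 0 ≤ ∫ t in (2:ℝ)..x, 1 / Real.log t := by
      apply intervalIntegral.integral_nonneg (by linarith)
      intro t ht; exact (inv_log_le ht.1).1
    refine le_trans ?_ h4
    rw [abs_le]; constructor <;> linarith
  · obtain ⟨χ, hχ1, hχ2, hχ⟩ := exists_char D hD
    haveI : NeZero (4 * D.natAbs) := ⟨by omega⟩
    have hq : ((4 * D.natAbs : ℕ) : ℝ) ≤ 4 * L^(1-δ) := by
      have : ((D.natAbs : ℕ) : ℝ) = |(D:ℝ)| := by rw [Nat.cast_natAbs]; push_cast; rfl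
      push_cast; rw [this]; linarith
    have hqL : ((4 * D.natAbs : ℕ) : ℝ) ≤ 4 * L := by
      refine hq.trans ?_
      have := Real.rpow_le_rpow_of_exponent_le (by linarith : 1 ≤ L) (by linarith : 1 - δ ≤ 1)
      rw [Real.rpow_one] at this; linarith
    have hw := hW x (by linarith) hs (4 * D.natAbs) χ hχ1 hχ2 hq
    have hS := sum_bd D hD0 χ hχ2 hχ (by linarith : 1 ≤ x) ⌊√x⌋₊
    have hz2 : 2 ≤ √x := by
      apply Real.le_sqrt_of_sq_le
      have := Real.log_le_sub_one_of_pos hx0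
      linarith
    have hzx : √x ≤ x := by
      have := Real.sq_sqrt hx0.le; nlinarith
    have hsplit : ∑ n ∈ Finset.Ioc 0 ⌊x⌋₊, (if n ∈ inert D then (1:ℝ) else 0) = ∑ n ∈ Finset.Ioc 0 ⌊√x⌋₊, (if n ∈ inert D then (1:ℝ) else 0) + ∑ n ∈ Finset.Ioc ⌊√x⌋₊ ⌊x⌋₊, (if n ∈ inert D then (1:ℝ) else 0) :=
      (Finset.sum_Ioc_consecutive _ (Nat.zero_le _) (Nat.floor_le_floor hzx)).symm
    have hint := intervalIntegral.integral_add_adjacent_intervals (int_ii le_rfl hz2) (int_ii hz2 hzx)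
    have hi := int_bd le_rfl hz2
    have hcz := hcnt ⌊√x⌋₊
    have hfz : (⌊√x⌋₊ : ℝ) ≤ √x := Nat.floor_le (by linarith)
    have hLE : √x * L ≤ 4 * x * E := by
      have hxe : x = Real.exp L := (Real.exp_log hx0).symm
      have e1 : √x = Real.exp (L/2) := by rw [hxe, ← Real.exp_half]
      have e2 : L ≤ 4 * Real.exp (L/4) := by linarith [Real.add_one_le_exp (L/4)]
      have e3 : √L ≤ L := by
        have := Real.sq_sqrt hL1.le
        have h1 : 1 ≤ √L := Real.one_le_sqrt.2 (by linarith)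
        nlinarith
      calc √x * L ≤ Real.exp (L/2) * (4 * Real.exp (L/4)) := by rw [e1]; gcongr
        _ = 4 * (Real.exp (L/2) * Real.exp (L/4)) := by ring
        _ = 4 * Real.exp (L/2 + L/4) := by rw [Real.exp_add]
        _ ≤ 4 * Real.exp (L + -c' * √L) := by
          have : c' * √L ≤ 1/4 * L := mul_le_mul hc4 e3 (Real.sqrt_nonneg _) (by norm_num)
          have := Real.exp_le_exp.2 (by linarith : L/2 + L/4 ≤ L + -c' * √L)
          linarith
        _ = 4 * x * E := by rw [Real.exp_add, ← hxe]; ring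
    have hWE : C * x * Real.exp (-c * √L) ≤ C * x * E := by
      apply mul_le_mul_of_nonneg_left _ (by positivity)
      apply Real.exp_le_exp.2
      have := Real.sqrt_nonneg L
      nlinarith
    have hzL : 4 * √x ≤ √x * L := by nlinarith
    have hLz : 2 * L ≤ √x * L := by nlinarith
    have hpos : 0 ≤ 2 * Real.exp (√L0) * x * E := by positivity
    have hxE : 0 ≤ x * E := by positivity
    have hCxE : 0 ≤ C * x * E := by positivity
    have : (C + 64 + 2 * Real.exp (√L0)) * x * E = C * x * E + 64 * (x * E) + 2 * Real.exp (√L0) * x * E := by ring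
    rw [this, hsplit, ← hint]
    rw [abs_le] at hw hS hi ⊢
    have : 4 * x * E = 4 * (x * E) := by ring
    constructor <;> linarith [hw.1, hw.2, hS.1, hS.2, hi.1, hi.2, hcz.1, hcz.2]

end



/-- Uniform density of primes p with Legendre symbol (D/p) = −1:
for 0 < δ < 1 there are constants c, C > 0 such that for all x ≥ 3 and all
non-square discriminants D (D ≡ 0, 1 mod 4) with |D| ≤ (log x)^{1−δ},
|π₀(x) − (1/2) Li(x)| ≤ C·x·exp(−c √(log x)), uniformly in D. -/
theorem uniform_density_of_inert_primes (δ : ℝ) (hδ0 : 0 < δ) (hδ1 : δ < 1) :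
    ∃ c : ℝ, 0 < c ∧ ∃ C : ℝ, 0 < C ∧
      ∀ x : ℝ, 3 ≤ x → ∀ D : ℤ,
        (D % 4 = 0 ∨ D % 4 = 1) → ¬ IsSquare D →
        (|D| : ℝ) ≤ (Real.log x) ^ ((1 : ℝ) - δ) →
        |(({p : ℕ | ∃ hp : p.Prime, p ≠ 2 ∧ ¬ ((p : ℤ) ∣ D) ∧
              @legendreSym p ⟨hp⟩ D = -1 ∧ (p : ℝ) ≤ x}).ncard : ℝ) -
            (1 / 2) * ∫ t in (2 : ℝ)..x, 1 / Real.log t| ≤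
          C * x * Real.exp (-c * Real.sqrt (Real.log x)) := by
  exact final_density δ hδ0 hδ1
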